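/- arXiv:2311.13441 — 2 statements merged into one kernel-verified Lean document; each statement's English description precedes it below -/
import Mathlib

section
/- Let {c_n}_{n≥1} be a non-decreasing sequence of positive reals with N_c(T) := #{n : c_n ∈ (0,T]} satisfying N_c(T) ~ T as T → ∞, and let ξ_T be the random measure Σ_{n≥1} δ_{c_n − t} with t chosen uniformly from (0,T]. Let ξ be a stationary simple point process on ℝ with intensity 1, and let ξ^0 be its Palm process. Then the following are equivalent: (i) ξ_T converges in distribution to ξ as T → ∞; (ii) for every positive integer K, the random vectors (c_{n+1}−c_n, c_{n+2}−c_n, ..., c_{n+K}−c_n), with n chosen uniformly from {1,...,N}, converge in distribution as N → ∞ to (x_1(ξ^0), x_2(ξ^0), ..., x_K(ξ^0)). -/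
open MeasureTheory Filter Topology Bornology

/-- The labeled points of a locally finite integer-valued measure on `ℝ`:
`x_n(ξ) = inf {x > 0 : ξ(0,x] ≥ n}` for `n > 0` and
`x_n(ξ) = sup {x ≤ 0 : ξ(x,0] ≥ -n+1}` for `n ≤ 0`. -/
noncomputable def xLabel (μ : MeasureTheory.Measure ℝ) (n : ℤ) : ℝ :=
  if 0 < n then sInf {x : ℝ | 0 < x ∧ (n.toNat : ENNReal) ≤ μ (Set.Ioc 0 x)}
  else sSup {x : ℝ | x ≤ 0 ∧ ((1 - n).toNat : ENNReal) ≤ μ (Set.Ioc x 0)}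

/-- A locally finite nonnegative-integer-valued Borel measure on `ℝ`. -/
def IsPointMeasure (μ : MeasureTheory.Measure ℝ) : Prop :=
  ∀ B : Set ℝ, MeasurableSet B → IsBounded B → ∃ m : ℕ, μ B = m

/-- `μ` is infinite in both directions. -/
def InfiniteBothDirections (μ : MeasureTheory.Measure ℝ) : Prop :=
  μ (Set.Iio 0) = ⊤ ∧ μ (Set.Ioi 0) = ⊤

/-- The translation `θ^s ν` of a measure, with `θ^s ν (B) = ν (B + s)`. -/
noncomputable def translateMeasure (s : ℝ) (ν : MeasureTheory.Measure ℝ) :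
    MeasureTheory.Measure ℝ :=
  ν.map (fun x => x - s)

/-- A random measure is stationary if all its translates have the same distribution. -/
def Stationary {Ω : Type*} [MeasurableSpace Ω] (P : MeasureTheory.Measure Ω)
    (ξ : Ω → MeasureTheory.Measure ℝ) : Prop :=
  ∀ s : ℝ, P.map (fun ω => translateMeasure s (ξ ω)) = P.map ξ

/-- A stationary point process has intensity `I` if `E[ξ(B)] = I · |B|` for Borel `B`. -/
def HasIntensity {Ω : Type*} [MeasurableSpace Ω] (P : MeasureTheory.Measure Ω)
    (ξ : Ω → MeasureTheory.Measure ℝ) (I : ENNReal) : Prop :=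
  ∀ B : Set ℝ, MeasurableSet B → ∫⁻ ω, ξ ω B ∂P = I * MeasureTheory.volume B

/-- `ξ0` (on `(Ω', P')`) is a Palm process of the stationary point process `ξ` (on `(Ω, P)`)
with intensity `I`: `P(ξ0 ∈ E) = I⁻¹ E[∫_(0,1] 1_E(θ^s ξ) dξ(s)]` for measurable `E`. -/
def IsPalmOf {Ω Ω' : Type*} [MeasurableSpace Ω] [MeasurableSpace Ω']
    (P : MeasureTheory.Measure Ω) (ξ : Ω → MeasureTheory.Measure ℝ)
    (P' : MeasureTheory.Measure Ω') (ξ0 : Ω' → MeasureTheory.Measure ℝ)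
    (I : ENNReal) : Prop :=
  ∀ E : Set (MeasureTheory.Measure ℝ), MeasurableSet E →
    P' {ω' | ξ0 ω' ∈ E} =
      I⁻¹ * ∫⁻ ω, (∫⁻ s in Set.Ioc (0 : ℝ) 1,
        E.indicator (fun _ => (1 : ENNReal)) (translateMeasure s (ξ ω)) ∂(ξ ω)) ∂P

/-- `N_c(T) = #{n ≥ 1 : c_n ∈ (0,T]}`. -/
noncomputable def Ncount (c : ℕ → ℝ) (T : ℝ) : ℕ :=
  Nat.card {n : ℕ | 1 ≤ n ∧ c n ∈ Set.Ioc (0 : ℝ) T}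

/-- The periodized points `c̆_{m + rN} = c_m + r·T` for `1 ≤ m ≤ N`, `r ∈ ℤ`,
where `N = N_c(T)`: the points `c_1, ..., c_N` of `(0,T]` tessellated by translates of `T`. -/
noncomputable def cbr (c : ℕ → ℝ) (T : ℝ) (n : ℤ) : ℝ :=
  c (((n - 1) % (Ncount c T : ℤ)).toNat + 1) + (((n - 1) / (Ncount c T : ℤ) : ℤ) : ℝ) * T

open Classical in
/-- The linear statistic `Σ_{n ≥ 1} f(c_n − t)` of the configuration `{c_n − t}_{n ≥ 1}`. -/
noncomputable def seqStat (c : ℕ → ℝ) (f : ℝ → ℝ) (t : ℝ) : ℝ :=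
  ∑' n : ℕ, if 1 ≤ n then f (c n - t) else 0

/-- The linear statistic `Σ_{n ∈ ℤ} f(c̆_n − t)` of the periodized configuration. -/
noncomputable def brStat (c : ℕ → ℝ) (T : ℝ) (f : ℝ → ℝ) (t : ℝ) : ℝ :=
  ∑' n : ℤ, f (cbr c T n - t)

namespace SpacingPalm

section Jump

variable {E : Type*} [NormedAddCommGroup E]

/-- The sum of `f` over the points `y i`, translated by `s`. -/
noncomputable def fwdSum (f : ℝ → E) (y : ℕ → ℝ) (s : ℝ) : E := ∑' i, f (y i + s)

theorem fwdSum_eq_sum {f : ℝ → E} {y : ℕ → ℝ} {s : ℝ} (n : ℕ)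
    (h : ∀ i, n ≤ i → f (y i + s) = 0) :
    fwdSum f y s = ∑ i ∈ Finset.range n, f (y i + s) :=
  tsum_eq_sum fun i hi => h i (by simpa using hi)

theorem continuous_fwdSum {f : ℝ → E} {y : ℕ → ℝ} {A : ℝ} (hf : Continuous f)
    (hA : ∀ x, A < |x| → f x = 0) (hy : Tendsto y atTop atTop) :
    Continuous (fwdSum f y) := by
  rw [continuous_iff_continuousAt]
  intro s₀
  obtain ⟨n, hn⟩ := eventually_atTop.1 (hy.eventually_gt_atTop (A - s₀ + 1))
  have hev : fwdSum f y =ᶠ[𝓝 s₀] fun s => ∑ i ∈ Finset.range n, f (y i + s) := by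
    filter_upwards [Ioi_mem_nhds (show s₀ - 1 < s₀ by linarith)] with s hs
    refine fwdSum_eq_sum n fun i hi => hA _ ?_
    have := hn i hi
    have hs' : s₀ - 1 < s := hs
    exact lt_of_lt_of_le (by linarith) (le_abs_self _)
  refine ContinuousAt.congr ?_ hev.symm
  fun_prop

/-- The change of `G` of a linear statistic when the point at the origin is added to the points
`y i`, everything being translated by `s`. -/
noncomputable def jump (G : BoundedContinuousFunction E ℝ) (f : ℝ → E) (y : ℕ → ℝ) (s : ℝ) : ℝ :=
  G (f s + fwdSum f y s) - G (fwdSum f y s)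

/-- The total change of `G` of a linear statistic when the point at the origin is added. -/
noncomputable def jumpInt (G : BoundedContinuousFunction E ℝ) (f : ℝ → E) (y : ℕ → ℝ) : ℝ :=
  ∫ s, jump G f y s

theorem abs_sub_le_two_norm (G : BoundedContinuousFunction E ℝ) (a b : E) :
    |G a - G b| ≤ 2 * ‖G‖ := by
  have h := G.dist_le_two_norm a b
  rwa [Real.dist_eq] at h

theorem abs_jump_le (G : BoundedContinuousFunction E ℝ) (f : ℝ → E) (y : ℕ → ℝ) (s : ℝ) :
    |jump G f y s| ≤ 2 * ‖G‖ :=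
  abs_sub_le_two_norm G _ _

theorem jump_eq_zero (G : BoundedContinuousFunction E ℝ) {f : ℝ → E} (y : ℕ → ℝ) {s : ℝ}
    (h : f s = 0) : jump G f y s = 0 := by
  simp [jump, h]

theorem continuous_jump (G : BoundedContinuousFunction E ℝ) {f : ℝ → E} {y : ℕ → ℝ} {A : ℝ}
    (hf : Continuous f) (hA : ∀ x, A < |x| → f x = 0) (hy : Tendsto y atTop atTop) :
    Continuous (jump G f y) := by
  have := continuous_fwdSum hf hA hy
  unfold jump
  fun_prop

end Jump

theorem integrable_of_bounded_support {φ : ℝ → ℝ} {A B : ℝ}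
    (hc : AEStronglyMeasurable φ volume) (hB : ∀ s, |φ s| ≤ B) (hA : ∀ s, A < |s| → φ s = 0) :
    Integrable φ := by
  have h1 : IntegrableOn φ (Set.Icc (-A) A) :=
    Measure.integrableOn_of_bounded (M := B) (by simp) hc (ae_of_all _ hB)
  refine (integrableOn_iff_integrable_of_support_subset ?_).1 h1
  intro s hs
  by_contra h
  exact hs (hA s (by
    by_contra h'
    exact h (abs_le.1 (not_lt.1 h'))))

theorem integral_abs_le_of_bounded_support {φ : ℝ → ℝ} {A B : ℝ} (hA0 : 0 ≤ A)
    (hc : AEStronglyMeasurable φ volume) (hB : ∀ s, |φ s| ≤ B) (hA : ∀ s, A < |s| → φ s = 0) :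
    ∫ s, |φ s| ≤ 2 * A * B := by
  have h1 : ∫ s, |φ s| = ∫ s in Set.Icc (-A) A, |φ s| := by
    refine (setIntegral_eq_integral_of_forall_compl_eq_zero fun s hs => ?_).symm
    rw [hA s (by by_contra h'; exact hs (abs_le.1 (not_lt.1 h'))), abs_zero]
  rw [h1]
  have hi := (integrable_of_bounded_support hc hB hA).abs
  calc ∫ s in Set.Icc (-A) A, |φ s| ≤ ∫ s in Set.Icc (-A) A, B :=
        setIntegral_mono hi.integrableOn (integrableOn_const (by simp)) hB
    _ = 2 * A * B := by
        rw [setIntegral_const, Real.volume_real_Icc_of_le (by linarith), smul_eq_mul]; ring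

section Counting

variable {d : ℕ → ℝ} {N : ℝ → ℕ}

theorem count_mono (hdN : ∀ n T, n < N T ↔ d n ≤ T) : Monotone N := by
  intro a b hab
  by_contra h
  rw [not_le] at h
  exact lt_irrefl _ ((hdN _ _).2 (((hdN _ _).1 h).trans hab))

theorem tendsto_points_atTop (hdN : ∀ n T, n < N T ↔ d n ≤ T) : Tendsto d atTop atTop := by
  refine tendsto_atTop.2 fun b => ?_
  filter_upwards [eventually_ge_atTop (N b)] with n hn
  by_contra h
  exact absurd ((hdN n b).2 (le_of_lt (not_le.1 h))) (not_lt.2 hn)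

theorem tendsto_count_shift (hN : Tendsto (fun T => (N T : ℝ) / T) atTop (𝓝 1)) (a : ℝ) :
    Tendsto (fun T => (N (T + a) : ℝ) / T) atTop (𝓝 1) := by
  have h1 : Tendsto (fun T : ℝ => (N (T + a) : ℝ) / (T + a)) atTop (𝓝 1) :=
    hN.comp (tendsto_atTop_add_const_right _ a tendsto_id)
  have h2 : Tendsto (fun T : ℝ => 1 + a / T) atTop (𝓝 (1 + 0)) :=
    tendsto_const_nhds.add (tendsto_const_nhds.div_atTop tendsto_id)
  have h3 := h1.mul h2
  simp only [add_zero, mul_one] at h3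
  refine h3.congr' ?_
  filter_upwards [eventually_gt_atTop 0, eventually_gt_atTop (-a)] with T hT hTa
  have : T + a ≠ 0 := by linarith
  field_simp

theorem abs_interval_sub_integral_le {φ : ℝ → ℝ} {A B : ℝ} (hA0 : 0 ≤ A)
    (hc : AEStronglyMeasurable φ volume) (hB : ∀ s, |φ s| ≤ B) (hA : ∀ s, A < |s| → φ s = 0)
    (x T : ℝ) (hT : 0 ≤ T) : |∫ t in (0:ℝ)..T, φ (x - t)| ≤ 2 * A * B := by
  rw [intervalIntegral.integral_comp_sub_left (fun s => φ s) x,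
    intervalIntegral.integral_of_le (by linarith)]
  refine (abs_integral_le_integral_abs).trans ?_
  refine le_trans ?_ (integral_abs_le_of_bounded_support hA0 hc hB hA)
  exact setIntegral_le_integral (integrable_of_bounded_support hc hB hA).abs
    (ae_of_all _ fun s => abs_nonneg _)

theorem interval_eq_integral {φ : ℝ → ℝ} {A : ℝ} (hA : ∀ s, A < |s| → φ s = 0)
    {x T : ℝ} (hT : 0 ≤ T) (h1 : A < x) (h2 : x < T - A) :
    ∫ t in (0:ℝ)..T, φ (x - t) = ∫ s, φ s := by
  rw [intervalIntegral.integral_comp_sub_left (fun s => φ s) x,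
    intervalIntegral.integral_of_le (by linarith)]
  refine setIntegral_eq_integral_of_forall_compl_eq_zero fun s hs => hA s ?_
  by_contra h
  have := abs_le.1 (not_lt.1 h)
  exact hs ⟨by linarith, by linarith⟩

theorem tendsto_average_swap (hdN : ∀ n T, n < N T ↔ d n ≤ T)
    (hN : Tendsto (fun T => (N T : ℝ) / T) atTop (𝓝 1))
    {φ : ℕ → ℝ → ℝ} {A B : ℝ} (hA0 : 0 ≤ A) (hc : ∀ n, Continuous (φ n))
    (hB : ∀ n s, |φ n s| ≤ B) (hA : ∀ n s, A < |s| → φ n s = 0) :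
    Tendsto (fun T => ((∫ t in (0:ℝ)..T, ∑ n ∈ Finset.range (N (T + A)), φ n (d n - t)) -
      ∑ n ∈ Finset.range (N T), ∫ s, φ n s) / T) atTop (𝓝 0) := by
  have hlim : Tendsto (fun T => 4 * A * B *
      ((N A : ℝ) / T + ((N (T + A) : ℝ) / T - (N (T + (-(A + 1))) : ℝ) / T))) atTop (𝓝 0) := by
    have := (((tendsto_const_nhds (x := (N A : ℝ))).div_atTop tendsto_id).add
      ((tendsto_count_shift hN A).sub (tendsto_count_shift hN (-(A+1))))).const_mul (4 * A * B)
    simpa using this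
  refine squeeze_zero_norm' ?_ hlim
  filter_upwards [eventually_gt_atTop 0] with T hT
  have hm := count_mono hdN
  have e1 : ∫ t in (0:ℝ)..T, ∑ n ∈ Finset.range (N (T + A)), φ n (d n - t) =
      ∑ n ∈ Finset.range (N (T + A)), ∫ t in (0:ℝ)..T, φ n (d n - t) := by
    refine intervalIntegral.integral_finsetSum fun n _ => ?_
    have := hc n
    exact Continuous.intervalIntegrable (by fun_prop) _ _
  have e2 : ∑ n ∈ Finset.range (N T), ∫ s, φ n s =
      ∑ n ∈ Finset.range (N (T + A)), if n < N T then ∫ s, φ n s else 0 := by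
    rw [← Finset.sum_filter]
    refine Finset.sum_congr ?_ fun _ _ => rfl
    ext n
    simp only [Finset.mem_range, Finset.mem_filter]
    have := hm (show T ≤ T + A by linarith)
    omega
  have hB0 : 0 ≤ B := (abs_nonneg _).trans (hB 0 0)
  rw [e1, e2, ← Finset.sum_sub_distrib, Real.norm_eq_abs, abs_div, abs_of_pos hT]
  have key : ∀ n ∈ Finset.range (N (T + A)),
      |(∫ t in (0:ℝ)..T, φ n (d n - t)) - if n < N T then ∫ s, φ n s else 0| ≤
      4 * A * B * ((if n < N A then 1 else 0) + (if N (T + (-(A+1))) ≤ n then 1 else 0)) := by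
    intro n _
    have b1 := abs_interval_sub_integral_le hA0 (hc n).aestronglyMeasurable (hB n) (hA n) (d n) T
      hT.le
    have b2 : |if n < N T then ∫ s, φ n s else 0| ≤ 2 * A * B := by
      split_ifs
      · exact abs_integral_le_integral_abs.trans
          (integral_abs_le_of_bounded_support hA0 (hc n).aestronglyMeasurable (hB n) (hA n))
      · simp only [abs_zero]; positivity
    have hAB : 0 ≤ A * B := by positivity
    have b3 := abs_sub (∫ t in (0:ℝ)..T, φ n (d n - t)) (if n < N T then ∫ s, φ n s else 0)
    by_cases h1 : n < N A
    · rw [if_pos h1]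
      have h01 : (0:ℝ) ≤ if N (T + (-(A+1))) ≤ n then 1 else 0 := by split_ifs <;> norm_num
      nlinarith
    · by_cases h2 : N (T + (-(A+1))) ≤ n
      · rw [if_neg h1, if_pos h2]
        nlinarith
      · rw [if_neg h1, if_neg h2]
        have h1' : A < d n := by
          by_contra h; exact h1 ((hdN n A).2 (not_lt.1 h))
        have h2' := (hdN n _).1 (not_le.1 h2)
        have h3 : n < N T := (hdN n T).2 (by linarith)
        rw [if_pos h3, interval_eq_integral (hA n) hT.le h1' (by linarith)]
        simp
  have hle : N (T + (-(A+1))) ≤ N (T + A) := hm (by linarith)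
  have s1 : (∑ n ∈ Finset.range (N (T + A)), if n < N A then (1:ℝ) else 0) ≤ N A := by
    rw [Finset.sum_boole]
    have : ((Finset.range (N (T + A))).filter (fun n => n < N A)).card ≤
        (Finset.range (N A)).card :=
      Finset.card_le_card fun n hn => by simpa using (Finset.mem_filter.1 hn).2
    rw [Finset.card_range] at this
    exact_mod_cast this
  have s2 : (∑ n ∈ Finset.range (N (T + A)), if N (T + (-(A+1))) ≤ n then (1:ℝ) else 0) ≤
      N (T + A) - N (T + (-(A+1))) := by
    rw [Finset.sum_boole]
    have : ((Finset.range (N (T + A))).filter (fun n => N (T + (-(A+1))) ≤ n)).card ≤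
        (Finset.Ico (N (T + (-(A+1)))) (N (T + A))).card :=
      Finset.card_le_card fun n hn => by
        simp only [Finset.mem_filter, Finset.mem_range] at hn
        exact Finset.mem_Ico.2 ⟨hn.2, hn.1⟩
    rw [Nat.card_Ico] at this
    rw [← Nat.cast_sub hle]
    exact_mod_cast this
  have hfin := (Finset.abs_sum_le_sum_abs _ _).trans (Finset.sum_le_sum key)
  rw [← Finset.mul_sum, Finset.sum_add_distrib] at hfin
  have : 4 * A * B * ((N A : ℝ) / T + ((N (T + A) : ℝ) / T - (N (T + (-(A + 1))) : ℝ) / T)) =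
    4 * A * B * ((N A : ℝ) + (N (T + A) - (N (T + (-(A + 1))) : ℝ))) / T := by ring
  rw [this]
  refine div_le_div_of_nonneg_right (hfin.trans ?_) hT.le
  refine mul_le_mul_of_nonneg_left (add_le_add s1 s2) (by positivity)

theorem tendsto_average_floor (hN : Tendsto (fun T => (N T : ℝ) / T) atTop (𝓝 1))
    {a : ℕ → ℝ} {B : ℝ} (hB : ∀ n, |a n| ≤ B) :
    Tendsto (fun T : ℝ => ((∑ n ∈ Finset.range (N T), a n) -
      ∑ n ∈ Finset.range ⌊T⌋₊, a n) / T) atTop (𝓝 0) := by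
  have hlim : Tendsto (fun T : ℝ => B * |(N T : ℝ) / T - (⌊T⌋₊ : ℝ) / T|) atTop (𝓝 0) := by
    have := ((hN.sub (tendsto_nat_floor_div_atTop (R := ℝ))).abs).const_mul B
    simpa using this
  refine squeeze_zero_norm' ?_ hlim
  filter_upwards [eventually_gt_atTop 0] with T hT
  have gen : ∀ m n : ℕ, |(∑ i ∈ Finset.range m, a i) - ∑ i ∈ Finset.range n, a i| ≤
      B * |(m : ℝ) - n| := by
    have aux : ∀ m n : ℕ, m ≤ n → |(∑ i ∈ Finset.range m, a i) - ∑ i ∈ Finset.range n, a i| ≤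
      B * |(m : ℝ) - n| := by
      intro m n hmn
      rw [abs_sub_comm, ← Finset.sum_Ico_eq_sub _ hmn, abs_sub_comm (m : ℝ) n,
        abs_of_nonneg (a := (n : ℝ) - m) (by simpa using hmn), ← Nat.cast_sub hmn]
      refine (Finset.abs_sum_le_sum_abs _ _).trans ?_
      refine (Finset.sum_le_card_nsmul _ _ B fun i _ => hB i).trans ?_
      rw [Nat.card_Ico, nsmul_eq_mul, mul_comm]
    intro m n
    rcases le_total m n with h | h
    · exact aux m n h
    · rw [abs_sub_comm, abs_sub_comm (m : ℝ)]; exact aux n m h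
  rw [Real.norm_eq_abs, abs_div, abs_of_pos hT, ← sub_div, abs_div, abs_of_pos hT, mul_div_assoc']
  exact div_le_div_of_nonneg_right (gen _ _) hT.le

end Counting

end SpacingPalm

namespace SpacingPalm

theorem finite_points {c : ℕ → ℝ} (hN : Tendsto (fun T => (Ncount c T : ℝ) / T) atTop (𝓝 1))
    (T : ℝ) : {n : ℕ | 1 ≤ n ∧ c n ∈ Set.Ioc (0 : ℝ) T}.Finite := by
  have h1 : ∀ᶠ T in atTop, 0 < (Ncount c T : ℝ) / T := hN.eventually (lt_mem_nhds one_pos)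
  obtain ⟨T', hT', hTT'⟩ := (h1.and (eventually_ge_atTop T)).exists
  have h2 : Ncount c T' ≠ 0 := by
    intro h
    simp [h] at hT'
  have h3 : {n : ℕ | 1 ≤ n ∧ c n ∈ Set.Ioc (0 : ℝ) T'}.Finite := by
    by_contra h
    have : Infinite {n : ℕ | 1 ≤ n ∧ c n ∈ Set.Ioc (0 : ℝ) T'} := Set.infinite_coe_iff.2 h
    exact h2 Nat.card_eq_zero_of_infinite
  exact h3.subset fun n hn => ⟨hn.1, hn.2.1, hn.2.2.trans hTT'⟩

theorem lt_Ncount_iff {c : ℕ → ℝ} (hmono : Monotone c) (hpos : ∀ n : ℕ, 1 ≤ n → 0 < c n)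
    (hN : Tendsto (fun T => (Ncount c T : ℝ) / T) atTop (𝓝 1)) (n : ℕ) (T : ℝ) :
    n < Ncount c T ↔ c (n + 1) ≤ T := by
  have hfin := finite_points hN T
  have hcard : Ncount c T = {n : ℕ | 1 ≤ n ∧ c n ∈ Set.Ioc (0 : ℝ) T}.ncard := rfl
  constructor
  · intro h
    by_contra hc
    rw [not_le] at hc
    have hsub : {n : ℕ | 1 ≤ n ∧ c n ∈ Set.Ioc (0 : ℝ) T} ⊆ (Finset.Icc 1 n : Finset ℕ) := by
      intro m hm
      have : ¬ n + 1 ≤ m := fun h' => absurd (hmono h') (not_le.2 (hm.2.2.trans_lt hc))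
      simpa using ⟨hm.1, by omega⟩
    have := Set.ncard_le_ncard hsub (Finset.finite_toSet _)
    rw [Set.ncard_coe_finset, Nat.card_Icc] at this
    omega
  · intro h
    have hsub : ((Finset.Icc 1 (n + 1) : Finset ℕ) : Set ℕ) ⊆
        {n : ℕ | 1 ≤ n ∧ c n ∈ Set.Ioc (0 : ℝ) T} := by
      intro m hm
      have hm' : 1 ≤ m ∧ m ≤ n + 1 := by simpa using hm
      exact ⟨hm'.1, hpos m hm'.1, (hmono hm'.2).trans h⟩
    have := Set.ncard_le_ncard hsub hfin
    rw [Set.ncard_coe_finset, Nat.card_Icc] at this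
    omega

/-- The spacings between the `n`-th point of a sequence and the following ones. -/
def gaps (d : ℕ → ℝ) (n i : ℕ) : ℝ := d (n + i + 1) - d n

theorem tendsto_gaps {d : ℕ → ℝ} (hd : Tendsto d atTop atTop) (n : ℕ) :
    Tendsto (gaps d n) atTop atTop := by
  refine tendsto_atTop_add_const_right _ (-d n) (hd.comp ?_)
  exact tendsto_atTop_mono (fun i => show i ≤ n + i + 1 by omega) tendsto_id

section

variable {E : Type*} [NormedAddCommGroup E] {f : ℝ → E} {A : ℝ} {d : ℕ → ℝ}

theorem fwdSum_succ (hA : ∀ x, A < |x| → f x = 0) (hd : Tendsto d atTop atTop) (s : ℝ) :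
    fwdSum f d s = f (d 0 + s) + fwdSum f (fun i => d (i + 1)) s := by
  obtain ⟨n, hn⟩ := eventually_atTop.1 (hd.eventually_gt_atTop (A - s))
  have hs : Summable fun i => f (d i + s) := by
    refine summable_of_ne_finset_zero (s := Finset.range n) fun i hi => hA _ ?_
    have := hn i (by simpa using hi)
    exact lt_of_lt_of_le (by linarith) (le_abs_self _)
  exact hs.tsum_eq_zero_add

theorem comp_fwdSum_eq_sum_jump (G : BoundedContinuousFunction E ℝ)
    (hA : ∀ x, A < |x| → f x = 0) (hd : Tendsto d atTop atTop) (t : ℝ) (M : ℕ)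
    (hM : ∀ n, M ≤ n → A < d n - t) :
    G (fwdSum f d (-t)) = G 0 + ∑ n ∈ Finset.range M, jump G f (gaps d n) (d n - t) := by
  have hsh : ∀ n, Tendsto (fun i => d (n + i)) atTop atTop := fun n =>
    hd.comp (tendsto_atTop_mono (fun i => by simp) tendsto_id)
  set b : ℕ → E := fun n => fwdSum f (fun i => d (n + i)) (-t) with hb
  have hg : ∀ n, fwdSum f (gaps d n) (d n - t) = b (n + 1) := by
    intro n
    simp only [hb, fwdSum, gaps]
    congr 1
    ext i
    congr 1
    rw [show n + 1 + i = n + i + 1 by ring]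
    ring
  have hb1 : ∀ n, b n = f (d n - t) + b (n + 1) := by
    intro n
    simp only [hb]
    rw [fwdSum_succ hA (hsh n)]
    simp only [add_zero, ← sub_eq_add_neg, ← add_assoc]
    congr 3
    ext i
    congr 1
    ring
  have hbM : b M = 0 := by
    simp only [hb]
    rw [fwdSum_eq_sum 0]
    · simp
    · intro i _
      refine hA _ ?_
      exact lt_of_lt_of_le (by simpa [sub_eq_add_neg] using hM (M + i) (by simp)) (le_abs_self _)
  have hb0 : b 0 = fwdSum f d (-t) := by simp [hb]
  have : ∀ n, jump G f (gaps d n) (d n - t) = G (b n) - G (b (n + 1)) := by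
    intro n
    rw [jump, hg, hb1 n]
  simp only [this]
  rw [Finset.sum_range_sub', hb0, hbM]
  ring

theorem continuous_fwdSum_neg (hf : Continuous f) (hA : ∀ x, A < |x| → f x = 0)
    (hd : Tendsto d atTop atTop) : Continuous fun t => fwdSum f d (-t) :=
  (continuous_fwdSum hf hA hd).comp continuous_neg

theorem abs_jumpInt_le (G : BoundedContinuousFunction E ℝ) (hA0 : 0 ≤ A) (hf : Continuous f)
    (hA : ∀ x, A < |x| → f x = 0) {y : ℕ → ℝ} (hy : Tendsto y atTop atTop) :
    |jumpInt G f y| ≤ 2 * A * (2 * ‖G‖) :=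
  abs_integral_le_integral_abs.trans
    (integral_abs_le_of_bounded_support hA0 (continuous_jump G hf hA hy).aestronglyMeasurable
      (abs_jump_le G f y) fun _ hs => jump_eq_zero G y (hA _ hs))

theorem tendsto_stat_sub_jump {N : ℝ → ℕ} (hdN : ∀ n T, n < N T ↔ d n ≤ T)
    (hN : Tendsto (fun T => (N T : ℝ) / T) atTop (𝓝 1))
    (G : BoundedContinuousFunction E ℝ) (hA0 : 0 ≤ A) (hf : Continuous f)
    (hA : ∀ x, A < |x| → f x = 0) :
    Tendsto (fun T : ℝ => (∫ t in (0:ℝ)..T, G (fwdSum f d (-t))) / T -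
      (∑ n ∈ Finset.range ⌊T⌋₊, jumpInt G f (gaps d n)) / T) atTop (𝓝 (G 0)) := by
  have hd := tendsto_points_atTop hdN
  have h1 := tendsto_average_swap hdN hN (φ := fun n => jump G f (gaps d n)) hA0
    (fun n => continuous_jump G hf hA (tendsto_gaps hd n)) (fun n => abs_jump_le G f (gaps d n))
    (fun n s hs => jump_eq_zero G _ (hA s hs))
  have h2 := tendsto_average_floor hN (a := fun n => jumpInt G f (gaps d n))
    (fun n => abs_jumpInt_le G hA0 hf hA (tendsto_gaps hd n))
  have h3 := (h1.add h2).const_add (G 0)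
  rw [add_zero, add_zero] at h3
  refine h3.congr' ?_
  filter_upwards [eventually_gt_atTop 0] with T hT
  have e1 : ∫ t in (0:ℝ)..T, G (fwdSum f d (-t)) = T * G 0 + ∫ t in (0:ℝ)..T,
      ∑ n ∈ Finset.range (N (T + A)), jump G f (gaps d n) (d n - t) := by
    have : ∫ t in (0:ℝ)..T, G (fwdSum f d (-t)) = ∫ t in (0:ℝ)..T, (G 0 +
      ∑ n ∈ Finset.range (N (T + A)), jump G f (gaps d n) (d n - t)) := by
      refine intervalIntegral.integral_congr fun t ht => ?_
      rw [Set.uIcc_of_le hT.le] at ht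
      refine comp_fwdSum_eq_sum_jump G hA hd t _ fun n hn => ?_
      have : ¬ d n ≤ T + A := fun h => absurd ((hdN _ _).2 h) (not_lt.2 hn)
      have := ht.2
      linarith
    rw [this, intervalIntegral.integral_add (by simp), intervalIntegral.integral_const]
    · simp
    · refine Continuous.intervalIntegrable (continuous_finsetSum _ fun n _ => ?_) _ _
      exact (continuous_jump G hf hA (tendsto_gaps hd n)).comp (by fun_prop)
  rw [e1]
  simp only [jumpInt]
  field_simp
  ring

theorem tendsto_floor_average_iff {a : ℕ → ℝ} {l : ℝ} :
    Tendsto (fun T : ℝ => (∑ n ∈ Finset.range ⌊T⌋₊, a n) / T) atTop (𝓝 l) ↔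
      Tendsto (fun N : ℕ => (N : ℝ)⁻¹ * ∑ n ∈ Finset.range N, a n) atTop (𝓝 l) := by
  constructor
  · intro h
    refine (h.comp tendsto_natCast_atTop_atTop).congr fun N => ?_
    simp [div_eq_inv_mul]
  · intro h
    have h1 := (h.comp (tendsto_nat_floor_atTop (α := ℝ))).mul
      (tendsto_nat_floor_div_atTop (R := ℝ))
    rw [mul_one] at h1
    refine h1.congr' ?_
    filter_upwards [eventually_ge_atTop 1] with T hT
    have : (⌊T⌋₊ : ℝ) ≠ 0 := by
      have := (Nat.one_le_floor_iff T).2 hT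
      positivity
    simp only [Function.comp]
    field_simp

theorem tendsto_stat_iff {N : ℝ → ℕ} (hdN : ∀ n T, n < N T ↔ d n ≤ T)
    (hN : Tendsto (fun T => (N T : ℝ) / T) atTop (𝓝 1))
    (G : BoundedContinuousFunction E ℝ) (hA0 : 0 ≤ A) (hf : Continuous f)
    (hA : ∀ x, A < |x| → f x = 0) {l : ℝ} :
    Tendsto (fun T : ℝ => (∫ t in (0:ℝ)..T, G (fwdSum f d (-t))) / T) atTop (𝓝 (G 0 + l)) ↔
      Tendsto (fun N : ℕ => (N : ℝ)⁻¹ * ∑ n ∈ Finset.range N, jumpInt G f (gaps d n))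
        atTop (𝓝 l) := by
  rw [← tendsto_floor_average_iff]
  have h := tendsto_stat_sub_jump hdN hN G hA0 hf hA
  constructor
  · intro h1
    have := h1.sub h
    simpa using this
  · intro h1
    have := h.add h1
    simpa using this

end

theorem seqStat_eq_fwdSum {c : ℕ → ℝ} (f : ℝ → ℝ) (t : ℝ) :
    seqStat c f t = fwdSum f (fun n => c (n + 1)) (-t) := by
  unfold seqStat fwdSum
  rw [← (Function.Injective.tsum_eq (g := fun n : ℕ => n + 1) (fun a b h => by simpa using h)
    (f := fun n : ℕ => if 1 ≤ n then f (c n - t) else 0))]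
  · simp [sub_eq_add_neg]
  · intro n hn
    have : 1 ≤ n := by
      by_contra h
      simp [h] at hn
    exact ⟨n - 1, by simp; omega⟩

end SpacingPalm

namespace SpacingPalm

section PointMeasure

variable {ν : Measure ℝ}

theorem _root_.IsPointMeasure.lt_top (hν : IsPointMeasure ν) {B : Set ℝ} (hB : MeasurableSet B)
    (hb : IsBounded B) : ν B < ⊤ := by
  obtain ⟨m, hm⟩ := hν B hB hb
  rw [hm]
  exact ENNReal.natCast_lt_top m

theorem _root_.IsPointMeasure.isLocallyFiniteMeasure (hν : IsPointMeasure ν) :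
    IsLocallyFiniteMeasure ν :=
  ⟨fun x => ⟨Metric.ball x 1, Metric.ball_mem_nhds x one_pos,
    hν.lt_top measurableSet_ball Metric.isBounded_ball⟩⟩

theorem _root_.IsPointMeasure.eq_zero_of_lt_one (hν : IsPointMeasure ν) {B : Set ℝ}
    (hB : MeasurableSet B) (hb : IsBounded B) (h : ν B < 1) : ν B = 0 := by
  obtain ⟨m, hm⟩ := hν B hB hb
  rw [hm] at h ⊢
  have : m < 1 := by exact_mod_cast h
  simp [Nat.lt_one_iff.1 this]

theorem _root_.IsPointMeasure.null_of_no_atoms (hν : IsPointMeasure ν) {B : Set ℝ}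
    (h : ∀ x ∈ B, ν {x} = 0) : ν B = 0 := by
  have := hν.isLocallyFiniteMeasure
  refine measure_null_of_locally_null B fun x hx => ?_
  obtain ⟨U, hxU, hU, hlt⟩ := Set.exists_isOpen_lt_of_lt (μ := ν) {x} 1 (by rw [h x hx]; simp)
  have hxU' : x ∈ U := hxU rfl
  refine ⟨U ∩ Metric.ball x 1, mem_nhdsWithin_of_mem_nhds
    (inter_mem (hU.mem_nhds hxU') (Metric.ball_mem_nhds x one_pos)), ?_⟩
  exact hν.eq_zero_of_lt_one (hU.measurableSet.inter measurableSet_ball)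
    (Metric.isBounded_ball.subset Set.inter_subset_right)
    ((measure_mono Set.inter_subset_left).trans_lt hlt)

theorem _root_.IsPointMeasure.one_le_singleton (hν : IsPointMeasure ν) {x : ℝ} (h : ν {x} ≠ 0) :
    1 ≤ ν {x} := by
  by_contra h'
  exact h (hν.eq_zero_of_lt_one (measurableSet_singleton x) isBounded_singleton (not_le.1 h'))

/-- A simple point measure is, on a bounded interval, a finite sum of unit point masses. -/
theorem exists_finset_of_simple (hν : IsPointMeasure ν) (hs : ∀ x, ν {x} ≤ 1) (A : ℝ) :
    ∃ S : Finset ℝ, ν.restrict (Set.Icc (-A) A) = ∑ x ∈ S, Measure.dirac x := by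
  classical
  set S : Set ℝ := {x ∈ Set.Icc (-A) A | ν {x} ≠ 0} with hS
  have hSfin : S.Finite := by
    by_contra hinf
    obtain ⟨m, hm⟩ := hν (Set.Icc (-A) A) measurableSet_Icc (Metric.isBounded_Icc _ _)
    obtain ⟨t, htS, htc⟩ := Set.Infinite.exists_subset_card_eq hinf (m + 1)
    have h1 : ν (t : Set ℝ) ≤ m := hm ▸ measure_mono fun x hx => (htS hx).1
    have h2 : ((m + 1 : ℕ) : ENNReal) ≤ ν (t : Set ℝ) := by
      rw [← sum_measure_singleton, ← htc]
      have : ∑ x ∈ t, (1 : ENNReal) ≤ ∑ x ∈ t, ν {x} :=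
        Finset.sum_le_sum fun x hx => hν.one_le_singleton (htS hx).2
      simpa using this
    have h3 := h2.trans h1
    have : m + 1 ≤ m := by exact_mod_cast h3
    omega
  have hnull : ν (Set.Icc (-A) A \ S) = 0 := by
    refine hν.null_of_no_atoms fun x hx => ?_
    by_contra h
    exact hx.2 ⟨hx.1, h⟩
  have hone : ∀ x ∈ S, ν {x} = 1 := fun x hx => le_antisymm (hs x) (hν.one_le_singleton hx.2)
  refine ⟨hSfin.toFinset, Measure.ext fun B hB => ?_⟩
  have h1 : ν.restrict (Set.Icc (-A) A) B = ν (hSfin.toFinset.filter (· ∈ B) : Finset ℝ) := by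
    rw [Measure.restrict_apply hB]
    refine le_antisymm ?_ (measure_mono fun x hx => ?_)
    · calc ν (B ∩ Set.Icc (-A) A) ≤ ν ((hSfin.toFinset.filter (· ∈ B) : Finset ℝ) ∪
            (Set.Icc (-A) A \ S)) := measure_mono fun x hx => by
              by_cases h : x ∈ S
              · left; simp [h, hx.1]
              · right; exact ⟨hx.2, h⟩
        _ ≤ _ := (measure_union_le _ _).trans (by rw [hnull, add_zero])
    · simp only [Finset.coe_filter, Set.Finite.mem_toFinset] at hx
      exact ⟨hx.2, hx.1.1⟩
  rw [h1, ← sum_measure_singleton, Measure.finsetSum_apply, Finset.sum_filter]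
  refine Finset.sum_congr rfl fun x hx => ?_
  rw [Measure.dirac_apply' x hB, hone x (by simpa using hx)]
  simp [Set.indicator_apply]

theorem sum_telescope {E : Type*} [AddCommMonoid E] (F : E → ℝ) (f : ℝ → E) (S : Finset ℝ) :
    F (∑ x ∈ S, f x) - F 0 = ∑ s ∈ S, (F (f s + ∑ x ∈ S with s < x, f x) -
      F (∑ x ∈ S with s < x, f x)) := by
  classical
  induction S using Finset.induction_on_min with
  | empty => simp
  | insert a S ha ih =>
    have haS : a ∉ S := fun h => lt_irrefl a (ha a h)
    have h1 : (insert a S).filter (fun x => a < x) = S := by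
      ext x
      simp only [Finset.mem_filter, Finset.mem_insert]
      constructor
      · rintro ⟨rfl | h, h'⟩
        · exact absurd h' (lt_irrefl _)
        · exact h
      · exact fun h => ⟨Or.inr h, ha x h⟩
    have h2 : ∀ s ∈ S, (insert a S).filter (fun x => s < x) = S.filter (fun x => s < x) := by
      intro s hs
      rw [Finset.filter_insert, if_neg (not_lt.2 (ha s hs).le)]
    have h3 : ∑ s ∈ S, (F (f s + ∑ x ∈ insert a S with s < x, f x) -
        F (∑ x ∈ insert a S with s < x, f x)) = F (∑ x ∈ S, f x) - F 0 := by
      rw [ih]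
      exact Finset.sum_congr rfl fun s hs => by rw [h2 s hs]
    rw [Finset.sum_insert haS, Finset.sum_insert haS, h1, h3]
    ring

variable {E : Type*} [NormedAddCommGroup E] [NormedSpace ℝ E] [CompleteSpace E]

theorem integral_eq_sum_of_restrict {ι : Type*} {S : Finset ι} {p : ι → ℝ} {B : Set ℝ}
    (hS : ν.restrict B = ∑ i ∈ S, Measure.dirac (p i)) {g : ℝ → E} (hg : ∀ x, x ∉ B → g x = 0) :
    ∫ x, g x ∂ν = ∑ i ∈ S, g (p i) := by
  rw [← setIntegral_eq_integral_of_forall_compl_eq_zero hg, hS, integral_finsetSum_measure]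
  · simp
  · exact fun x _ => integrable_dirac (by simp)

/-- Telescoping over the points of a simple point measure, from right to left. -/
theorem comp_integral_sub_eq (hν : IsPointMeasure ν) (hs : ∀ x, ν {x} ≤ 1) (F : E → ℝ)
    {f : ℝ → E} {A : ℝ} (hA : ∀ x, A < |x| → f x = 0) :
    F (∫ x, f x ∂ν) - F 0 =
      ∫ s, (F (f s + ∫ x in Set.Ioi s, f x ∂ν) - F (∫ x in Set.Ioi s, f x ∂ν)) ∂ν := by
  obtain ⟨S, hS⟩ := exists_finset_of_simple hν hs A
  have hA' : ∀ x, x ∉ Set.Icc (-A) A → f x = 0 := fun x hx => hA x (by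
    by_contra h
    exact hx (abs_le.1 (not_lt.1 h)))
  have h1 : ∀ s, ∫ x in Set.Ioi s, f x ∂ν = ∑ x ∈ S with s < x, f x := by
    intro s
    rw [← integral_indicator measurableSet_Ioi, integral_eq_sum_of_restrict hS,
      Finset.sum_filter]
    · exact Finset.sum_congr rfl fun x _ => by simp [Set.indicator_apply]
    · intro x hx
      simp [Set.indicator_apply, hA' x hx]
  simp_rw [h1]
  rw [integral_eq_sum_of_restrict hS hA', sum_telescope, integral_eq_sum_of_restrict hS]
  intro s hs
  simp [hA' s hs]

end PointMeasure

end SpacingPalm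

namespace SpacingPalm

section Labels

/-- The positive points of a point measure, in increasing order and indexed from `0`. -/
noncomputable def labels (ν : Measure ℝ) (i : ℕ) : ℝ := xLabel ν ((i : ℤ) + 1)

theorem labels_eq (ν : Measure ℝ) (i : ℕ) :
    labels ν i = sInf {x : ℝ | 0 < x ∧ ((i + 1 : ℕ) : ENNReal) ≤ ν (Set.Ioc 0 x)} := by
  have h : (0 : ℤ) < (i : ℤ) + 1 := by omega
  have h' : ((i : ℤ) + 1).toNat = i + 1 := by omega
  rw [labels, xLabel, if_pos h, h']

variable {ν : Measure ℝ}

theorem exists_lt_measure_Ioc (hinf : ν (Set.Ioi 0) = ⊤) (m : ℕ) :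
    ∃ k : ℕ, (m : ENNReal) < ν (Set.Ioc 0 (k : ℝ)) := by
  have h1 : (⋃ k : ℕ, Set.Ioc (0 : ℝ) k) = Set.Ioi 0 := by
    ext x
    simp only [Set.mem_iUnion, Set.mem_Ioc, Set.mem_Ioi]
    constructor
    · rintro ⟨_, h, _⟩
      exact h
    · intro h
      obtain ⟨k, hk⟩ := exists_nat_ge x
      exact ⟨k, h, hk⟩
  have hm : Monotone fun k : ℕ => Set.Ioc (0 : ℝ) k := fun a b hab =>
    Set.Ioc_subset_Ioc_right (by exact_mod_cast hab)
  have h2 := tendsto_measure_iUnion_atTop (μ := ν) hm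
  rw [h1, hinf] at h2
  exact (h2.eventually (lt_mem_nhds (ENNReal.natCast_lt_top m))).exists

theorem labels_le_iff (hν : IsPointMeasure ν) (hinf : ν (Set.Ioi 0) = ⊤) (i : ℕ) (a : ℝ) :
    labels ν i ≤ a ↔ ((i + 1 : ℕ) : ENNReal) ≤ ν (Set.Ioc 0 a) := by
  set S : Set ℝ := {x : ℝ | 0 < x ∧ ((i + 1 : ℕ) : ENNReal) ≤ ν (Set.Ioc 0 x)} with hS
  have hbdd : BddBelow S := ⟨0, fun x hx => hx.1.le⟩
  have hpos : ∀ x : ℝ, ((i + 1 : ℕ) : ENNReal) ≤ ν (Set.Ioc 0 x) → 0 < x := by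
    intro x hx
    by_contra h
    rw [Set.Ioc_eq_empty (by simpa using h), measure_empty] at hx
    simp at hx
  have hne : S.Nonempty := by
    obtain ⟨k, hk⟩ := exists_lt_measure_Ioc hinf (i + 1)
    exact ⟨k, hpos _ hk.le, hk.le⟩
  have hatt : ((i + 1 : ℕ) : ENNReal) ≤ ν (Set.Ioc 0 (sInf S)) := by
    have h1 : (⋂ k : ℕ, Set.Ioc (0 : ℝ) (sInf S + 1 / ((k : ℝ) + 1))) = Set.Ioc 0 (sInf S) := by
      ext x
      simp only [Set.mem_iInter, Set.mem_Ioc]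
      constructor
      · intro h
        have hlim : Tendsto (fun k : ℕ => sInf S + 1 / ((k : ℝ) + 1)) atTop (𝓝 (sInf S)) := by
          simpa using (tendsto_one_div_add_atTop_nhds_zero_nat (𝕜 := ℝ)).const_add (sInf S)
        exact ⟨(h 0).1, ge_of_tendsto' hlim fun k => (h k).2⟩
      · intro h k
        exact ⟨h.1, h.2.trans (by have : (0 : ℝ) < 1 / ((k : ℝ) + 1) := by positivity
                                  linarith)⟩
    have hanti : Antitone fun k : ℕ => Set.Ioc (0 : ℝ) (sInf S + 1 / ((k : ℝ) + 1)) := by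
      intro a b hab
      refine Set.Ioc_subset_Ioc_right ?_
      have : (1 : ℝ) / ((b : ℝ) + 1) ≤ 1 / ((a : ℝ) + 1) := by gcongr
      linarith
    have h2 := tendsto_measure_iInter_atTop (μ := ν)
      (fun k : ℕ => (measurableSet_Ioc (a := (0 : ℝ))
        (b := sInf S + 1 / ((k : ℝ) + 1))).nullMeasurableSet) hanti
      ⟨0, (hν.lt_top measurableSet_Ioc (Metric.isBounded_Ioc _ _)).ne⟩
    rw [h1] at h2
    refine ge_of_tendsto' h2 fun k => ?_
    obtain ⟨x, hx, hxlt⟩ := exists_lt_of_csInf_lt hne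
      (show sInf S < sInf S + 1 / ((k : ℝ) + 1) by
        have : (0 : ℝ) < 1 / ((k : ℝ) + 1) := by positivity
        linarith)
    exact hx.2.trans (measure_mono (Set.Ioc_subset_Ioc_right hxlt.le))
  rw [labels_eq]
  constructor
  · exact fun h => hatt.trans (measure_mono (Set.Ioc_subset_Ioc_right h))
  · exact fun h => csInf_le hbdd ⟨hpos a h, h⟩

theorem labels_pos (hν : IsPointMeasure ν) (hinf : ν (Set.Ioi 0) = ⊤) (i : ℕ) :
    0 < labels ν i := by
  by_contra h
  have := (labels_le_iff hν hinf i 0).1 (not_lt.1 h)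
  simp at this

theorem monotone_labels (hν : IsPointMeasure ν) (hinf : ν (Set.Ioi 0) = ⊤) :
    Monotone (labels ν) := by
  intro i j hij
  rw [labels_le_iff hν hinf]
  refine le_trans ?_ ((labels_le_iff hν hinf j _).1 le_rfl)
  exact_mod_cast Nat.succ_le_succ hij

theorem labels_le_iff_lt (hν : IsPointMeasure ν) (hinf : ν (Set.Ioi 0) = ⊤) {a : ℝ} {m : ℕ}
    (hm : ν (Set.Ioc 0 a) = m) (i : ℕ) : labels ν i ≤ a ↔ i < m := by
  rw [labels_le_iff hν hinf, hm, Nat.cast_le, Nat.succ_le_iff]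

theorem tendsto_labels (hν : IsPointMeasure ν) (hinf : ν (Set.Ioi 0) = ⊤) :
    Tendsto (labels ν) atTop atTop := by
  refine tendsto_atTop.2 fun R => ?_
  obtain ⟨m, hm⟩ := hν (Set.Ioc 0 R) measurableSet_Ioc (Metric.isBounded_Ioc _ _)
  filter_upwards [eventually_ge_atTop m] with i hi
  by_contra h
  exact absurd ((labels_le_iff_lt hν hinf hm i).1 (not_le.1 h).le) (not_lt.2 hi)

theorem restrict_Ioc_eq_sum (hν : IsPointMeasure ν) (hinf : ν (Set.Ioi 0) = ⊤) {R : ℝ} {m : ℕ}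
    (hm : ν (Set.Ioc 0 R) = m) :
    ν.restrict (Set.Ioc 0 R) = ∑ i ∈ Finset.range m, Measure.dirac (labels ν i) := by
  have hfin : IsFiniteMeasure (ν.restrict (Set.Ioc 0 R)) :=
    ⟨by rw [Measure.restrict_apply_univ, hm]; exact ENNReal.natCast_lt_top m⟩
  refine Measure.ext_of_Iic _ _ fun a => ?_
  obtain ⟨k, hk⟩ := hν (Set.Ioc 0 (min a R)) measurableSet_Ioc (Metric.isBounded_Ioc _ _)
  have h1 : Set.Iic a ∩ Set.Ioc 0 R = Set.Ioc 0 (min a R) := by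
    ext x
    simp only [Set.mem_inter_iff, Set.mem_Iic, Set.mem_Ioc, le_min_iff]
    tauto
  rw [Measure.restrict_apply measurableSet_Iic, h1, hk, Measure.finsetSum_apply]
  simp only [Measure.dirac_apply' _ measurableSet_Iic, Set.indicator_apply, Set.mem_Iic,
    Pi.one_apply]
  rw [← Finset.sum_filter, Finset.sum_const, nsmul_one]
  have h2 : (Finset.range m).filter (fun i => labels ν i ≤ a) = Finset.range k := by
    ext i
    rw [Finset.mem_filter, Finset.mem_range, Finset.mem_range, ← labels_le_iff_lt hν hinf hm,
      ← labels_le_iff_lt hν hinf hk, le_min_iff, and_comm]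
  rw [h2, Finset.card_range]

/-- Sums over the positive points of a point measure are integrals over `(0, ∞)`. -/
theorem fwdSum_labels {E : Type*} [NormedAddCommGroup E] [NormedSpace ℝ E] [CompleteSpace E]
    (hν : IsPointMeasure ν) (hinf : ν (Set.Ioi 0) = ⊤) {f : ℝ → E} {A : ℝ}
    (hA : ∀ x, A < |x| → f x = 0) (s : ℝ) :
    fwdSum f (labels ν) s = ∫ u in Set.Ioi 0, f (u + s) ∂ν := by
  obtain ⟨m, hm⟩ := hν (Set.Ioc 0 (A + |s|)) measurableSet_Ioc (Metric.isBounded_Ioc _ _)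
  have hz : ∀ u, A + |s| < u → f (u + s) = 0 := fun u hu => hA _ (by
    have := neg_abs_le s
    exact lt_of_lt_of_le (by linarith) (le_abs_self _))
  rw [fwdSum_eq_sum m, ← integral_indicator measurableSet_Ioi,
    integral_eq_sum_of_restrict (restrict_Ioc_eq_sum hν hinf hm)]
  · refine Finset.sum_congr rfl fun i _ => ?_
    rw [Set.indicator_of_mem (show labels ν i ∈ Set.Ioi 0 from labels_pos hν hinf i)]
  · intro u hu
    by_cases h : 0 < u
    · have : A + |s| < u := by
        by_contra h'
        exact hu ⟨h, not_lt.1 h'⟩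
      simp [Set.indicator_apply, hz u this]
    · simp [h]
  · intro i hi
    refine hz _ ?_
    by_contra h
    exact absurd ((labels_le_iff_lt hν hinf hm i).1 (not_lt.1 h)) (not_lt.2 hi)

theorem measurable_labels (i : ℕ) : Measurable fun ν : Measure ℝ => labels ν i := by
  have hm : ∀ x : ℝ, MeasurableSet {ν : Measure ℝ | ((i + 1 : ℕ) : ENNReal) ≤ ν (Set.Ioc 0 x)} :=
    fun x => measurableSet_le measurable_const (Measure.measurable_coe measurableSet_Ioc)
  refine measurable_of_Iio fun a => ?_
  have h : (fun ν : Measure ℝ => labels ν i) ⁻¹' Set.Iio a =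
      (⋃ q : ℚ, ⋃ _ : 0 < (q : ℝ) ∧ (q : ℝ) < a,
        {ν : Measure ℝ | ((i + 1 : ℕ) : ENNReal) ≤ ν (Set.Ioc 0 (q : ℝ))}) ∪
      ((⋂ k : ℕ, {ν : Measure ℝ | ((i + 1 : ℕ) : ENNReal) ≤ ν (Set.Ioc 0 (k : ℝ))}ᶜ) ∩
        {_ν | 0 < a}) := by
    ext ν
    have hpos : ∀ x : ℝ, ((i + 1 : ℕ) : ENNReal) ≤ ν (Set.Ioc 0 x) → 0 < x := by
      intro x hx
      by_contra h
      rw [Set.Ioc_eq_empty (by simpa using h), measure_empty] at hx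
      simp at hx
    simp only [Set.mem_preimage, Set.mem_Iio, labels_eq, Set.mem_union, Set.mem_iUnion,
      Set.mem_ofPred_eq, Set.mem_inter_iff, Set.mem_iInter, Set.mem_compl_iff, exists_prop]
    set S : Set ℝ := {x : ℝ | 0 < x ∧ ((i + 1 : ℕ) : ENNReal) ≤ ν (Set.Ioc 0 x)} with hS
    have hbdd : BddBelow S := ⟨0, fun x hx => hx.1.le⟩
    rcases S.eq_empty_or_nonempty with he | hne
    · have hnot : ∀ x : ℝ, ¬ ((i + 1 : ℕ) : ENNReal) ≤ ν (Set.Ioc 0 x) := fun x hx => by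
        have : x ∈ S := ⟨hpos x hx, hx⟩
        rw [he] at this
        exact this
      rw [he, Real.sInf_empty]
      constructor
      · exact fun h => Or.inr ⟨fun k => hnot k, h⟩
      · rintro (⟨q, _, h⟩ | ⟨_, h⟩)
        · exact absurd h (hnot q)
        · exact h
    · rw [csInf_lt_iff hbdd hne]
      constructor
      · rintro ⟨x, hx, hxa⟩
        obtain ⟨q, hq, hqa⟩ := exists_rat_btwn hxa
        exact Or.inl ⟨q, ⟨hx.1.trans hq, hqa⟩,
          hx.2.trans (measure_mono (Set.Ioc_subset_Ioc_right hq.le))⟩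
      · rintro (⟨q, hq, h⟩ | ⟨h, _⟩)
        · exact ⟨q, ⟨hq.1, h⟩, hq.2⟩
        · obtain ⟨x, hx⟩ := hne
          obtain ⟨k, hk⟩ := exists_nat_ge x
          exact absurd (hx.2.trans (measure_mono (Set.Ioc_subset_Ioc_right hk))) (h k)
  rw [h]
  refine MeasurableSet.union (MeasurableSet.iUnion fun q => MeasurableSet.iUnion fun _ => hm _)
    (MeasurableSet.inter (MeasurableSet.iInter fun k => (hm _).compl) (MeasurableSet.const _))

end Labels

end SpacingPalm

namespace SpacingPalm

open ProbabilityTheory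

section Campbell

theorem _root_.IsPointMeasure.translate {ν : Measure ℝ} (hν : IsPointMeasure ν) (s : ℝ) :
    IsPointMeasure (translateMeasure s ν) := by
  intro B hB hb
  rw [translateMeasure, Measure.map_apply (by fun_prop) hB]
  refine hν _ (hB.preimage (by fun_prop)) ?_
  have : (fun x => x - s) ⁻¹' B = (fun x => x + s) '' B := by
    ext x
    simp only [Set.mem_preimage, Set.mem_image]
    exact ⟨fun h => ⟨_, h, by ring⟩, fun ⟨y, hy, h⟩ => by rw [← h]; simpa using hy⟩
  rw [this]
  obtain ⟨r, hr⟩ := isBounded_iff_forall_norm_le.1 hb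
  refine isBounded_iff_forall_norm_le.2 ⟨r + ‖s‖, ?_⟩
  rintro _ ⟨x, hx, rfl⟩
  exact (norm_add_le _ _).trans (by gcongr; exact hr x hx)

theorem measurableSet_floor_mass (k : ℤ) (n : ℕ) : MeasurableSet
    {ν : Measure ℝ | (n : ENNReal) ≤ ν (Set.Ioc (k : ℝ) (k + 1)) ∧
      ν (Set.Ioc (k : ℝ) (k + 1)) < n + 1} :=
  (measurableSet_le measurable_const (Measure.measurable_coe measurableSet_Ioc)).inter
    (measurableSet_lt (Measure.measurable_coe measurableSet_Ioc) measurable_const)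

open Classical in
/-- The restriction of `ν` to `(k, k + 1]` if its mass lies in `[n, n + 1)`, else `0`. -/
noncomputable def pieceKernel (p : ℤ × ℕ) : Kernel (Measure ℝ) ℝ :=
  Kernel.piecewise (measurableSet_floor_mass p.1 p.2)
    (Kernel.restrict ⟨id, measurable_id⟩ (measurableSet_Ioc (a := (p.1 : ℝ)) (b := p.1 + 1))) 0

instance (p : ℤ × ℕ) : IsFiniteKernel (pieceKernel p) := by
  refine ⟨⟨p.2 + 1, by simp, fun ν => ?_⟩⟩
  rw [pieceKernel, Kernel.piecewise_apply]
  split_ifs with h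
  · rw [Kernel.restrict_apply, Measure.restrict_apply_univ]
    exact h.2.le
  · simp

/-- An s-finite kernel that maps every point measure to itself. -/
noncomputable def selfKernel : Kernel (Measure ℝ) ℝ := Kernel.sum pieceKernel

instance : IsSFiniteKernel selfKernel := Kernel.isSFiniteKernel_sum

theorem selfKernel_apply {ν : Measure ℝ} (hν : IsPointMeasure ν) : selfKernel ν = ν := by
  refine Measure.ext fun B hB => ?_
  rw [selfKernel, Kernel.sum_apply, Measure.sum_apply _ hB, ENNReal.tsum_prod']
  have h1 : ∀ k : ℤ, ∑' n : ℕ, pieceKernel (k, n) ν B =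
      ν.restrict (Set.Ioc (k : ℝ) (k + 1)) B := by
    intro k
    obtain ⟨m, hm⟩ := hν (Set.Ioc (k : ℝ) (k + 1)) measurableSet_Ioc (Metric.isBounded_Ioc _ _)
    rw [tsum_eq_single m]
    · rw [pieceKernel, Kernel.piecewise_apply, if_pos, Kernel.restrict_apply]
      · rfl
      · simp only [Set.mem_ofPred_eq, hm, le_refl, true_and]
        exact_mod_cast Nat.lt_succ_self m
    · intro n hn
      rw [pieceKernel, Kernel.piecewise_apply, if_neg]
      · simp
      · simp only [Set.mem_ofPred_eq, hm]
        rintro ⟨h1, h2⟩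
        have h1' : n ≤ m := by exact_mod_cast h1
        have h2' : m < n + 1 := by exact_mod_cast h2
        omega
  simp_rw [h1]
  rw [← Measure.sum_apply _ hB, ← Measure.restrict_iUnion, iUnion_Ioc_intCast,
    Measure.restrict_univ]
  · exact Set.pairwise_disjoint_Ioc_intCast ℝ
  · exact fun _ => measurableSet_Ioc

/-- The pair `(ν, s)` mapped to `(s, θ^s ν)`. -/
noncomputable def shiftMap (p : Measure ℝ × ℝ) : ℝ × Measure ℝ :=
  (p.2, translateMeasure p.2 (selfKernel p.1))

theorem measurable_shiftMap : Measurable shiftMap := by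
  refine measurable_snd.prodMk (Measure.measurable_of_measurable_coe _ fun B hB => ?_)
  have h : ∀ p : Measure ℝ × ℝ, translateMeasure p.2 (selfKernel p.1) B =
      (Kernel.prodMkRight ℝ selfKernel) p
        (Prod.mk p ⁻¹' {q : (Measure ℝ × ℝ) × ℝ | q.2 - q.1.2 ∈ B}) := by
    intro p
    rw [translateMeasure, Measure.map_apply (by fun_prop) hB, Kernel.prodMkRight_apply]
    rfl
  simp_rw [h]
  refine Kernel.measurable_kernel_prodMk_left ?_
  exact hB.preimage (by fun_prop)

variable {Ω Ω' : Type*} [MeasurableSpace Ω] [MeasurableSpace Ω'] {P : Measure Ω}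
  {P' : Measure Ω'} [IsProbabilityMeasure P] [IsProbabilityMeasure P']
  {ξ : Ω → Measure ℝ} {ξ0 : Ω' → Measure ℝ}

theorem map_compProd_shiftMap_prod (hξ : Measurable ξ) (hpp : ∀ᵐ ω ∂P, IsPointMeasure (ξ ω))
    {B : Set ℝ} (hB : MeasurableSet B) {S : Set (Measure ℝ)} (hS : MeasurableSet S) :
    ((P.map ξ ⊗ₘ selfKernel).map shiftMap) (B ×ˢ S) =
      ∫⁻ ω, (∫⁻ s in B, S.indicator (fun _ => (1 : ENNReal))
        (translateMeasure s (ξ ω)) ∂(ξ ω)) ∂P := by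
  classical
  have : IsProbabilityMeasure (P.map ξ) := Measure.isProbabilityMeasure_map hξ.aemeasurable
  have hm : MeasurableSet (shiftMap ⁻¹' (B ×ˢ S)) := measurable_shiftMap (hB.prod hS)
  rw [Measure.map_apply measurable_shiftMap (hB.prod hS), Measure.compProd_apply hm,
    lintegral_map (Kernel.measurable_kernel_prodMk_left hm) hξ]
  refine lintegral_congr_ae ?_
  filter_upwards [hpp] with ω hω
  have hm' : MeasurableSet (Prod.mk (ξ ω) ⁻¹' (shiftMap ⁻¹' (B ×ˢ S))) :=
    measurable_prodMk_left hm
  rw [← lintegral_indicator hB, ← lintegral_indicator_one hm', selfKernel_apply hω]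
  refine lintegral_congr fun s => ?_
  simp only [Set.indicator_apply, Set.mem_preimage, shiftMap, Set.mem_prod, selfKernel_apply hω,
    Pi.one_apply]
  by_cases h1 : s ∈ B <;> by_cases h2 : translateMeasure s (ξ ω) ∈ S <;> simp [h1, h2]

theorem translateMeasure_add (s h : ℝ) (ν : Measure ℝ) :
    translateMeasure s (translateMeasure h ν) = translateMeasure (s + h) ν := by
  rw [translateMeasure, translateMeasure, translateMeasure,
    Measure.map_map (by fun_prop) (by fun_prop)]
  congr 1
  ext x
  simp only [Function.comp_apply]
  ring

theorem measurable_translateMeasure (h : ℝ) : Measurable (translateMeasure h) :=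
  Measure.measurable_map _ (by fun_prop)

/-- The refined Campbell measure of a stationary point process is the product of Lebesgue
measure and the law of its Palm process. -/
theorem map_compProd_shiftMap_eq (hξ : Measurable ξ) (hξ0 : Measurable ξ0)
    (hpp : ∀ᵐ ω ∂P, IsPointMeasure (ξ ω)) (hstat : Stationary P ξ) (hint : HasIntensity P ξ 1)
    (hpalm : IsPalmOf P ξ P' ξ0 1) :
    (P.map ξ ⊗ₘ selfKernel).map shiftMap = (volume : Measure ℝ).prod (P'.map ξ0) := by
  have hQ : IsProbabilityMeasure (P.map ξ) := Measure.isProbabilityMeasure_map hξ.aemeasurable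
  have hQ0 : IsProbabilityMeasure (P'.map ξ0) := Measure.isProbabilityMeasure_map hξ0.aemeasurable
  symm
  refine Measure.prod_eq fun B S hB hS => ?_
  set C := (P.map ξ ⊗ₘ selfKernel).map shiftMap with hC
  set μ : Measure ℝ := (C.restrict (Set.univ ×ˢ S)).map Prod.fst with hμ
  have hμB : ∀ B : Set ℝ, MeasurableSet B → μ B = C (B ×ˢ S) := by
    intro B hB
    rw [hμ, Measure.map_apply measurable_fst hB, Measure.restrict_apply (measurable_fst hB)]
    congr 1
    ext p
    simp
  have hfin : IsFiniteMeasureOnCompacts μ := by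
    refine ⟨fun K hK => ?_⟩
    have h1 : μ K ≤ volume K := by
      rw [hμB K hK.measurableSet]
      refine (measure_mono (Set.prod_mono_right (Set.subset_univ S))).trans ?_
      rw [hC, map_compProd_shiftMap_prod hξ hpp hK.measurableSet MeasurableSet.univ]
      simp only [Set.indicator_univ, lintegral_const, one_mul, Measure.restrict_apply_univ]
      rw [hint K hK.measurableSet, one_mul]
    exact h1.trans_lt hK.measure_lt_top
  have hinv : μ.IsAddLeftInvariant := by
    refine ⟨fun h => Measure.ext fun B hB => ?_⟩
    have hB' : MeasurableSet ((fun x => h + x) ⁻¹' B) := hB.preimage (by fun_prop)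
    rw [Measure.map_apply (by fun_prop) hB, hμB _ hB', hμB _ hB, hC,
      map_compProd_shiftMap_prod hξ hpp hB hS]
    have hst : P.map ξ = P.map (fun ω => translateMeasure h (ξ ω)) := (hstat h).symm
    rw [hst, map_compProd_shiftMap_prod (ξ := fun ω => translateMeasure h (ξ ω))
      ((measurable_translateMeasure h).comp hξ)
      (hpp.mono fun ω hω => hω.translate h) hB' hS]
    refine lintegral_congr_ae ?_
    filter_upwards [hpp] with ω hω
    have hmeas : Measurable fun s => S.indicator (fun _ => (1 : ENNReal))
        (translateMeasure s (ξ ω)) := by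
      have h1 : Measurable fun s : ℝ => (shiftMap (ξ ω, s)).2 :=
        (measurable_shiftMap.comp measurable_prodMk_left).snd
      simp only [shiftMap, selfKernel_apply hω] at h1
      exact (measurable_const.indicator hS).comp h1
    rw [← lintegral_indicator hB', ← lintegral_indicator hB]
    have hl : ∀ g : ℝ → ENNReal, Measurable g →
        ∫⁻ u, g u ∂(translateMeasure h (ξ ω)) = ∫⁻ s, g (s - h) ∂(ξ ω) :=
      fun g hg => lintegral_map hg (by fun_prop)
    rw [hl]
    · refine lintegral_congr fun s => ?_
      by_cases hs : s ∈ B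
      · rw [Set.indicator_of_mem hs, Set.indicator_of_mem (by simpa using hs),
          translateMeasure_add, sub_add_cancel]
      · rw [Set.indicator_of_notMem hs, Set.indicator_of_notMem (by simpa using hs)]
    · simp_rw [translateMeasure_add]
      exact (hmeas.comp (measurable_id.add_const h)).indicator hB'
  rw [← hμB B hB, Measure.isAddLeftInvariant_eq_smul μ volume]
  have h01 : μ (Set.Ioc 0 1) = P'.map ξ0 S := by
    rw [hμB _ measurableSet_Ioc, hC, map_compProd_shiftMap_prod hξ hpp measurableSet_Ioc hS,
      Measure.map_apply hξ0 hS]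
    have := hpalm S hS
    rw [inv_one, one_mul] at this
    exact this.symm
  have h02 : μ (Set.Ioc 0 1) = μ.addHaarScalarFactor volume := by
    conv_lhs => rw [Measure.isAddLeftInvariant_eq_smul μ volume]
    simp
  rw [← h01, h02, Measure.smul_apply, mul_comm]
  rfl

end Campbell

end SpacingPalm

namespace SpacingPalm

open ProbabilityTheory

section PalmFormula

variable {Ω Ω' : Type*} [MeasurableSpace Ω] [MeasurableSpace Ω'] {P : Measure Ω}
  {P' : Measure Ω'}
  {ξ : Ω → Measure ℝ} {ξ0 : Ω' → Measure ℝ}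

theorem integrable_prod_of_bounded_support {Q : Measure (Measure ℝ)} [IsProbabilityMeasure Q]
    {V : ℝ × Measure ℝ → ℝ} (hV : StronglyMeasurable V) {A B : ℝ} (hB : ∀ p, |V p| ≤ B)
    (hA : ∀ p, A < |p.1| → V p = 0) : Integrable V ((volume : Measure ℝ).prod Q) := by
  have h1 : Integrable ((Set.Icc (-A) A ×ˢ (Set.univ : Set (Measure ℝ))).indicator
      fun _ => B) ((volume : Measure ℝ).prod Q) := by
    rw [integrable_indicator_iff (measurableSet_Icc.prod MeasurableSet.univ)]
    refine integrableOn_const ?_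
    rw [Measure.prod_prod, Real.volume_Icc, measure_univ, mul_one]
    exact ENNReal.ofReal_ne_top
  refine h1.mono' hV.aestronglyMeasurable (Eventually.of_forall fun p => ?_)
  by_cases hp : p ∈ Set.Icc (-A) A ×ˢ (Set.univ : Set (Measure ℝ))
  · rw [Set.indicator_of_mem hp]
    exact hB p
  · rw [Set.indicator_of_notMem hp, hA p, norm_zero]
    by_contra h
    exact hp ⟨abs_le.1 (not_lt.1 h), trivial⟩

/-- The Campbell formula for bounded functions with bounded support in the shift variable. -/
theorem integral_palm [IsProbabilityMeasure P] [IsProbabilityMeasure P'] (hξ : Measurable ξ)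
    (hξ0 : Measurable ξ0)
    (hpp : ∀ᵐ ω ∂P, IsPointMeasure (ξ ω)) (hstat : Stationary P ξ) (hint : HasIntensity P ξ 1)
    (hpalm : IsPalmOf P ξ P' ξ0 1)
    {V : ℝ × Measure ℝ → ℝ} (hV : StronglyMeasurable V) {A B : ℝ} (hB : ∀ p, |V p| ≤ B)
    (hA : ∀ p, A < |p.1| → V p = 0) :
    ∫ ω, ∫ s, V (s, translateMeasure s (ξ ω)) ∂(ξ ω) ∂P = ∫ ω', (∫ s, V (s, ξ0 ω')) ∂P' := by
  have hQ : IsProbabilityMeasure (P.map ξ) := Measure.isProbabilityMeasure_map hξ.aemeasurable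
  have hQ0 : IsProbabilityMeasure (P'.map ξ0) := Measure.isProbabilityMeasure_map hξ0.aemeasurable
  have hC := map_compProd_shiftMap_eq hξ hξ0 hpp hstat hint hpalm
  have hVi := integrable_prod_of_bounded_support (Q := P'.map ξ0) hV hB hA
  have h1 : ∫ p, V p ∂((volume : Measure ℝ).prod (P'.map ξ0)) =
      ∫ ω', (∫ s, V (s, ξ0 ω')) ∂P' := by
    rw [integral_prod_symm _ hVi, integral_map hξ0.aemeasurable]
    exact hV.integral_prod_left'.aestronglyMeasurable
  have hVs : StronglyMeasurable fun p => V (shiftMap p) := hV.comp_measurable measurable_shiftMap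
  rw [← hC] at h1 hVi
  rw [← h1, integral_map measurable_shiftMap.aemeasurable hV.aestronglyMeasurable,
    Measure.integral_compProd (f := fun p => V (shiftMap p))
      ((integrable_map_measure hV.aestronglyMeasurable measurable_shiftMap.aemeasurable).1 hVi),
    integral_map hξ.aemeasurable]
  · refine integral_congr_ae ?_
    filter_upwards [hpp] with ω hω
    simp only [shiftMap, selfKernel_apply hω]
  · exact hVs.integral_kernel_prod_right'.aestronglyMeasurable

variable {E : Type*} [NormedAddCommGroup E] [NormedSpace ℝ E]

/-- The sum of `f (x + s)` over the positive points `x` of `ν`. -/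
noncomputable def posInt (f : ℝ → E) (p : ℝ × Measure ℝ) : E :=
  ∫ x, (Set.Ioi (0 : ℝ)).indicator (fun x => f (x + p.1)) x ∂(selfKernel p.2)

theorem stronglyMeasurable_posInt {f : ℝ → E} (hf : Continuous f) :
    StronglyMeasurable (posInt f) := by
  have h : StronglyMeasurable fun q : (ℝ × Measure ℝ) × ℝ =>
      ({q | 0 < q.2} : Set ((ℝ × Measure ℝ) × ℝ)).indicator (fun q => f (q.2 + q.1.1)) q :=
    (hf.stronglyMeasurable.comp_measurable (by fun_prop)).indicator
      (measurableSet_lt measurable_const measurable_snd)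
  exact h.integral_kernel_prod_right' (κ := Kernel.prodMkLeft ℝ selfKernel)

theorem posInt_eq_fwdSum [CompleteSpace E] {f : ℝ → E} {A : ℝ} (hA : ∀ x, A < |x| → f x = 0)
    {ν : Measure ℝ}
    (hν : IsPointMeasure ν) (hinf : ν (Set.Ioi 0) = ⊤) (s : ℝ) :
    posInt f (s, ν) = fwdSum f (labels ν) s := by
  rw [posInt, fwdSum_labels hν hinf hA, selfKernel_apply hν, integral_indicator measurableSet_Ioi]

theorem posInt_translate {f : ℝ → E} (hf : Continuous f) {ν : Measure ℝ}
    (hν : IsPointMeasure ν) (s : ℝ) :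
    posInt f (s, translateMeasure s ν) = ∫ x in Set.Ioi s, f x ∂ν := by
  rw [posInt, selfKernel_apply (hν.translate s), translateMeasure, integral_map (by fun_prop),
    ← integral_indicator measurableSet_Ioi]
  · refine integral_congr_ae (Eventually.of_forall fun x => ?_)
    simp [Set.indicator]
  · exact (StronglyMeasurable.indicator
      (hf.stronglyMeasurable.comp_measurable (by fun_prop)) measurableSet_Ioi).aestronglyMeasurable

theorem aestronglyMeasurable_integral (hξ : Measurable ξ) (hpp : ∀ᵐ ω ∂P, IsPointMeasure (ξ ω))
    {f : ℝ → E} (hf : Continuous f) : AEStronglyMeasurable (fun ω => ∫ x, f x ∂(ξ ω)) P := by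
  have h : StronglyMeasurable fun ν : Measure ℝ => ∫ x, f x ∂(selfKernel ν) :=
    StronglyMeasurable.integral_kernel_prod_right' (κ := selfKernel) (f := fun p => f p.2)
      (hf.stronglyMeasurable.comp_measurable measurable_snd)
  refine (h.comp_measurable hξ).aestronglyMeasurable.congr ?_
  filter_upwards [hpp] with ω hω
  simp only [Function.comp_apply, selfKernel_apply hω]

variable (G : BoundedContinuousFunction E ℝ)

theorem stronglyMeasurable_jump_posInt {f : ℝ → E} (hf : Continuous f) :
    StronglyMeasurable fun p : ℝ × Measure ℝ => G (f p.1 + posInt f p) - G (posInt f p) := by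
  have h1 := stronglyMeasurable_posInt hf
  have h2 : StronglyMeasurable fun p : ℝ × Measure ℝ => f p.1 :=
    hf.stronglyMeasurable.comp_measurable measurable_fst
  exact (G.continuous.comp_stronglyMeasurable (h2.add h1)).sub
    (G.continuous.comp_stronglyMeasurable h1)

theorem aestronglyMeasurable_jumpInt_labels [CompleteSpace E] (hξ0 : Measurable ξ0)
    (hpp0 : ∀ᵐ ω' ∂P', IsPointMeasure (ξ0 ω') ∧ InfiniteBothDirections (ξ0 ω'))
    {f : ℝ → E} (hf : Continuous f) {A : ℝ} (hA : ∀ x, A < |x| → f x = 0) :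
    AEStronglyMeasurable (fun ω' => jumpInt G f (labels (ξ0 ω'))) P' := by
  have h := ((stronglyMeasurable_jump_posInt G hf).integral_prod_left'
    (μ := (volume : Measure ℝ))).comp_measurable hξ0
  refine h.aestronglyMeasurable.congr ?_
  filter_upwards [hpp0] with ω' hω'
  simp only [Function.comp_apply, posInt_eq_fwdSum hA hω'.1 hω'.2.2]
  rfl

/-- The law of a linear statistic of `ξ` expressed through the positive points of its Palm
process. -/
theorem integral_comp_eq_jumpInt_labels [CompleteSpace E] [IsProbabilityMeasure P]
    [IsProbabilityMeasure P'] (hξ : Measurable ξ) (hξ0 : Measurable ξ0)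
    (hpp : ∀ᵐ ω ∂P, IsPointMeasure (ξ ω)) (hsimple : ∀ᵐ ω ∂P, ∀ x : ℝ, ξ ω {x} ≤ 1)
    (hstat : Stationary P ξ) (hint : HasIntensity P ξ 1) (hpalm : IsPalmOf P ξ P' ξ0 1)
    (hpp0 : ∀ᵐ ω' ∂P', IsPointMeasure (ξ0 ω') ∧ InfiniteBothDirections (ξ0 ω'))
    {f : ℝ → E} (hf : Continuous f) {A : ℝ} (hA : ∀ x, A < |x| → f x = 0) :
    ∫ ω, G (∫ x, f x ∂(ξ ω)) ∂P = G 0 + ∫ ω', jumpInt G f (labels (ξ0 ω')) ∂P' := by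
  have h := integral_palm hξ hξ0 hpp hstat hint hpalm (stronglyMeasurable_jump_posInt G hf)
    (A := A) (B := 2 * ‖G‖) (fun p => abs_sub_le_two_norm G _ _)
    (fun p hp => by simp [hA p.1 hp])
  have h1 : ∫ ω', (∫ s, (G (f s + posInt f (s, ξ0 ω')) - G (posInt f (s, ξ0 ω')))) ∂P' =
      ∫ ω', jumpInt G f (labels (ξ0 ω')) ∂P' := by
    refine integral_congr_ae ?_
    filter_upwards [hpp0] with ω' hω'
    simp only [posInt_eq_fwdSum hA hω'.1 hω'.2.2]
    rfl
  have h2 : ∫ ω, ∫ s, (G (f s + posInt f (s, translateMeasure s (ξ ω))) -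
      G (posInt f (s, translateMeasure s (ξ ω)))) ∂(ξ ω) ∂P =
      ∫ ω, (G (∫ x, f x ∂(ξ ω)) - G 0) ∂P := by
    refine integral_congr_ae ?_
    filter_upwards [hpp, hsimple] with ω hω hs
    simp only [posInt_translate hf hω]
    exact (comp_integral_sub_eq hω hs G hA).symm
  rw [← h1, ← h, h2, integral_sub _ (integrable_const _)]
  · simp
  · have hm := G.continuous.comp_aestronglyMeasurable (aestronglyMeasurable_integral hξ hpp hf)
    exact (integrable_const ‖G‖).mono' hm (Eventually.of_forall fun ω => G.norm_coe_le_norm _)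

end PalmFormula

end SpacingPalm

namespace SpacingPalm

section FiniteToJump

/-- The average of the first `N` terms of a sequence. -/
noncomputable def avg (a : ℕ → ℝ) (N : ℕ) : ℝ := (N : ℝ)⁻¹ * ∑ n ∈ Finset.range N, a n

theorem avg_mono {a b : ℕ → ℝ} (h : ∀ n, a n ≤ b n) (N : ℕ) : avg a N ≤ avg b N :=
  mul_le_mul_of_nonneg_left (Finset.sum_le_sum fun n _ => h n) (by positivity)

theorem avg_add (a b : ℕ → ℝ) (N : ℕ) : avg (fun n => a n + b n) N = avg a N + avg b N := by
  simp only [avg, Finset.sum_add_distrib, mul_add]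

theorem avg_const_mul (C : ℝ) (a : ℕ → ℝ) (N : ℕ) : avg (fun n => C * a n) N = C * avg a N := by
  simp only [avg, ← Finset.mul_sum]
  ring

theorem abs_avg_sub_le {a b e : ℕ → ℝ} (h : ∀ n, |a n - b n| ≤ e n) (N : ℕ) :
    |avg a N - avg b N| ≤ avg e N := by
  have h1 : avg a N ≤ avg (fun n => b n + e n) N :=
    avg_mono (fun n => by linarith [(abs_le.1 (h n)).2]) N
  have h2 : avg b N ≤ avg (fun n => a n + e n) N :=
    avg_mono (fun n => by linarith [(abs_le.1 (h n)).1]) N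
  rw [avg_add] at h1 h2
  exact abs_le.2 ⟨by linarith, by linarith⟩

variable {E : Type*} [NormedAddCommGroup E]

/-- The integrand of `truncJumpInt`. -/
noncomputable def truncJump (G : BoundedContinuousFunction E ℝ) (f : ℝ → E) {K : ℕ}
    (z : Fin K → ℝ) (s : ℝ) : ℝ :=
  G (f s + ∑ i, f (z i + s)) - G (∑ i, f (z i + s))

theorem abs_truncJump_le (G : BoundedContinuousFunction E ℝ) (f : ℝ → E) {K : ℕ}
    (z : Fin K → ℝ) (s : ℝ) : |truncJump G f z s| ≤ 2 * ‖G‖ :=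
  abs_sub_le_two_norm G _ _

theorem truncJump_eq_zero (G : BoundedContinuousFunction E ℝ) {f : ℝ → E} {K : ℕ}
    (z : Fin K → ℝ) {s : ℝ} (h : f s = 0) : truncJump G f z s = 0 := by
  simp [truncJump, h]

theorem continuous_truncJump (G : BoundedContinuousFunction E ℝ) {f : ℝ → E}
    (hf : Continuous f) (K : ℕ) :
    Continuous fun p : (Fin K → ℝ) × ℝ => truncJump G f p.1 p.2 := by
  have h : Continuous fun p : (Fin K → ℝ) × ℝ => ∑ i, f (p.1 i + p.2) :=
    continuous_finsetSum _ fun i _ => hf.comp (by fun_prop)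
  exact (G.continuous.comp ((hf.comp continuous_snd).add h)).sub (G.continuous.comp h)

theorem abs_integral_truncJump_le (G : BoundedContinuousFunction E ℝ) {f : ℝ → E} {A : ℝ}
    (hA0 : 0 ≤ A) (hf : Continuous f) (hA : ∀ x, A < |x| → f x = 0) {K : ℕ} (z : Fin K → ℝ) :
    |∫ s, truncJump G f z s| ≤ 2 * A * (2 * ‖G‖) :=
  (norm_integral_le_integral_norm (truncJump G f z)).trans
    (integral_abs_le_of_bounded_support hA0
      ((continuous_truncJump G hf K).comp
        (by fun_prop : Continuous fun s => (z, s))).aestronglyMeasurable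
      (abs_truncJump_le G f z) fun s hs => truncJump_eq_zero G z (hA s hs))

/-- The version of `jumpInt` that only sees the first `K` points, as a bounded continuous
function of these points. -/
noncomputable def truncJumpInt (G : BoundedContinuousFunction E ℝ) {f : ℝ → E} {A : ℝ}
    (hA0 : 0 ≤ A) (hf : Continuous f) (hA : ∀ x, A < |x| → f x = 0) (K : ℕ) :
    BoundedContinuousFunction (Fin K → ℝ) ℝ :=
  BoundedContinuousFunction.ofNormedAddCommGroup (fun z => ∫ s, truncJump G f z s)
    (by
      have hc := continuous_truncJump G hf K
      refine continuous_of_dominated (bound := (Set.Icc (-A) A).indicator fun _ => 2 * ‖G‖)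
        (fun z => (hc.comp (by fun_prop : Continuous fun s => (z, s))).aestronglyMeasurable)
        (fun z => Eventually.of_forall fun s => ?_) ?_
        (Eventually.of_forall fun s => hc.comp (by fun_prop : Continuous fun z => (z, s)))
      · by_cases hs : s ∈ Set.Icc (-A) A
        · rw [Set.indicator_of_mem hs]
          exact abs_truncJump_le G f z s
        · rw [Set.indicator_of_notMem hs, truncJump_eq_zero G z (hA s _), norm_zero]
          by_contra h
          exact hs (abs_le.1 (not_lt.1 h))
      · rw [integrable_indicator_iff measurableSet_Icc]
        exact integrableOn_const (by simp))
    (2 * A * (2 * ‖G‖))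
    (abs_integral_truncJump_le G hA0 hf hA)

/-- A continuous cutoff: `1` on `(-∞, B]` and `0` on `[B + 1, ∞)`. -/
noncomputable def cutoff (B : ℝ) : BoundedContinuousFunction ℝ ℝ :=
  BoundedContinuousFunction.ofNormedAddCommGroup (fun r => max 0 (min 1 (B + 1 - r)))
    (by fun_prop) 1 (fun r => by
      rw [Real.norm_of_nonneg (le_max_left _ _)]
      exact max_le zero_le_one (min_le_left _ _))

theorem cutoff_nonneg (B r : ℝ) : 0 ≤ cutoff B r := le_max_left _ _

theorem cutoff_le_one (B r : ℝ) : cutoff B r ≤ 1 := max_le zero_le_one (min_le_left _ _)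

theorem cutoff_eq_one {B r : ℝ} (h : r ≤ B) : cutoff B r = 1 := by
  change max 0 (min 1 (B + 1 - r)) = 1
  rw [min_eq_left (by linarith), max_eq_right zero_le_one]

theorem cutoff_eq_zero {B r : ℝ} (h : B + 1 ≤ r) : cutoff B r = 0 := by
  change max 0 (min 1 (B + 1 - r)) = 0
  exact max_eq_left ((min_le_right _ _).trans (by linarith))

theorem abs_jumpInt_sub_truncJumpInt_le (G : BoundedContinuousFunction E ℝ) {f : ℝ → E} {A : ℝ}
    (hA0 : 0 ≤ A) (hf : Continuous f) (hA : ∀ x, A < |x| → f x = 0) {y : ℕ → ℝ}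
    (hy : Monotone y) (hyt : Tendsto y atTop atTop) (K : ℕ) :
    |jumpInt G f y - truncJumpInt G hA0 hf hA (K + 1) (fun i => y i)| ≤
      8 * A * ‖G‖ * cutoff (2 * A) (y K) := by
  rcases le_or_gt (y K) (2 * A) with h | h
  · rw [cutoff_eq_one h]
    have h1 := abs_jumpInt_le G hA0 hf hA hyt
    have h2 : |truncJumpInt G hA0 hf hA (K + 1) (fun i => y i)| ≤ 2 * A * (2 * ‖G‖) :=
      abs_integral_truncJump_le G hA0 hf hA _
    have h3 := abs_sub (jumpInt G f y) (truncJumpInt G hA0 hf hA (K + 1) (fun i => y i))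
    linarith
  · have : jumpInt G f y = truncJumpInt G hA0 hf hA (K + 1) (fun i => y i) := by
      change ∫ s, jump G f y s = ∫ s, truncJump G f (fun i : Fin (K + 1) => y i) s
      refine integral_congr_ae (Eventually.of_forall fun s => ?_)
      rcases lt_or_ge A |s| with hs | hs
      · rw [jump_eq_zero G y (hA s hs), truncJump_eq_zero G _ (hA s hs)]
      · have hsum : fwdSum f y s = ∑ i : Fin (K + 1), f (y i + s) := by
          rw [fwdSum_eq_sum (K + 1) fun i hi => ?_, Finset.sum_range]
          have h1 : y K ≤ y i := hy (by omega)
          have h2 := neg_abs_le s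
          exact hA _ (lt_of_lt_of_le (by linarith) (le_abs_self _))
        rw [jump, truncJump, hsum]
    rw [this, sub_self, abs_zero]
    exact mul_nonneg (by positivity) (cutoff_nonneg _ _)

variable {Ω' : Type*} [MeasurableSpace Ω'] {P' : Measure Ω'} [IsProbabilityMeasure P']
  {x : Ω' → ℕ → ℝ} {y : ℕ → ℕ → ℝ}

/-- Convergence of finitely many coordinates implies convergence of `jumpInt`. -/
theorem tendsto_avg_jumpInt (hx : ∀ᵐ ω ∂P', Monotone (x ω) ∧ Tendsto (x ω) atTop atTop)
    (hxm : ∀ i, Measurable fun ω => x ω i)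
    (hy : ∀ n, Monotone (y n) ∧ Tendsto (y n) atTop atTop)
    (hii : ∀ (K : ℕ) (F : BoundedContinuousFunction (Fin (K + 1) → ℝ) ℝ),
      Tendsto (avg fun n => F fun i => y n i) atTop (𝓝 (∫ ω, F (fun i => x ω i) ∂P')))
    (G : BoundedContinuousFunction E ℝ) {f : ℝ → E} {A : ℝ}
    (hA0 : 0 ≤ A) (hf : Continuous f) (hA : ∀ x, A < |x| → f x = 0)
    (hm : AEStronglyMeasurable (fun ω => jumpInt G f (x ω)) P') :
    Tendsto (avg fun n => jumpInt G f (y n)) atTop (𝓝 (∫ ω, jumpInt G f (x ω) ∂P')) := by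
  set C : ℝ := 8 * A * ‖G‖ with hC
  have hC0 : 0 ≤ C := by positivity
  have hcut : Tendsto (fun K => ∫ ω, cutoff (2 * A) (x ω K) ∂P') atTop (𝓝 0) := by
    have := tendsto_integral_of_dominated_convergence (μ := P')
      (F := fun K ω => cutoff (2 * A) (x ω K)) (f := fun _ => (0 : ℝ)) (fun _ => 1)
      (fun K => ((cutoff (2 * A)).continuous.measurable.comp (hxm K)).aestronglyMeasurable)
      (integrable_const 1)
      (fun K => Eventually.of_forall fun ω => by
        rw [Real.norm_of_nonneg (cutoff_nonneg _ _)]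
        exact cutoff_le_one _ _)
      (by
        filter_upwards [hx] with ω hω
        refine tendsto_const_nhds.congr' ?_
        filter_upwards [hω.2.eventually_ge_atTop (2 * A + 1)] with K hK
        exact (cutoff_eq_zero hK).symm)
    simpa using this
  rw [Metric.tendsto_atTop]
  intro ε hε
  have hC1 : 0 < C + 1 := by linarith
  obtain ⟨K, hK⟩ := ((hcut.const_mul (C + 1)).eventually
    (gt_mem_nhds (show (C + 1) * 0 < ε / 4 by rw [mul_zero]; positivity))).exists
  set H := truncJumpInt G hA0 hf hA (K + 1) with hH
  have hproj : Continuous fun z : Fin (K + 1) → ℝ => z (Fin.last K) := continuous_apply _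
  have hU := hii K ((cutoff (2 * A)).compContinuous ⟨_, hproj⟩)
  have hHt := hii K H
  set U := ∫ ω, cutoff (2 * A) (x ω K) ∂P' with hUdef
  have hU' : Tendsto (avg fun n => cutoff (2 * A) (y n K)) atTop (𝓝 U) := hU
  have hU0 : 0 ≤ U := integral_nonneg fun ω => cutoff_nonneg _ _
  have hxvec : Measurable fun ω => fun i : Fin (K + 1) => x ω i :=
    measurable_pi_lambda _ fun i => hxm i
  have hdiff : |∫ ω, jumpInt G f (x ω) ∂P' - ∫ ω, H (fun i => x ω i) ∂P'| ≤ C * U := by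
    have hb : ∀ᵐ ω ∂P', ‖jumpInt G f (x ω)‖ ≤ 2 * A * (2 * ‖G‖) := by
      filter_upwards [hx] with ω hω
      exact abs_jumpInt_le G hA0 hf hA hω.2
    have hHi : Integrable (fun ω => H fun i => x ω i) P' :=
      (integrable_const ‖H‖).mono' (H.continuous.measurable.comp hxvec).aestronglyMeasurable
        (Eventually.of_forall fun ω => H.norm_coe_le_norm _)
    rw [← integral_sub ((integrable_const _).mono' hm hb) hHi, hUdef, ← integral_const_mul]
    refine norm_integral_le_of_norm_le (f := fun ω => jumpInt G f (x ω) - H fun i => x ω i) ?_ ?_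
    · refine Integrable.const_mul ?_ _
      exact (integrable_const (1 : ℝ)).mono'
        ((cutoff (2 * A)).continuous.measurable.comp (hxm K)).aestronglyMeasurable
        (Eventually.of_forall fun ω => by
          rw [Real.norm_of_nonneg (cutoff_nonneg _ _)]
          exact cutoff_le_one _ _)
    · filter_upwards [hx] with ω hω
      exact abs_jumpInt_sub_truncJumpInt_le G hA0 hf hA hω.1 hω.2 K
  have hCU : C * U < ε / 4 := by nlinarith
  have hev1 := Metric.tendsto_atTop.1 hHt (ε / 4) (by positivity)
  have hev2 : ∀ᶠ N in atTop, C * avg (fun n => cutoff (2 * A) (y n K)) N < ε / 4 :=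
    (hU'.const_mul C).eventually (gt_mem_nhds hCU)
  obtain ⟨N1, hN1⟩ := hev1
  obtain ⟨N2, hN2⟩ := eventually_atTop.1 hev2
  refine ⟨max N1 N2, fun N hN => ?_⟩
  have e1 := hN1 N (le_of_max_le_left hN)
  have e2 := hN2 N (le_of_max_le_right hN)
  have e3 := abs_avg_sub_le (fun n => abs_jumpInt_sub_truncJumpInt_le G hA0 hf hA (hy n).1
    (hy n).2 K) N
  rw [avg_const_mul] at e3
  rw [Real.dist_eq] at e1 ⊢
  rw [abs_lt] at e1
  rw [abs_le] at e3 hdiff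
  rw [abs_lt]
  constructor <;> linarith [e1.1, e1.2, e3.1, e3.2, hdiff.1, hdiff.2]

end FiniteToJump

end SpacingPalm

namespace SpacingPalm

open ProbabilityTheory

section CramerWold

variable {E : Type*} [NormedAddCommGroup E] [InnerProductSpace ℝ E] [MeasurableSpace E]
  [BorelSpace E]

/-- The cosine as a bounded continuous function. -/
noncomputable def cosBCF : BoundedContinuousFunction ℝ ℝ :=
  BoundedContinuousFunction.ofNormedAddCommGroup Real.cos Real.continuous_cos 1 Real.abs_cos_le_one

/-- The sine as a bounded continuous function. -/
noncomputable def sinBCF : BoundedContinuousFunction ℝ ℝ :=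
  BoundedContinuousFunction.ofNormedAddCommGroup Real.sin Real.continuous_sin 1 Real.abs_sin_le_one

theorem charFun_eq_cos_add_sin [SecondCountableTopology E] (μ : Measure E)
    [IsProbabilityMeasure μ] (u : E) :
    charFun μ u = ((∫ x, cosBCF (inner ℝ u x) ∂μ : ℝ) : ℂ) +
      ((∫ x, sinBCF (inner ℝ u x) ∂μ : ℝ) : ℂ) * Complex.I := by
  have hi : ∀ g : BoundedContinuousFunction ℝ ℝ, Integrable (fun x => g (inner ℝ u x)) μ :=
    fun g => (integrable_const ‖g‖).mono'
      (g.continuous.comp (continuous_const.inner continuous_id)).aestronglyMeasurable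
      (Eventually.of_forall fun x => g.norm_coe_le_norm _)
  rw [charFun_apply, ← integral_complex_ofReal, ← integral_complex_ofReal, ← integral_mul_const,
    ← integral_add (hi cosBCF).ofReal ((hi sinBCF).ofReal.mul_const _)]
  refine integral_congr_ae (Eventually.of_forall fun x => ?_)
  simp only [Complex.exp_mul_I, real_inner_comm u x]
  change _ = ((Real.cos (inner ℝ u x) : ℝ) : ℂ) + ((Real.sin (inner ℝ u x) : ℝ) : ℂ) * Complex.I
  rw [Complex.ofReal_cos, Complex.ofReal_sin]

/-- The Cramér–Wold device. -/
theorem tendsto_of_forall_inner [FiniteDimensional ℝ E] {μ : ℕ → ProbabilityMeasure E}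
    {μ0 : ProbabilityMeasure E}
    (h : ∀ (u : E) (g : BoundedContinuousFunction ℝ ℝ),
      Tendsto (fun n => ∫ x, g (inner ℝ u x) ∂(μ n : Measure E)) atTop
        (𝓝 (∫ x, g (inner ℝ u x) ∂(μ0 : Measure E)))) : Tendsto μ atTop (𝓝 μ0) := by
  have : SecondCountableTopology E := secondCountable_of_proper
  refine ProbabilityMeasure.tendsto_of_tendsto_charFun fun u => ?_
  simp only [charFun_eq_cos_add_sin]
  exact ((Complex.continuous_ofReal.tendsto _).comp (h u cosBCF)).add
    (((Complex.continuous_ofReal.tendsto _).comp (h u sinBCF)).mul_const _)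

end CramerWold

section VectorStatistics

/-- The uniform distribution on `(0, T]`. -/
noncomputable def unif (T : ℝ) : Measure ℝ :=
  (ENNReal.ofReal T)⁻¹ • volume.restrict (Set.Ioc 0 T)

theorem isProbabilityMeasure_unif {T : ℝ} (hT : 0 < T) : IsProbabilityMeasure (unif T) := by
  refine ⟨?_⟩
  rw [unif, Measure.smul_apply, Measure.restrict_apply_univ, Real.volume_Ioc, sub_zero,
    smul_eq_mul, ENNReal.inv_mul_cancel]
  · simpa using hT
  · exact ENNReal.ofReal_ne_top

theorem integral_unif {T : ℝ} (hT : 0 < T) (φ : ℝ → ℝ) :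
    ∫ t, φ t ∂(unif T) = (∫ t in (0 : ℝ)..T, φ t) / T := by
  rw [unif, integral_smul_measure, intervalIntegral.integral_of_le hT.le, ENNReal.toReal_inv,
    ENNReal.toReal_ofReal hT.le, smul_eq_mul, div_eq_inv_mul]

theorem inner_fwdSum {E : Type*} [NormedAddCommGroup E] [InnerProductSpace ℝ E] {f : ℝ → E}
    {A : ℝ} (hA : ∀ x, A < |x| → f x = 0) {d : ℕ → ℝ} (hd : Tendsto d atTop atTop) (u : E)
    (s : ℝ) : inner ℝ u (fwdSum f d s) = fwdSum (fun x => inner ℝ u (f x)) d s := by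
  obtain ⟨n, hn⟩ := eventually_atTop.1 (hd.eventually_gt_atTop (A - s))
  have hz : ∀ i, n ≤ i → f (d i + s) = 0 := fun i hi =>
    hA _ (lt_of_lt_of_le (by linarith [hn i hi]) (le_abs_self _))
  rw [fwdSum_eq_sum n hz, fwdSum_eq_sum n fun i hi => by rw [hz i hi, inner_zero_right], inner_sum]

theorem hasCompactSupport_of_bounded {E : Type*} [Zero E] {f : ℝ → E}
    {A : ℝ} (hA : ∀ x, A < |x| → f x = 0) : HasCompactSupport f := by
  refine HasCompactSupport.of_support_subset_isCompact (isCompact_Icc (a := -A) (b := A)) ?_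
  intro x hx
  by_contra h
  exact hx (hA x (by
    by_contra h'
    exact h (abs_le.1 (not_lt.1 h'))))

variable {Ω : Type*} [MeasurableSpace Ω] {P : Measure Ω} [IsProbabilityMeasure P]
  {ξ : Ω → Measure ℝ} {d : ℕ → ℝ}

/-- Convergence of all scalar linear statistics implies convergence of vector-valued ones. -/
theorem tendsto_vector_stat {E : Type*} [NormedAddCommGroup E] [InnerProductSpace ℝ E]
    [FiniteDimensional ℝ E] (hξ : Measurable ξ) (hpp : ∀ᵐ ω ∂P, IsPointMeasure (ξ ω))
    (hd : Tendsto d atTop atTop)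
    (hi : ∀ f : ℝ → ℝ, Continuous f → HasCompactSupport f →
      ∀ g : BoundedContinuousFunction ℝ ℝ,
        Tendsto (fun T : ℝ => (∫ t in (0 : ℝ)..T, g (fwdSum f d (-t))) / T) atTop
          (𝓝 (∫ ω, g (∫ x, f x ∂(ξ ω)) ∂P)))
    (G : BoundedContinuousFunction E ℝ) {f : ℝ → E} {A : ℝ} (hf : Continuous f)
    (hA : ∀ x, A < |x| → f x = 0) :
    Tendsto (fun N : ℕ => (∫ t in (0 : ℝ)..((N : ℝ) + 1), G (fwdSum f d (-t))) / ((N : ℝ) + 1))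
      atTop (𝓝 (∫ ω, G (∫ x, f x ∂(ξ ω)) ∂P)) := by
  borelize E
  have : SecondCountableTopology E := secondCountable_of_proper
  have hc : Continuous fun t => fwdSum f d (-t) := continuous_fwdSum_neg hf hA hd
  have hξm : AEMeasurable (fun ω => ∫ x, f x ∂(ξ ω)) P :=
    (aestronglyMeasurable_integral hξ hpp hf).aemeasurable
  have hpos : ∀ N : ℕ, (0 : ℝ) < (N : ℝ) + 1 := fun N => by positivity
  have hu : ∀ N : ℕ, IsProbabilityMeasure (unif ((N : ℝ) + 1)) := fun N =>
    isProbabilityMeasure_unif (hpos N)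
  let μ : ℕ → ProbabilityMeasure E := fun N =>
    ⟨(unif ((N : ℝ) + 1)).map fun t => fwdSum f d (-t),
      Measure.isProbabilityMeasure_map hc.measurable.aemeasurable⟩
  let μ0 : ProbabilityMeasure E :=
    ⟨P.map fun ω => ∫ x, f x ∂(ξ ω), Measure.isProbabilityMeasure_map hξm⟩
  have hμ : ∀ (N : ℕ) (φ : E → ℝ), Continuous φ → ∫ x, φ x ∂(μ N : Measure E) =
      (∫ t in (0 : ℝ)..((N : ℝ) + 1), φ (fwdSum f d (-t))) / ((N : ℝ) + 1) := fun N φ hφ => by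
    rw [← integral_unif (hpos N)]
    exact integral_map hc.measurable.aemeasurable hφ.aestronglyMeasurable
  have hμ0 : ∀ φ : E → ℝ, Continuous φ → ∫ x, φ x ∂(μ0 : Measure E) =
      ∫ ω, φ (∫ x, f x ∂(ξ ω)) ∂P := fun φ hφ =>
    integral_map hξm hφ.aestronglyMeasurable
  have hT : Tendsto (fun N : ℕ => (N : ℝ) + 1) atTop atTop :=
    tendsto_atTop_add_const_right _ _ tendsto_natCast_atTop_atTop
  have key : Tendsto μ atTop (𝓝 μ0) := by
    refine tendsto_of_forall_inner fun u g => ?_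
    have hgc : Continuous fun x : E => g (inner ℝ u x) :=
      g.continuous.comp (continuous_const.inner continuous_id)
    simp only [hμ _ _ hgc, hμ0 _ hgc, inner_fwdSum hA hd]
    have hsc : ∀ x, A < |x| → inner ℝ u (f x) = 0 := fun x hx => by
      rw [hA x hx, inner_zero_right]
    have h := (hi (fun x => inner ℝ u (f x)) (continuous_const.inner hf)
      (hasCompactSupport_of_bounded hsc) g).comp hT
    have e : ∫ ω, g (∫ x, inner ℝ u (f x) ∂(ξ ω)) ∂P =
        ∫ ω, g (inner ℝ u (∫ x, f x ∂(ξ ω))) ∂P := by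
      refine integral_congr_ae ?_
      filter_upwards [hpp] with ω hω
      have := hω.isLocallyFiniteMeasure
      rw [integral_inner
        (hf.integrable_of_hasCompactSupport (hasCompactSupport_of_bounded hA))]
    rw [e] at h
    exact h
  have := ProbabilityMeasure.tendsto_iff_forall_integral_tendsto.1 key G
  simpa only [hμ _ _ G.continuous, hμ0 _ G.continuous] using this

/-- Convergence of all scalar linear statistics implies convergence of averages of `jumpInt`. -/
theorem tendsto_avg_jumpInt_of_stat {E : Type*} [NormedAddCommGroup E] [InnerProductSpace ℝ E]
    [FiniteDimensional ℝ E] (hξ : Measurable ξ) (hpp : ∀ᵐ ω ∂P, IsPointMeasure (ξ ω))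
    {N : ℝ → ℕ} (hdN : ∀ n T, n < N T ↔ d n ≤ T)
    (hN : Tendsto (fun T => (N T : ℝ) / T) atTop (𝓝 1))
    (hi : ∀ f : ℝ → ℝ, Continuous f → HasCompactSupport f →
      ∀ g : BoundedContinuousFunction ℝ ℝ,
        Tendsto (fun T : ℝ => (∫ t in (0 : ℝ)..T, g (fwdSum f d (-t))) / T) atTop
          (𝓝 (∫ ω, g (∫ x, f x ∂(ξ ω)) ∂P)))
    (G : BoundedContinuousFunction E ℝ) {f : ℝ → E} {A : ℝ} (hA0 : 0 ≤ A) (hf : Continuous f)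
    (hA : ∀ x, A < |x| → f x = 0) {l : ℝ} (hl : ∫ ω, G (∫ x, f x ∂(ξ ω)) ∂P = G 0 + l) :
    Tendsto (avg fun n => jumpInt G f (gaps d n)) atTop (𝓝 l) := by
  have hT : Tendsto (fun N : ℕ => (N : ℝ) + 1) atTop atTop :=
    tendsto_atTop_add_const_right _ _ tendsto_natCast_atTop_atTop
  have h1 := tendsto_vector_stat hξ hpp (tendsto_points_atTop hdN) hi G hf hA
  have h2 := h1.sub ((tendsto_stat_sub_jump hdN hN G hA0 hf hA).comp hT)
  rw [hl, add_sub_cancel_left] at h2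
  refine (tendsto_add_atTop_iff_nat 1).1 (h2.congr fun n => ?_)
  have hfl : ⌊(n : ℝ) + 1⌋₊ = n + 1 := by
    rw [Nat.floor_add_one (Nat.cast_nonneg n), Nat.floor_natCast]
  simp only [Function.comp_apply, hfl, avg, sub_sub_cancel]
  push_cast
  rw [div_eq_inv_mul]

end VectorStatistics

end SpacingPalm

namespace SpacingPalm

section Reconstruction

/-- The projection of the real line onto `[0, 1]`. -/
noncomputable def clamp (r : ℝ) : ℝ := max 0 (min 1 r)

theorem clamp_nonneg (r : ℝ) : 0 ≤ clamp r := le_max_left _ _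

theorem clamp_le_one (r : ℝ) : clamp r ≤ 1 := max_le zero_le_one (min_le_left _ _)

theorem clamp_of_nonpos {r : ℝ} (h : r ≤ 0) : clamp r = 0 :=
  max_eq_left ((min_le_right _ _).trans h)

theorem clamp_of_one_le {r : ℝ} (h : 1 ≤ r) : clamp r = 1 := by
  rw [clamp, min_eq_left h, max_eq_right zero_le_one]

theorem clamp_of_mem {r : ℝ} (h0 : 0 ≤ r) (h1 : r ≤ 1) : clamp r = r := by
  rw [clamp, min_eq_right h1, max_eq_right h0]

theorem monotone_clamp : Monotone clamp := fun _ _ h =>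
  max_le_max le_rfl (min_le_min le_rfl h)

theorem continuous_clamp : Continuous clamp := by
  unfold clamp
  fun_prop

/-- The coordinates of the test function: a tent at the origin, a wider bump at the origin, and
indicators of the intervals `[3, i]`. -/
noncomputable def probe : ℕ → ℝ → ℝ
  | 0, x => clamp (1 - |x|)
  | 1, x => clamp (6 - |x|)
  | i + 2, x => clamp (min (x - 2) (i + 1 - x))

theorem continuous_probe (i : ℕ) : Continuous (probe i) := by
  match i with
  | 0 => exact continuous_clamp.comp (by fun_prop)
  | 1 => exact continuous_clamp.comp (by fun_prop)
  | i + 2 => exact continuous_clamp.comp (by fun_prop)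

theorem probe_nonneg (i : ℕ) (x : ℝ) : 0 ≤ probe i x := by
  match i with
  | 0 => exact clamp_nonneg _
  | 1 => exact clamp_nonneg _
  | i + 2 => exact clamp_nonneg _

theorem probe_le_one (i : ℕ) (x : ℝ) : probe i x ≤ 1 := by
  match i with
  | 0 => exact clamp_le_one _
  | 1 => exact clamp_le_one _
  | i + 2 => exact clamp_le_one _

theorem probe_eq_zero {i : ℕ} {x : ℝ} (h : (i : ℝ) + 6 < |x|) : probe i x = 0 := by
  match i with
  | 0 => exact clamp_of_nonpos (by norm_num at h; linarith)
  | 1 => exact clamp_of_nonpos (by norm_num at h; linarith)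
  | i + 2 =>
    refine clamp_of_nonpos ?_
    push_cast at h
    rcases lt_abs.1 h with h | h
    · exact (min_le_right _ _).trans (by linarith)
    · exact (min_le_left _ _).trans (by linarith [(Nat.cast_nonneg i : (0 : ℝ) ≤ i)])

theorem probe_zero_eq_zero {x : ℝ} (h : 1 ≤ |x|) : probe 0 x = 0 :=
  clamp_of_nonpos (by linarith)

theorem probe_zero_of_le {x : ℝ} (h : |x| ≤ 1) : probe 0 x = 1 - |x| :=
  clamp_of_mem (by linarith) (by linarith [abs_nonneg x])

theorem probe_one_eq_zero {x : ℝ} (h : 6 ≤ |x|) : probe 1 x = 0 :=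
  clamp_of_nonpos (by linarith)

theorem probe_one_eq_one {x : ℝ} (h : |x| ≤ 5) : probe 1 x = 1 :=
  clamp_of_one_le (by linarith)

theorem probe_add_two_eq_zero_of_le {i : ℕ} {x : ℝ} (h : x ≤ 2) : probe (i + 2) x = 0 :=
  clamp_of_nonpos ((min_le_left _ _).trans (by linarith))

theorem probe_add_two_eq_zero {i : ℕ} {x : ℝ} (h : (i : ℝ) + 1 ≤ x) : probe (i + 2) x = 0 :=
  clamp_of_nonpos ((min_le_right _ _).trans (by linarith))

theorem probe_add_two_eq_one {i : ℕ} {x : ℝ} (h : 3 ≤ x) (h' : x ≤ i) : probe (i + 2) x = 1 :=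
  clamp_of_one_le (le_min (by linarith) (by linarith))

/-- The vector of the functions `probe i` at scale `ε`. -/
noncomputable def probeVec (ε : ℝ) (m : ℕ) (x : ℝ) : EuclideanSpace ℝ (Fin m) :=
  WithLp.toLp 2 fun i => probe i (x / ε)

theorem continuous_probeVec (ε : ℝ) (m : ℕ) : Continuous (probeVec ε m) :=
  (PiLp.continuous_toLp 2 _).comp
    (continuous_pi fun i => (continuous_probe i).comp (continuous_id.div_const ε))

theorem probeVec_eq_zero {ε : ℝ} (hε : 0 < ε) {m : ℕ} {x : ℝ} (h : ((m : ℝ) + 6) * ε < |x|) :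
    probeVec ε m x = 0 := by
  ext i
  change probe i (x / ε) = 0
  refine probe_eq_zero ?_
  rw [abs_div, abs_of_pos hε, lt_div_iff₀ hε]
  refine lt_of_le_of_lt ?_ h
  have : ((i : ℕ) : ℝ) ≤ m := by exact_mod_cast i.2.le
  gcongr

theorem fwdSum_probeVec {ε : ℝ} (hε : 0 < ε) {m : ℕ} {y : ℕ → ℝ} (hy : Tendsto y atTop atTop)
    (s : ℝ) (i : Fin m) :
    fwdSum (probeVec ε m) y s i = ∑' n, probe i ((y n + s) / ε) := by
  obtain ⟨n, hn⟩ := eventually_atTop.1 (hy.eventually_gt_atTop (((m : ℝ) + 6) * ε - s))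
  have h0 : ∀ k, n ≤ k → probeVec ε m (y k + s) = 0 := fun k hk =>
    probeVec_eq_zero hε (lt_of_lt_of_le (by linarith [hn k hk]) (le_abs_self _))
  rw [fwdSum_eq_sum n h0, tsum_eq_sum (s := Finset.range n)]
  · simp [probeVec]
  · intro k hk
    have := congrArg (fun v : EuclideanSpace ℝ (Fin m) => v i)
      (h0 k (by simpa using hk))
    exact this

/-- The approximate reconstruction, at scale `ε`, of the `j`-th point from the linear statistics of
`probeVec`. -/
noncomputable def recon (ε : ℝ) (M : ℕ) (v : EuclideanSpace ℝ (Fin (M + 2))) (j : ℕ) : ℝ :=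
  ∑ i : Fin M, ε * clamp (j + 1 - v i.succ.succ)

theorem sum_step_le {M : ℕ} {a : ℕ → ℝ} {t : ℝ} (ht : 0 ≤ t) (h1 : ∀ i, a i ≤ 1)
    (h0 : ∀ i : ℕ, t ≤ i → a i = 0) : ∑ i ∈ Finset.range M, a i ≤ min (t + 1) M := by
  induction M with
  | zero => simp; linarith
  | succ M ih =>
    rw [Finset.sum_range_succ]
    push_cast
    rcases le_or_gt t M with h | h
    · rw [h0 M h, add_zero]
      exact ih.trans (min_le_min le_rfl (by linarith))
    · rw [min_eq_right (by linarith)]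
      linarith [h1 M, ih.trans (min_le_right _ _)]

theorem le_sum_step {M : ℕ} {a : ℕ → ℝ} {t : ℝ} (h0 : ∀ i, 0 ≤ a i)
    (h1 : ∀ i : ℕ, (i : ℝ) + 1 ≤ t → a i = 1) :
    min (t - 1) M ≤ ∑ i ∈ Finset.range M, a i := by
  induction M with
  | zero => simp
  | succ M ih =>
    rw [Finset.sum_range_succ]
    push_cast
    rcases le_or_gt ((M : ℝ) + 1) t with h | h
    · rw [min_eq_right (by linarith)] at ih
      rw [h1 M h]
      linarith [min_le_right (t - 1) ((M : ℝ) + 1)]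
    · rw [min_eq_left (by linarith)] at ih ⊢
      linarith [h0 M]

theorem tsum_probe_le {x : ℕ → ℝ} (hx : Monotone x) {i j : ℕ} (h : (i : ℝ) + 1 ≤ x j) :
    ∑' n, probe (i + 2) (x n) ≤ j := by
  rw [tsum_eq_sum (s := Finset.range j)]
  · refine (Finset.sum_le_sum fun n _ => probe_le_one _ _).trans ?_
    simp
  · intro n hn
    exact probe_add_two_eq_zero (h.trans (hx (by simpa using hn)))

theorem le_tsum_probe {x : ℕ → ℝ} (hx : Monotone x) (hxt : Tendsto x atTop atTop)
    (hx3 : ∀ n, 3 ≤ x n) {i j : ℕ} (h : x j ≤ i) :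
    (j : ℝ) + 1 ≤ ∑' n, probe (i + 2) (x n) := by
  obtain ⟨m, hm⟩ := eventually_atTop.1 (hxt.eventually_ge_atTop ((i : ℝ) + 1))
  rw [tsum_eq_sum (s := Finset.range (max m (j + 1)))]
  · refine le_trans ?_ (Finset.sum_le_sum_of_subset_of_nonneg
      (Finset.range_mono (le_max_right m (j + 1))) fun n _ _ => probe_nonneg _ _)
    rw [Finset.sum_congr rfl fun n hn => probe_add_two_eq_one (hx3 n)
      ((hx (by simpa [Nat.lt_succ_iff] using hn)).trans h)]
    simp
  · intro n hn
    refine probe_add_two_eq_zero (hm n ?_)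
    simp at hn
    exact hn.1

theorem abs_recon_sub_le {ε : ℝ} (hε : 0 < ε) {M : ℕ} {y : ℕ → ℝ} (hy : Monotone y)
    (hyt : Tendsto y atTop atTop) {s : ℝ} (hs : |s| ≤ ε) (h0 : 4 * ε < y 0)
    {v : EuclideanSpace ℝ (Fin (M + 2))}
    (hv : ∀ i : Fin M, v i.succ.succ = ∑' n, probe (i + 2) ((y n + s) / ε)) (j : ℕ) :
    |recon ε M v j - min (y j) (M * ε)| ≤ 2 * ε := by
  have hs' := abs_le.1 hs
  set x : ℕ → ℝ := fun n => (y n + s) / ε with hxdef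
  have hx : Monotone x := fun a b hab => by
    have := hy hab
    simp only [hxdef]
    gcongr
  have hxt : Tendsto x atTop atTop :=
    (tendsto_atTop_add_const_right _ s hyt).atTop_div_const hε
  have hx3 : ∀ n, 3 ≤ x n := fun n => by
    rw [le_div_iff₀ hε]
    linarith [hy (Nat.zero_le n)]
  have hxj : ε * x j = y j + s := by
    simp only [hxdef]
    field_simp
  set a : ℕ → ℝ := fun i => clamp (j + 1 - ∑' n, probe (i + 2) (x n)) with ha
  have hr : recon ε M v j = ε * ∑ i ∈ Finset.range M, a i := by
    rw [recon, Finset.mul_sum, Finset.sum_range]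
    exact Finset.sum_congr rfl fun i _ => by rw [hv i]
  have hup := sum_step_le (M := M) (a := a) (t := x j) (by linarith [hx3 j])
    (fun i => clamp_le_one _)
    (fun i hi => clamp_of_nonpos (by linarith [le_tsum_probe hx hxt hx3 hi]))
  have hlo := le_sum_step (M := M) (a := a) (t := x j) (fun i => clamp_nonneg _)
    (fun i hi => clamp_of_one_le (by linarith [tsum_probe_le hx hi]))
  have hup' := mul_le_mul_of_nonneg_left hup hε.le
  have hlo' := mul_le_mul_of_nonneg_left hlo hε.le
  rw [hr, abs_le]
  rw [mul_min_of_nonneg _ _ hε.le, mul_sub, hxj] at hlo'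
  rw [mul_min_of_nonneg _ _ hε.le, mul_add, hxj] at hup'
  constructor
  · rcases le_total (y j + s - ε * 1) (ε * M) with h | h
    · rw [min_eq_left h] at hlo'
      linarith [min_le_left (y j) (M * ε)]
    · rw [min_eq_right h] at hlo'
      linarith [min_le_right (y j) (M * ε)]
  · rcases le_total (y j) (M * ε) with h | h
    · rw [min_eq_left h]
      linarith [min_le_left (y j + s + ε * 1) (ε * M)]
    · rw [min_eq_right h]
      linarith [min_le_right (y j + s + ε * 1) (ε * M)]

end Reconstruction

end SpacingPalm

namespace SpacingPalm

section JumpToFinite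

variable {K : ℕ} (F : BoundedContinuousFunction (Fin K → ℝ) ℝ)

/-- The function of the linear statistics of `probeVec` that evaluates `F` at the reconstructed
points when there is a point near the origin and no other nearby. -/
noncomputable def probeFun (ε : ℝ) (M : ℕ) :
    BoundedContinuousFunction (EuclideanSpace ℝ (Fin (M + 2))) ℝ :=
  BoundedContinuousFunction.ofNormedAddCommGroup
    (fun v => clamp (v 0) * clamp (2 - v 1) * F fun j => recon ε M v j)
    (by
      have h : ∀ i, Continuous fun v : EuclideanSpace ℝ (Fin (M + 2)) => v i := fun i => by
        fun_prop
      refine ((continuous_clamp.comp (h 0)).mul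
        (continuous_clamp.comp (continuous_const.sub (h 1)))).mul
        (F.continuous.comp (continuous_pi fun j => continuous_finsetSum _ fun i _ =>
          continuous_const.mul (continuous_clamp.comp (continuous_const.sub (h _))))))
    ‖F‖ (fun v => by
      rw [norm_mul, norm_mul, Real.norm_of_nonneg (clamp_nonneg _),
        Real.norm_of_nonneg (clamp_nonneg _)]
      have h1 := mul_le_mul (clamp_le_one (v 0)) (clamp_le_one (2 - v 1)) (clamp_nonneg _)
        zero_le_one
      have h2 := F.norm_coe_le_norm fun j => recon ε M v j
      have := mul_le_mul h1 h2 (norm_nonneg _) (by norm_num)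
      simpa using this)

theorem norm_probeFun_le (ε : ℝ) (M : ℕ) : ‖probeFun F ε M‖ ≤ ‖F‖ :=
  BoundedContinuousFunction.norm_ofNormedAddCommGroup_le _ (norm_nonneg _) _

theorem probeFun_apply (ε : ℝ) (M : ℕ) (v : EuclideanSpace ℝ (Fin (M + 2))) :
    probeFun F ε M v = clamp (v 0) * clamp (2 - v 1) * F fun j => recon ε M v j := rfl

variable {F} {ε : ℝ} {M : ℕ} {y : ℕ → ℝ} {R η : ℝ}

theorem probeFun_nonneg (hF : ∀ z, 0 ≤ F z) (v : EuclideanSpace ℝ (Fin (M + 2))) :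
    0 ≤ probeFun F ε M v :=
  mul_nonneg (mul_nonneg (clamp_nonneg _) (clamp_nonneg _)) (hF _)

theorem apply_min_eq (hFR : ∀ z, R ≤ ‖z‖ → F z = 0) {b : ℝ} (hb0 : 0 ≤ b) (hb : R ≤ b)
    (z : Fin K → ℝ) : F (fun j => min (z j) b) = F z := by
  by_cases h : ∀ j, z j ≤ b
  · congr 1
    funext j
    exact min_eq_left (h j)
  · push Not at h
    obtain ⟨j, hj⟩ := h
    rw [hFR, hFR]
    · exact (hb.trans hj.le).trans ((le_abs_self _).trans (norm_le_pi_norm z j))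
    · have := norm_le_pi_norm (fun j => min (z j) b) j
      rw [min_eq_right hj.le, Real.norm_of_nonneg hb0] at this
      exact hb.trans this

/-- The properties of a test function and of the scales that make the reconstruction work. -/
structure Scales (F : BoundedContinuousFunction (Fin K → ℝ) ℝ) (ε : ℝ) (M : ℕ) (R η : ℝ) :
    Prop where
  pos : 0 < ε
  nonneg : ∀ z, 0 ≤ F z
  eq_zero : ∀ z, R ≤ ‖z‖ → F z = 0
  le : R ≤ M * ε
  cont : ∀ z z', dist z z' ≤ 2 * ε → |F z - F z'| ≤ η

theorem abs_apply_recon_sub_le (h : Scales F ε M R η) (hy : Monotone y)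
    (hyt : Tendsto y atTop atTop) {s : ℝ} (hs : |s| ≤ ε) (h0 : 4 * ε < y 0)
    {v : EuclideanSpace ℝ (Fin (M + 2))}
    (hv : ∀ i : Fin M, v i.succ.succ = ∑' n, probe (i + 2) ((y n + s) / ε)) :
    |F (fun j => recon ε M v j) - F (fun j => y j)| ≤ η := by
  have hMε : 0 ≤ M * ε := mul_nonneg (Nat.cast_nonneg _) h.pos.le
  rw [← apply_min_eq h.eq_zero hMε h.le fun j => y j]
  refine h.cont _ _ ((dist_pi_le_iff (by linarith [h.pos])).2 fun j => ?_)
  exact abs_recon_sub_le h.pos hy hyt hs h0 hv j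

theorem abs_div_le_iff (h : 0 < ε) (x b : ℝ) : |x / ε| ≤ b ↔ |x| ≤ b * ε := by
  rw [abs_div, abs_of_pos h, div_le_iff₀ h]

theorem le_abs_div_iff (h : 0 < ε) (x b : ℝ) : b ≤ |x / ε| ↔ b * ε ≤ |x| := by
  rw [abs_div, abs_of_pos h, le_div_iff₀ h]

theorem fwdSum_zero_eq_zero (h : 0 < ε) (hyt : Tendsto y atTop atTop) {s : ℝ}
    (hs : ∀ n, ε ≤ y n + s) : fwdSum (probeVec ε (M + 2)) y s 0 = 0 := by
  rw [fwdSum_probeVec h hyt]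
  refine (tsum_congr fun n => probe_zero_eq_zero ?_).trans tsum_zero
  rw [le_abs_div_iff h, one_mul]
  exact (hs n).trans (le_abs_self _)

theorem fwdSum_one_eq_zero (h : 0 < ε) (hyt : Tendsto y atTop atTop) {s : ℝ}
    (hs : ∀ n, 6 * ε ≤ y n + s) : fwdSum (probeVec ε (M + 2)) y s 1 = 0 := by
  rw [fwdSum_probeVec h hyt]
  refine (tsum_congr fun n => probe_one_eq_zero ?_).trans tsum_zero
  rw [le_abs_div_iff h]
  exact (hs n).trans (le_abs_self _)

theorem one_le_fwdSum_one (h : 0 < ε) (hyt : Tendsto y atTop atTop) {s : ℝ}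
    (hs : |y 0 + s| ≤ 5 * ε) : 1 ≤ fwdSum (probeVec ε (M + 2)) y s 1 := by
  rw [fwdSum_probeVec h hyt]
  rw [← probe_one_eq_one ((abs_div_le_iff h _ _).2 hs)]
  obtain ⟨m, hm⟩ := eventually_atTop.1 (hyt.eventually_ge_atTop (6 * ε - s))
  rw [tsum_eq_sum (s := Finset.range (m + 1))]
  · exact Finset.single_le_sum (f := fun n => probe 1 ((y n + s) / ε))
      (fun n _ => probe_nonneg _ _) (by simp)
  · intro n hn
    refine probe_one_eq_zero ((le_abs_div_iff h _ _).2 ((?_ : _ ≤ _).trans (le_abs_self _)))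
    simp at hn
    linarith [hm n (by omega)]

theorem probeVec_of_le (h : 0 < ε) {s : ℝ} (hs : s ≤ 2 * ε) (i : Fin M) :
    probeVec ε (M + 2) s i.succ.succ = 0 :=
  probe_add_two_eq_zero_of_le ((div_le_iff₀ h).2 hs)

theorem probeVec_zero_eq_zero (h : 0 < ε) {s : ℝ} (hs : ε ≤ |s|) :
    probeVec ε (M + 2) s 0 = 0 :=
  probe_zero_eq_zero ((le_abs_div_iff h _ _).2 (by linarith))

theorem probeFun_eq_zero {v : EuclideanSpace ℝ (Fin (M + 2))} (h : v 0 = 0) :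
    probeFun F ε M v = 0 := by
  rw [probeFun_apply, h, clamp_of_nonpos le_rfl, zero_mul, zero_mul]

theorem recon_congr {v w : EuclideanSpace ℝ (Fin (M + 2))}
    (h : ∀ i : Fin M, v i.succ.succ = w i.succ.succ) (j : ℕ) : recon ε M v j = recon ε M w j := by
  simp only [recon, h]

/-- The value of `probeFun` with a single point near the origin. -/
theorem probeFun_le (h : Scales F ε M R η) (hy : Monotone y) (hyt : Tendsto y atTop atTop)
    {s : ℝ} (hs : |s| ≤ ε) (h0 : 4 * ε < y 0) :
    probeFun F ε M (probeVec ε (M + 2) s + fwdSum (probeVec ε (M + 2)) y s) ≤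
      probe 0 (s / ε) * (F (fun j => y j) + η) := by
  have hs' := abs_le.1 hs
  have hF := abs_le.1 (abs_apply_recon_sub_le h hy hyt hs h0
    (v := probeVec ε (M + 2) s + fwdSum (probeVec ε (M + 2)) y s) fun i => by
      rw [PiLp.add_apply, probeVec_of_le h.pos (by linarith), zero_add, fwdSum_probeVec h.pos hyt]
      rfl)
  rw [probeFun_apply]
  rw [PiLp.add_apply, fwdSum_zero_eq_zero h.pos hyt fun n => by
    linarith [hy (Nat.zero_le n), h.pos], add_zero]
  change clamp (probe 0 (s / ε)) * _ * _ ≤ _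
  rw [clamp_of_mem (probe_nonneg _ _) (probe_le_one _ _), mul_assoc]
  refine mul_le_mul_of_nonneg_left ?_ (probe_nonneg _ _)
  refine (mul_le_of_le_one_left (h.nonneg _) (clamp_le_one _)).trans ?_
  linarith [hF.2]

theorem le_probeFun (h : Scales F ε M R η) (hy : Monotone y) (hyt : Tendsto y atTop atTop)
    {s : ℝ} (hs : |s| ≤ ε) (h0 : 7 * ε < y 0) :
    probe 0 (s / ε) * (F (fun j => y j) - η) ≤
      probeFun F ε M (probeVec ε (M + 2) s + fwdSum (probeVec ε (M + 2)) y s) := by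
  have hs' := abs_le.1 hs
  have hF := abs_le.1 (abs_apply_recon_sub_le h hy hyt hs (by linarith [h.pos])
    (v := probeVec ε (M + 2) s + fwdSum (probeVec ε (M + 2)) y s) fun i => by
      rw [PiLp.add_apply, probeVec_of_le h.pos (by linarith), zero_add, fwdSum_probeVec h.pos hyt]
      rfl)
  rw [probeFun_apply]
  rw [PiLp.add_apply, PiLp.add_apply, fwdSum_zero_eq_zero h.pos hyt fun n => by
    linarith [hy (Nat.zero_le n), h.pos], fwdSum_one_eq_zero h.pos hyt fun n => by
    linarith [hy (Nat.zero_le n), h.pos], add_zero, add_zero]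
  change _ ≤ clamp (probe 0 (s / ε)) * clamp (2 - probe 1 (s / ε)) * _
  rw [clamp_of_mem (probe_nonneg _ _) (probe_le_one _ _),
    clamp_of_one_le (by linarith [probe_le_one 1 (s / ε)]), mul_one]
  exact mul_le_mul_of_nonneg_left (by linarith [hF.1]) (probe_nonneg _ _)

theorem jump_le (h : Scales F ε M R η) (hη : 0 ≤ η) (hy : Monotone y)
    (hyt : Tendsto y atTop atTop) (hy0 : 0 ≤ y 0) (s : ℝ) :
    jump (probeFun F ε M) (probeVec ε (M + 2)) y s ≤ probe 0 (s / ε) * (F (fun j => y j) + η) := by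
  have hε := h.pos
  have hr : 0 ≤ probe 0 (s / ε) * (F (fun j => y j) + η) :=
    mul_nonneg (probe_nonneg _ _) (add_nonneg (h.nonneg _) hη)
  have hG := probeFun_nonneg (ε := ε) h.nonneg (fwdSum (probeVec ε (M + 2)) y s)
  unfold jump
  rcases lt_or_ge ε |s| with hs | hs
  · refine le_trans ?_ hr
    have hz := probeVec_zero_eq_zero (M := M) hε hs.le
    rcases lt_abs.1 hs with hs | hs
    · have h0 := fwdSum_zero_eq_zero (M := M) hε hyt (s := s) fun n => by
        linarith [hy (Nat.zero_le n)]
      rw [probeFun_eq_zero (by rw [PiLp.add_apply, hz, h0, add_zero]), probeFun_eq_zero h0,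
        sub_zero]
    · rw [sub_nonpos, probeFun_apply, probeFun_apply, PiLp.add_apply, hz, zero_add]
      have hrec : (fun j : Fin K => recon ε M (probeVec ε (M + 2) s +
          fwdSum (probeVec ε (M + 2)) y s) j) =
          fun j : Fin K => recon ε M (fwdSum (probeVec ε (M + 2)) y s) j := by
        funext j
        refine recon_congr (fun i => ?_) _
        rw [PiLp.add_apply, probeVec_of_le hε (by linarith), zero_add]
      rw [hrec]
      refine mul_le_mul_of_nonneg_right (mul_le_mul_of_nonneg_left (monotone_clamp ?_)
        (clamp_nonneg _)) (h.nonneg _)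
      have : 0 ≤ probeVec ε (M + 2) s 1 := probe_nonneg 1 (s / ε)
      rw [PiLp.add_apply]
      linarith
  · rcases le_or_gt (y 0) (4 * ε) with h0 | h0
    · refine le_trans ?_ hr
      have hs' := abs_le.1 hs
      have h1 := one_le_fwdSum_one (M := M) hε hyt (s := s) (abs_le.2 ⟨by linarith, by linarith⟩)
      have h2 : probeVec ε (M + 2) s 1 = 1 :=
        probe_one_eq_one ((abs_div_le_iff hε _ _).2 (by linarith))
      rw [probeFun_apply, PiLp.add_apply, PiLp.add_apply, h2, clamp_of_nonpos
        (r := 2 - (1 + _)) (by linarith)]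
      linarith
    · linarith [probeFun_le h hy hyt hs h0]

theorem probeVec_eq_zero_of_lt (hε : 0 < ε) {s : ℝ} (hs : s < -(6 * ε)) :
    probeVec ε (M + 2) s = 0 := by
  have hs' := neg_le_abs s
  ext i
  refine Fin.cases (probeVec_zero_eq_zero hε (by linarith)) (fun i => ?_) i
  refine Fin.cases ?_ (fun i => probeVec_of_le hε (by linarith) i) i
  exact probe_one_eq_zero ((le_abs_div_iff hε _ _).2 (by linarith))

theorem jump_probeFun_eq_zero (hε : 0 < ε) (hy : Monotone y) (hyt : Tendsto y atTop atTop)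
    (hy0 : 0 ≤ y 0) {s : ℝ} (hs : 6 * ε < |s|) :
    jump (probeFun F ε M) (probeVec ε (M + 2)) y s = 0 := by
  rcases lt_abs.1 hs with hs' | hs'
  · have hz := probeVec_zero_eq_zero (M := M) hε (s := s) (by linarith)
    have hS := fwdSum_zero_eq_zero (M := M) hε hyt (s := s) fun n => by
      linarith [hy (Nat.zero_le n)]
    rw [jump, probeFun_eq_zero (by rw [PiLp.add_apply, hz, hS, add_zero]), probeFun_eq_zero hS,
      sub_zero]
  · exact jump_eq_zero _ _ (probeVec_eq_zero_of_lt hε (by linarith))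

theorem le_jump (h : Scales F ε M R η) (hy : Monotone y) (hyt : Tendsto y atTop atTop)
    (h0 : 7 * ε < y 0) (s : ℝ) :
    probe 0 (s / ε) * (F (fun j => y j) - η) ≤ jump (probeFun F ε M) (probeVec ε (M + 2)) y s := by
  have hε := h.pos
  rcases lt_or_ge ε |s| with hs | hs
  · have hz := probeVec_zero_eq_zero (M := M) hε hs.le
    have hz' : probe 0 (s / ε) = 0 := hz
    rw [hz', zero_mul]
    rcases le_or_gt (-(6 * ε)) s with hs6 | hs6
    · have hS := fwdSum_zero_eq_zero (M := M) hε hyt (s := s) fun n => by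
        linarith [hy (Nat.zero_le n)]
      rw [jump, probeFun_eq_zero (by rw [PiLp.add_apply, hz, hS, add_zero]), probeFun_eq_zero hS,
        sub_zero]
    · rw [jump_eq_zero _ _ (probeVec_eq_zero_of_lt hε hs6)]
  · have hs' := abs_le.1 hs
    rw [jump, probeFun_eq_zero (fwdSum_zero_eq_zero (M := M) hε hyt (s := s) fun n => by
      linarith [hy (Nat.zero_le n)]), sub_zero]
    exact le_probeFun h hy hyt hs h0

theorem integrable_jump_probeFun (hε : 0 < ε) (hyt : Tendsto y atTop atTop) :
    Integrable (jump (probeFun F ε M) (probeVec ε (M + 2)) y) :=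
  integrable_of_bounded_support
    (continuous_jump _ (continuous_probeVec ε _) (fun _ => probeVec_eq_zero hε)
      hyt).aestronglyMeasurable
    (abs_jump_le _ _ _) fun _ hs => jump_eq_zero _ _ (probeVec_eq_zero hε hs)

theorem integrable_probe_zero : Integrable (probe 0) :=
  integrable_of_bounded_support (A := 1) (B := 1) (continuous_probe 0).aestronglyMeasurable
    (fun s => by rw [abs_of_nonneg (probe_nonneg _ _)]; exact probe_le_one _ _)
    fun s hs => probe_zero_eq_zero hs.le

theorem integral_probe_zero_pos : 0 < ∫ x, probe 0 x := by
  refine (continuous_probe 0).integral_pos_of_hasCompactSupport_nonneg_nonzero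
    (hasCompactSupport_of_bounded (A := 1) fun s hs => probe_zero_eq_zero hs.le)
    (probe_nonneg 0) (x := 0) ?_
  rw [probe_zero_of_le (by simp)]
  simp

/-- The total mass of the tent function at scale `ε`. -/
noncomputable def tentMass (ε : ℝ) : ℝ := ε * ∫ x, probe 0 x

theorem tentMass_pos (hε : 0 < ε) : 0 < tentMass ε := mul_pos hε integral_probe_zero_pos

theorem integral_probe_zero_div_mul (hε : 0 < ε) (r : ℝ) :
    ∫ s, probe 0 (s / ε) * r = tentMass ε * r := by
  rw [integral_mul_const, Measure.integral_comp_div, abs_of_pos hε, smul_eq_mul, tentMass]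

theorem integrable_probe_zero_div_mul (hε : 0 < ε) (r : ℝ) :
    Integrable fun s => probe 0 (s / ε) * r :=
  (integrable_probe_zero.comp_div hε.ne').mul_const r

theorem jumpInt_div_le (h : Scales F ε M R η) (hη : 0 ≤ η) (hy : Monotone y)
    (hyt : Tendsto y atTop atTop) (hy0 : 0 ≤ y 0) :
    jumpInt (probeFun F ε M) (probeVec ε (M + 2)) y / tentMass ε ≤ F (fun j => y j) + η := by
  rw [div_le_iff₀ (tentMass_pos h.pos), mul_comm, ← integral_probe_zero_div_mul h.pos]
  exact integral_mono (integrable_jump_probeFun h.pos hyt)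
    (integrable_probe_zero_div_mul h.pos _) (jump_le h hη hy hyt hy0)

theorem le_jumpInt_div (h : Scales F ε M R η) (hy : Monotone y)
    (hyt : Tendsto y atTop atTop) (h0 : 7 * ε < y 0) :
    F (fun j => y j) - η ≤ jumpInt (probeFun F ε M) (probeVec ε (M + 2)) y / tentMass ε := by
  rw [le_div_iff₀ (tentMass_pos h.pos), mul_comm, ← integral_probe_zero_div_mul h.pos]
  exact integral_mono (integrable_probe_zero_div_mul h.pos _)
    (integrable_jump_probeFun h.pos hyt) (le_jump h hy hyt h0)

theorem abs_jumpInt_div_le (hε : 0 < ε) (hy : Monotone y) (hyt : Tendsto y atTop atTop)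
    (hy0 : 0 ≤ y 0) :
    |jumpInt (probeFun F ε M) (probeVec ε (M + 2)) y / tentMass ε| ≤
      24 * ‖F‖ / ∫ x, probe 0 x := by
  have h1 := (norm_integral_le_integral_norm
    (jump (probeFun F ε M) (probeVec ε (M + 2)) y)).trans
    (integral_abs_le_of_bounded_support (A := 6 * ε) (by linarith)
      (integrable_jump_probeFun hε hyt).aestronglyMeasurable (abs_jump_le _ _ _)
      fun s hs => jump_probeFun_eq_zero hε hy hyt hy0 hs)
  have h2 := norm_probeFun_le F ε M
  rw [abs_div, abs_of_pos (tentMass_pos hε), div_le_iff₀ (tentMass_pos hε), tentMass,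
    mul_comm ε, ← mul_assoc, div_mul_cancel₀ _ integral_probe_zero_pos.ne']
  refine h1.trans ?_
  nlinarith

/-- A lower bound for `jumpInt` that is valid regardless of the first gap. -/
theorem apply_sub_le_jumpInt_div (h : Scales F ε M R η) (hη : 0 ≤ η) (hy : Monotone y)
    (hyt : Tendsto y atTop atTop) (hy0 : 0 ≤ y 0) :
    F (fun j => y j) - η -
      (‖F‖ + 24 * ‖F‖ / ∫ x, probe 0 x) * (Set.Iic (7 * ε)).indicator (fun _ => (1 : ℝ)) (y 0) ≤
      jumpInt (probeFun F ε M) (probeVec ε (M + 2)) y / tentMass ε := by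
  rcases le_or_gt (y 0) (7 * ε) with h0 | h0
  · rw [Set.indicator_of_mem (show y 0 ∈ Set.Iic (7 * ε) from h0)]
    have h1 := (abs_le.1 (abs_jumpInt_div_le (F := F) (M := M) h.pos hy hyt hy0)).1
    have h2 := (le_abs_self _).trans (F.norm_coe_le_norm fun j => y j)
    linarith
  · rw [Set.indicator_of_notMem (show y 0 ∉ Set.Iic (7 * ε) from not_le.2 h0)]
    linarith [le_jumpInt_div h hy hyt h0]

end JumpToFinite

end SpacingPalm

namespace SpacingPalm

section JumpToFiniteLimit

variable {Ω' : Type*} [MeasurableSpace Ω'] {P' : Measure Ω'} [IsProbabilityMeasure P']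
  {x : Ω' → ℕ → ℝ} {y : ℕ → ℕ → ℝ} {K : ℕ}

theorem avg_const_le {C : ℝ} (hC : 0 ≤ C) (N : ℕ) : avg (fun _ => C) N ≤ C := by
  rw [avg, Finset.sum_const, Finset.card_range, nsmul_eq_mul, ← mul_assoc]
  refine mul_le_of_le_one_left hC ?_
  rcases eq_or_ne (N : ℝ) 0 with h | h
  · simp [h]
  · rw [inv_mul_cancel₀ h]

theorem integrable_apply (hxm : ∀ i, Measurable fun ω => x ω i)
    (F : BoundedContinuousFunction (Fin K → ℝ) ℝ) :
    Integrable (fun ω => F fun i => x ω i) P' :=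
  (integrable_const ‖F‖).mono'
    (F.continuous.measurable.comp (measurable_pi_lambda _ fun i => hxm i)).aestronglyMeasurable
    (Eventually.of_forall fun _ => F.norm_coe_le_norm _)

theorem tendsto_integral_indicator_first (hx : ∀ᵐ ω ∂P', 0 < x ω 0)
    (hxm : ∀ i, Measurable fun ω => x ω i) {e : ℕ → ℝ} (he : Tendsto e atTop (𝓝 0)) :
    Tendsto (fun k => ∫ ω, (Set.Iic (e k)).indicator (fun _ => (1 : ℝ)) (x ω 0) ∂P') atTop
      (𝓝 0) := by
  have := tendsto_integral_of_dominated_convergence (μ := P')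
    (F := fun k ω => (Set.Iic (e k)).indicator (fun _ => (1 : ℝ)) (x ω 0))
    (f := fun _ => (0 : ℝ)) (fun _ => 1)
    (fun k => ((measurable_const.indicator measurableSet_Iic).comp (hxm 0)).aestronglyMeasurable)
    (integrable_const 1)
    (fun k => Eventually.of_forall fun _ => by
      refine (norm_indicator_le_norm_self _ _).trans ?_
      simp)
    (by
      filter_upwards [hx] with ω hω
      refine tendsto_const_nhds.congr' ?_
      filter_upwards [he.eventually (gt_mem_nhds hω)] with k hk
      exact (Set.indicator_of_notMem (show x ω 0 ∉ Set.Iic (e k) from not_le.2 hk) _).symm)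
  simpa using this

theorem eventually_le_avg_of_compact
    (hx : ∀ᵐ ω ∂P', (Monotone (x ω) ∧ Tendsto (x ω) atTop atTop) ∧ 0 < x ω 0)
    (hxm : ∀ i, Measurable fun ω => x ω i)
    (hy : ∀ n, (Monotone (y n) ∧ Tendsto (y n) atTop atTop) ∧ 0 ≤ y n 0)
    (hJ : ∀ (m : ℕ) (G : BoundedContinuousFunction (EuclideanSpace ℝ (Fin m)) ℝ)
      (f : ℝ → EuclideanSpace ℝ (Fin m)) (A : ℝ), 0 ≤ A → Continuous f →
      (∀ x, A < |x| → f x = 0) →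
      AEStronglyMeasurable (fun ω => jumpInt G f (x ω)) P' ∧
      Tendsto (avg fun n => jumpInt G f (y n)) atTop (𝓝 (∫ ω, jumpInt G f (x ω) ∂P')))
    {F : BoundedContinuousFunction (Fin K → ℝ) ℝ} (hF : ∀ z, 0 ≤ F z) {R : ℝ}
    (hR : ∀ z, R ≤ ‖z‖ → F z = 0) {δ : ℝ} (hδ : 0 < δ) :
    ∀ᶠ N in atTop, ∫ ω, F (fun i => x ω i) ∂P' - δ ≤ avg (fun n => F fun i => y n i) N := by
  set C : ℝ := ‖F‖ + 24 * ‖F‖ / ∫ x, probe 0 x with hC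
  have huc : UniformContinuous F := F.continuous.uniformContinuous_of_tendsto_cocompact (x := 0) (by
    refine tendsto_const_nhds.congr' ?_
    filter_upwards [(tendsto_norm_cocompact_atTop (E := Fin K → ℝ)).eventually_ge_atTop R]
      with z hz
    exact (hR z hz).symm)
  obtain ⟨r, hr, hFr⟩ := Metric.uniformContinuous_iff.1 huc (δ / 4) (by positivity)
  have he0 : Tendsto (fun k : ℕ => 1 / ((k : ℝ) + 1)) atTop (𝓝 0) :=
    tendsto_one_div_add_atTop_nhds_zero_nat
  have hp := (tendsto_integral_indicator_first (P' := P') (hx.mono fun _ h => h.2) hxm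
    (e := fun k : ℕ => 7 * (1 / ((k : ℝ) + 1))) (by simpa using he0.const_mul 7)).const_mul C
  rw [mul_zero] at hp
  obtain ⟨k, hk1, hk2⟩ := ((hp.eventually (gt_mem_nhds (show 0 < δ / 4 by positivity))).and
    ((he0.const_mul 2).eventually (gt_mem_nhds (show 2 * 0 < r by simpa using hr)))).exists
  set ε : ℝ := 1 / ((k : ℝ) + 1) with hεdef
  have hε : 0 < ε := by positivity
  obtain ⟨M, hM⟩ := exists_nat_ge (R / ε)
  have hS : Scales F ε M R (δ / 4) := ⟨hε, hF, hR, (div_le_iff₀ hε).1 hM, fun z z' h =>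
    (hFr (h.trans_lt hk2)).le⟩
  set G := probeFun F ε M
  set f := probeVec ε (M + 2)
  obtain ⟨hm, ht⟩ := hJ (M + 2) G f (((M + 2 : ℕ) + 6) * ε) (by positivity)
    (continuous_probeVec ε _) fun _ => probeVec_eq_zero hε
  have hlow : ∫ ω, F (fun i => x ω i) ∂P' - δ / 4 -
      C * ∫ ω, (Set.Iic (7 * ε)).indicator (fun _ => (1 : ℝ)) (x ω 0) ∂P' ≤
      (∫ ω, jumpInt G f (x ω) ∂P') / tentMass ε := by
    have hind : Integrable (fun ω => (Set.Iic (7 * ε)).indicator (fun _ => (1 : ℝ)) (x ω 0)) P' :=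
      (integrable_const (1 : ℝ)).mono'
        ((measurable_const.indicator measurableSet_Iic).comp (hxm 0)).aestronglyMeasurable
        (Eventually.of_forall fun ω => by
          refine (norm_indicator_le_norm_self _ _).trans ?_
          simp)
    have hFi := integrable_apply (P' := P') hxm F
    have hδi := integrable_const (μ := P') (δ / 4)
    have hDi : Integrable (fun ω => jumpInt G f (x ω) / tentMass ε) P' :=
      (integrable_const (24 * ‖F‖ / ∫ x, probe 0 x)).mono' (hm.mul_const (tentMass ε)⁻¹) (by
        filter_upwards [hx] with ω hω
        exact abs_jumpInt_div_le hε hω.1.1 hω.1.2 hω.2.le)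
    rw [← integral_div, ← integral_const_mul]
    calc _ = ∫ ω, (F (fun i => x ω i) - δ / 4 -
          C * (Set.Iic (7 * ε)).indicator (fun _ => (1 : ℝ)) (x ω 0)) ∂P' := by
          rw [integral_sub (f := fun ω => F (fun i => x ω i) - δ / 4) (hFi.sub hδi)
            (hind.const_mul C), integral_sub hFi hδi, integral_const, probReal_univ, one_smul]
      _ ≤ _ := by
          refine integral_mono_ae ((hFi.sub hδi).sub (hind.const_mul C)) hDi ?_
          filter_upwards [hx] with ω hω
          exact apply_sub_le_jumpInt_div hS (by positivity) hω.1.1 hω.1.2 hω.2.le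
  have ht' := ht.div_const (tentMass ε)
  filter_upwards [ht'.eventually (lt_mem_nhds (show
    (∫ ω, jumpInt G f (x ω) ∂P') / tentMass ε - δ / 4 < _ by linarith))] with N hN
  have hup : avg (fun n => jumpInt G f (y n)) N / tentMass ε ≤
      avg (fun n => F fun i => y n i) N + δ / 4 := by
    rw [div_eq_mul_inv, mul_comm, ← avg_const_mul]
    refine (avg_mono (b := fun n => F (fun i => y n i) + δ / 4) (fun n => ?_) N).trans ?_
    · rw [mul_comm, ← div_eq_mul_inv]
      exact jumpInt_div_le hS (by positivity) (hy n).1.1 (hy n).1.2 (hy n).2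
    · rw [avg_add]
      linarith [avg_const_le (show 0 ≤ δ / 4 by positivity) N]
  linarith

/-- A bounded continuous function multiplied by a cutoff. -/
noncomputable def cut (F : BoundedContinuousFunction (Fin K → ℝ) ℝ) (L : ℝ) :
    BoundedContinuousFunction (Fin K → ℝ) ℝ :=
  F * (cutoff L).compContinuous ⟨fun z => ‖z‖, continuous_norm⟩

theorem cut_apply (F : BoundedContinuousFunction (Fin K → ℝ) ℝ) (L : ℝ) (z : Fin K → ℝ) :
    cut F L z = F z * cutoff L ‖z‖ := rfl

theorem eventually_le_avg_of_nonneg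
    (hx : ∀ᵐ ω ∂P', (Monotone (x ω) ∧ Tendsto (x ω) atTop atTop) ∧ 0 < x ω 0)
    (hxm : ∀ i, Measurable fun ω => x ω i)
    (hy : ∀ n, (Monotone (y n) ∧ Tendsto (y n) atTop atTop) ∧ 0 ≤ y n 0)
    (hJ : ∀ (m : ℕ) (G : BoundedContinuousFunction (EuclideanSpace ℝ (Fin m)) ℝ)
      (f : ℝ → EuclideanSpace ℝ (Fin m)) (A : ℝ), 0 ≤ A → Continuous f →
      (∀ x, A < |x| → f x = 0) →
      AEStronglyMeasurable (fun ω => jumpInt G f (x ω)) P' ∧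
      Tendsto (avg fun n => jumpInt G f (y n)) atTop (𝓝 (∫ ω, jumpInt G f (x ω) ∂P')))
    {F : BoundedContinuousFunction (Fin K → ℝ) ℝ} (hF : ∀ z, 0 ≤ F z) {δ : ℝ} (hδ : 0 < δ) :
    ∀ᶠ N in atTop, ∫ ω, F (fun i => x ω i) ∂P' - δ ≤ avg (fun n => F fun i => y n i) N := by
  have hcut : ∀ (L : ℝ) z, cut F L z ≤ F z := fun L z =>
    mul_le_of_le_one_right (hF z) (cutoff_le_one _ _)
  have hlim : Tendsto (fun L : ℕ => ∫ ω, cut F L (fun i => x ω i) ∂P') atTop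
      (𝓝 (∫ ω, F (fun i => x ω i) ∂P')) := by
    refine tendsto_integral_of_dominated_convergence (fun _ => ‖F‖)
      (fun L => (integrable_apply hxm _).aestronglyMeasurable) (integrable_const _)
      (fun L => Eventually.of_forall fun ω => ?_) (Eventually.of_forall fun ω => ?_)
    · rw [cut_apply, Real.norm_of_nonneg (mul_nonneg (hF _) (cutoff_nonneg _ _)), ← cut_apply]
      exact (hcut _ _).trans ((le_abs_self _).trans (F.norm_coe_le_norm _))
    · refine tendsto_const_nhds.congr' ?_
      filter_upwards [tendsto_natCast_atTop_atTop.eventually_ge_atTop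
        ‖fun i : Fin K => x ω i‖] with L hL
      rw [cut_apply, cutoff_eq_one hL, mul_one]
  obtain ⟨L, hL⟩ := (hlim.eventually (lt_mem_nhds (show
    ∫ ω, F (fun i => x ω i) ∂P' - δ / 2 < _ by linarith))).exists
  filter_upwards [eventually_le_avg_of_compact hx hxm hy hJ (F := cut F L) (R := L + 1)
    (fun z => mul_nonneg (hF z) (cutoff_nonneg _ _))
    (fun z hz => by rw [cut_apply, cutoff_eq_zero hz, mul_zero]) (half_pos hδ)] with N hN
  have := avg_mono (fun n => hcut L fun i => y n i) N
  linarith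

theorem eventually_le_avg
    (hx : ∀ᵐ ω ∂P', (Monotone (x ω) ∧ Tendsto (x ω) atTop atTop) ∧ 0 < x ω 0)
    (hxm : ∀ i, Measurable fun ω => x ω i)
    (hy : ∀ n, (Monotone (y n) ∧ Tendsto (y n) atTop atTop) ∧ 0 ≤ y n 0)
    (hJ : ∀ (m : ℕ) (G : BoundedContinuousFunction (EuclideanSpace ℝ (Fin m)) ℝ)
      (f : ℝ → EuclideanSpace ℝ (Fin m)) (A : ℝ), 0 ≤ A → Continuous f →
      (∀ x, A < |x| → f x = 0) →
      AEStronglyMeasurable (fun ω => jumpInt G f (x ω)) P' ∧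
      Tendsto (avg fun n => jumpInt G f (y n)) atTop (𝓝 (∫ ω, jumpInt G f (x ω) ∂P')))
    (F : BoundedContinuousFunction (Fin K → ℝ) ℝ) {δ : ℝ} (hδ : 0 < δ) :
    ∀ᶠ N in atTop, ∫ ω, F (fun i => x ω i) ∂P' - δ ≤ avg (fun n => F fun i => y n i) N := by
  set H : BoundedContinuousFunction (Fin K → ℝ) ℝ :=
    BoundedContinuousFunction.const _ ‖F‖ + F with hH
  have hHz : ∀ z, H z = ‖F‖ + F z := fun z => rfl
  filter_upwards [eventually_le_avg_of_nonneg hx hxm hy hJ (F := H) (fun z => by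
    rw [hHz]
    linarith [(abs_le.1 (F.norm_coe_le_norm z)).1]) hδ] with N hN
  simp only [hHz] at hN
  rw [avg_add, integral_add (integrable_const _) (integrable_apply hxm F), integral_const,
    probReal_univ, one_smul] at hN
  linarith [avg_const_le (norm_nonneg F) N]

/-- Convergence of `jumpInt` for all test functions implies convergence of finitely many
coordinates. -/
theorem tendsto_avg_of_tendsto_avg_jumpInt
    (hx : ∀ᵐ ω ∂P', (Monotone (x ω) ∧ Tendsto (x ω) atTop atTop) ∧ 0 < x ω 0)
    (hxm : ∀ i, Measurable fun ω => x ω i)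
    (hy : ∀ n, (Monotone (y n) ∧ Tendsto (y n) atTop atTop) ∧ 0 ≤ y n 0)
    (hJ : ∀ (m : ℕ) (G : BoundedContinuousFunction (EuclideanSpace ℝ (Fin m)) ℝ)
      (f : ℝ → EuclideanSpace ℝ (Fin m)) (A : ℝ), 0 ≤ A → Continuous f →
      (∀ x, A < |x| → f x = 0) →
      AEStronglyMeasurable (fun ω => jumpInt G f (x ω)) P' ∧
      Tendsto (avg fun n => jumpInt G f (y n)) atTop (𝓝 (∫ ω, jumpInt G f (x ω) ∂P')))
    (F : BoundedContinuousFunction (Fin K → ℝ) ℝ) :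
    Tendsto (avg fun n => F fun i => y n i) atTop (𝓝 (∫ ω, F (fun i => x ω i) ∂P')) := by
  rw [tendsto_order]
  constructor
  · intro a ha
    filter_upwards [eventually_le_avg hx hxm hy hJ F (half_pos (sub_pos.2 ha))] with N hN
    linarith
  · intro a ha
    filter_upwards [eventually_le_avg hx hxm hy hJ (-F) (half_pos (sub_pos.2 ha))] with N hN
    have h1 : (avg (fun n => (-F) fun i => y n i) N) = -avg (fun n => F fun i => y n i) N := by
      have := avg_const_mul (-1) (fun n => F fun i => y n i) N
      simpa using this
    have h2 : ∫ ω, (-F) (fun i => x ω i) ∂P' = -∫ ω, F (fun i => x ω i) ∂P' := by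
      simp [integral_neg]
    rw [h1, h2] at hN
    linarith

end JumpToFiniteLimit

end SpacingPalm

namespace SpacingPalm

theorem inv_mul_sum_Icc_eq_avg (c : ℕ → ℝ) {K : ℕ} (F : (Fin K → ℝ) → ℝ) (N : ℕ) :
    (N : ℝ)⁻¹ * ∑ n ∈ Finset.Icc 1 N, F (fun i => c (n + i.val + 1) - c n) =
      avg (fun n => F fun i => gaps (fun k => c (k + 1)) n i) N := by
  rw [avg, ← Finset.Ico_add_one_right_eq_Icc, Finset.sum_Ico_eq_sum_range, add_tsub_cancel_right]
  congr 1
  refine Finset.sum_congr rfl fun n _ => ?_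
  congr 1
  funext i
  rw [gaps, add_comm 1 n]
  congr 2
  omega

theorem monotone_gaps {d : ℕ → ℝ} (hd : Monotone d) (n : ℕ) : Monotone (gaps d n) :=
  fun _ _ h => sub_le_sub_right (hd (by omega)) _

theorem exists_bound_of_hasCompactSupport {f : ℝ → ℝ} (h : HasCompactSupport f) :
    ∃ A, 0 ≤ A ∧ ∀ x, A < |x| → f x = 0 := by
  obtain ⟨A, hA⟩ := h.isCompact.isBounded.subset_closedBall (0 : ℝ)
  refine ⟨max A 0, le_max_right _ _, fun x hx => ?_⟩
  by_contra hne
  have := hA (subset_tsupport f hne)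
  rw [mem_closedBall_zero_iff, Real.norm_eq_abs] at this
  linarith [le_max_left A 0]

end SpacingPalm

open SpacingPalm

/-- (Thm. `spacing_to_palm`.) For a non-decreasing positive sequence with `N_c(T) ~ T` and a
stationary *simple* point process `ξ` of intensity `1` with Palm process `ξ^0`: the
processes `ξ_T = {c_n − t}` (with `t` uniform in `(0,T]`) converge in distribution to `ξ`
iff for every `K ≥ 1` the spacing vectors `(c_{n+1}−c_n, ..., c_{n+K}−c_n)` (with `n`
uniform in `{1,...,N}`) converge in distribution to `(x_1(ξ^0), ..., x_K(ξ^0))` as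
`N → ∞`. -/
theorem stmt_16 {Ω Ω' : Type*} [MeasurableSpace Ω] [MeasurableSpace Ω']
    (P : MeasureTheory.Measure Ω) (P' : MeasureTheory.Measure Ω')
    [IsProbabilityMeasure P] [IsProbabilityMeasure P']
    (ξ : Ω → MeasureTheory.Measure ℝ) (ξ0 : Ω' → MeasureTheory.Measure ℝ)
    (hξ : Measurable ξ) (hξ0 : Measurable ξ0)
    (hpp : ∀ᵐ ω ∂P, IsPointMeasure (ξ ω))
    (hsimple : ∀ᵐ ω ∂P, ∀ x : ℝ, ξ ω {x} ≤ 1)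
    (hstat : Stationary P ξ) (hint : HasIntensity P ξ 1)
    (hpalm : IsPalmOf P ξ P' ξ0 1)
    (hpp0 : ∀ᵐ ω' ∂P', IsPointMeasure (ξ0 ω') ∧ InfiniteBothDirections (ξ0 ω'))
    (c : ℕ → ℝ) (hmono : Monotone c) (hpos : ∀ n : ℕ, 1 ≤ n → 0 < c n)
    (hN : Tendsto (fun T => (Ncount c T : ℝ) / T) atTop (𝓝 1)) :
    (∀ f : ℝ → ℝ, Continuous f → HasCompactSupport f →
        ∀ g : BoundedContinuousFunction ℝ ℝ,
        Tendsto (fun T => (∫ t in (0:ℝ)..T, g (seqStat c f t)) / T) atTop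
          (𝓝 (∫ ω, g (∫ x, f x ∂(ξ ω)) ∂P))) ↔
    (∀ K : ℕ, 1 ≤ K → ∀ F : BoundedContinuousFunction (Fin K → ℝ) ℝ,
        Tendsto (fun N : ℕ => (N : ℝ)⁻¹ *
            ∑ n ∈ Finset.Icc 1 N, F (fun i => c (n + i.val + 1) - c n)) atTop
          (𝓝 (∫ ω', F (fun i => xLabel (ξ0 ω') ((i.val : ℤ) + 1)) ∂P'))) := by
  set d : ℕ → ℝ := fun k => c (k + 1) with hd
  have hdN : ∀ n T, n < Ncount c T ↔ d n ≤ T := lt_Ncount_iff hmono hpos hN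
  have hdmono : Monotone d := fun a b hab => hmono (by omega)
  have hdt : Tendsto d atTop atTop := tendsto_points_atTop hdN
  have hx : ∀ᵐ ω' ∂P', (Monotone (labels (ξ0 ω')) ∧ Tendsto (labels (ξ0 ω')) atTop atTop) ∧
      0 < labels (ξ0 ω') 0 := by
    filter_upwards [hpp0] with ω' h
    exact ⟨⟨monotone_labels h.1 h.2.2, tendsto_labels h.1 h.2.2⟩, labels_pos h.1 h.2.2 0⟩
  have hxm : ∀ i, Measurable fun ω' => labels (ξ0 ω') i := fun i =>
    (measurable_labels i).comp hξ0
  have hy : ∀ n, (Monotone (gaps d n) ∧ Tendsto (gaps d n) atTop atTop) ∧ 0 ≤ gaps d n 0 :=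
    fun n => ⟨⟨monotone_gaps hdmono n, tendsto_gaps hdt n⟩,
      sub_nonneg.2 (hdmono (by omega))⟩
  simp only [seqStat_eq_fwdSum, inv_mul_sum_Icc_eq_avg]
  constructor
  · intro hi K _ F
    refine tendsto_avg_of_tendsto_avg_jumpInt hx hxm hy (fun m G f A hA0 hf hA => ?_) F
    exact ⟨aestronglyMeasurable_jumpInt_labels G hξ0 hpp0 hf hA,
      tendsto_avg_jumpInt_of_stat hξ hpp hdN hN hi G hA0 hf hA
        (integral_comp_eq_jumpInt_labels G hξ hξ0 hpp hsimple hstat hint hpalm hpp0 hf hA)⟩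
  · intro hii f hf hfc G
    obtain ⟨A, hA0, hA⟩ := exists_bound_of_hasCompactSupport hfc
    rw [integral_comp_eq_jumpInt_labels G hξ hξ0 hpp hsimple hstat hint hpalm hpp0 hf hA]
    exact (tendsto_stat_iff hdN hN G hA0 hf hA).2
      (tendsto_avg_jumpInt (hx.mono fun _ h => h.1) hxm (fun n => (hy n).1)
        (fun K F => hii (K + 1) (by omega) F) G hA0 hf hA
        (aestronglyMeasurable_jumpInt_labels G hξ0 hpp0 hf hA))
end

section
/- Let ξ be a point process on ℝ whose correlation measures are those of the sine-kernel process: for every k ≥ 1 and every bounded Borel set B ⊂ ℝ^k, the expected number of k-tuples of distinct points of ξ lying in B equals ∫_B det_{1≤i,j≤k}(S(x_i − x_j)) dx_1···dx_k. Then for any k ≥ 1, any mutually disjoint compact intervals I_1,...,I_k, and any nonnegative integers λ_1,...,λ_k, one has P(ξ(I_1) = λ_1, ..., ξ(I_k) = λ_k) = (1/λ!) · Σ_{n ∈ ℤ_{≥0}^k} ((−1)^{|n|}/n!) · C(I, λ+n), where the series converges absolutely. Here λ! = λ_1!···λ_k!, n! = n_1!···n_k!, |n| = n_1+···+n_k,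 and for a ∈ ℤ_{≥0}^k with A = a_1+···+a_k, C(I,a) := ∫_{I_1^{a_1}×···×I_k^{a_k}} det_{1≤i,j≤A}(S(x_i − x_j)) dx_1···dx_A. -/
open MeasureTheory Filter Topology Bornology

open Classical in
/-- The `k`-point correlation sum `C_k(μ, f)`: the sum over tuples of pairwise distinct
indices `(n_1,...,n_k) ∈ ℤ^k` of `f(x_{n_1}(μ),...,x_{n_k}(μ))`. -/
noncomputable def corrSumM (μ : MeasureTheory.Measure ℝ) (k : ℕ) (f : (Fin k → ℝ) → ℝ) : ℝ :=
  ∑' m : Fin k → ℤ, if Function.Injective m then f (fun i => xLabel μ (m i)) else 0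

/-- The sine kernel `S(x) = sin(πx)/(πx)`, `S(0) = 1`. -/
noncomputable def sineK (x : ℝ) : ℝ :=
  if x = 0 then 1 else Real.sin (Real.pi * x) / (Real.pi * x)

/-- The sine-kernel determinant `det_{i,j}(S(y_i − y_j))`. -/
noncomputable def sineDet {ι : Type*} [Fintype ι] [DecidableEq ι] (y : ι → ℝ) : ℝ :=
  Matrix.det (Matrix.of fun i j => sineK (y i - y j))

/-- The quantity `C(I, a) = ∫_{I_1^{a_1} × ⋯ × I_k^{a_k}} det_{1≤i,j≤A}(S(x_i − x_j)) d^A x`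
for intervals `I_i = [aI i, bI i]`, with the `A = a_1 + ⋯ + a_k` coordinates indexed by
pairs `(i, j)` with `i : Fin k`, `j : Fin (a i)`. -/
noncomputable def sineCorrInt (k : ℕ) (aI bI : Fin k → ℝ) (a : Fin k → ℕ) : ℝ :=
  ∫ y : ((i : Fin k) × Fin (a i)) → ℝ in
    {y | ∀ p : (i : Fin k) × Fin (a i), y p ∈ Set.Icc (aI p.1) (bI p.1)}, sineDet y

section SineKernel

theorem sineK_eq_sinc (x : ℝ) : sineK x = Real.sinc (Real.pi * x) := by
  by_cases hx : x = 0
  · simp [sineK, hx]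
  · rw [sineK, if_neg hx, Real.sinc_of_ne_zero (mul_ne_zero Real.pi_ne_zero hx)]

theorem continuous_sineK : Continuous sineK := by
  have : sineK = fun x => Real.sinc (Real.pi * x) := funext sineK_eq_sinc
  rw [this]
  fun_prop

theorem sineK_eq_integral_cos (x : ℝ) :
    sineK x = ∫ t in (0 : ℝ)..1, Real.cos (Real.pi * x * t) := by
  by_cases hx : x = 0
  · simp [sineK, hx]
  · have h : Real.pi * x ≠ 0 := mul_ne_zero Real.pi_ne_zero hx
    rw [sineK, if_neg hx, intervalIntegral.integral_comp_mul_left (fun t => Real.cos t) h]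
    simp [div_eq_inv_mul]

variable {ι : Type*} [Fintype ι]

theorem posSemidef_sineK (y : ι → ℝ) :
    (Matrix.of fun i j => sineK (y i - y j)).PosSemidef := by
  rw [Matrix.posSemidef_iff_dotProduct_mulVec]
  refine ⟨?_, fun v => ?_⟩
  · ext i j
    simp only [Matrix.conjTranspose_apply, Matrix.of_apply, star_trivial, sineK_eq_sinc]
    rw [← Real.sinc_neg]
    congr 1
    ring
  · have hsq : star v ⬝ᵥ ((Matrix.of fun i j => sineK (y i - y j)).mulVec v) =
        ∫ t in (0 : ℝ)..1, ((∑ i, v i * Real.cos (Real.pi * y i * t)) ^ 2 +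
          (∑ i, v i * Real.sin (Real.pi * y i * t)) ^ 2) := by
      simp only [dotProduct, Matrix.mulVec, Matrix.of_apply, star_trivial,
        sineK_eq_integral_cos, Pi.star_apply, Finset.mul_sum]
      simp_rw [← intervalIntegral.integral_mul_const, ← intervalIntegral.integral_const_mul]
      have hI : ∀ i j, IntervalIntegrable (fun t : ℝ =>
          v i * (Real.cos (Real.pi * (y i - y j) * t) * v j)) volume 0 1 := fun i j =>
        Continuous.intervalIntegrable (by fun_prop) _ _
      simp_rw [← intervalIntegral.integral_finsetSum fun j _ => hI _ j]
      rw [← intervalIntegral.integral_finsetSum fun i _ =>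
        Continuous.intervalIntegrable (by fun_prop) _ _]
      congr 1
      ext t
      simp only [sq, Finset.sum_mul_sum, ← Finset.sum_add_distrib]
      refine Finset.sum_congr rfl fun i _ => Finset.sum_congr rfl fun j _ => ?_
      rw [mul_sub, sub_mul, Real.cos_sub]
      ring
    rw [hsq]
    exact intervalIntegral.integral_nonneg zero_le_one fun t _ => by positivity

variable [DecidableEq ι]

theorem sineDet_nonneg (y : ι → ℝ) : 0 ≤ sineDet y := (posSemidef_sineK y).det_nonneg

theorem sineDet_le_one (y : ι → ℝ) : sineDet y ≤ 1 := by
  have h := posSemidef_sineK y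
  have htr : ∑ i, h.isHermitian.eigenvalues i = Fintype.card ι := by
    have := h.isHermitian.trace_eq_sum_eigenvalues
    simpa [Matrix.trace, sineK] using this.symm
  rw [sineDet, h.isHermitian.det_eq_prod_eigenvalues]
  calc ∏ i, h.isHermitian.eigenvalues i
      ≤ ∏ i, Real.exp (h.isHermitian.eigenvalues i - 1) :=
        Finset.prod_le_prod (fun i _ => h.eigenvalues_nonneg i) fun i _ => by
          simpa using Real.add_one_le_exp (h.isHermitian.eigenvalues i - 1)
    _ = 1 := by rw [← Real.exp_sum]; simp [htr]

theorem continuous_sineDet : Continuous (sineDet : (ι → ℝ) → ℝ) :=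
  Continuous.matrix_det <| continuous_matrix fun i j =>
    continuous_sineK.comp ((continuous_apply i).sub (continuous_apply j))

theorem sineDet_comp_equiv {κ : Type*} [Fintype κ] [DecidableEq κ] (e : κ ≃ ι) (y : ι → ℝ) :
    sineDet (fun i => y (e i)) = sineDet y :=
  Matrix.det_submatrix_equiv_self e (Matrix.of fun i j => sineK (y i - y j))

theorem sineDet_eq_one_of_intCast {z : ι → ℤ} (hz : Function.Injective z) :
    sineDet (fun i => (z i : ℝ)) = 1 := by
  have : (Matrix.of fun i j => sineK ((z i : ℝ) - z j)) = 1 := by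
    ext i j
    by_cases hij : i = j
    · subst hij
      simp [sineK]
    · have h0 : (z i : ℝ) - z j ≠ 0 := sub_ne_zero.2 (by exact_mod_cast hz.ne hij)
      have hs : Real.sin (Real.pi * ((z i : ℝ) - z j)) = 0 := by
        rw [mul_comm]
        exact_mod_cast Real.sin_int_mul_pi (z i - z j)
      simp [Matrix.one_apply_ne hij, sineK, h0, hs]
  rw [sineDet, this, Matrix.det_one]

theorem integrableOn_sineDet {s : Set (ι → ℝ)} (hs : Bornology.IsBounded s) :
    IntegrableOn sineDet s := by
  obtain ⟨r, hr⟩ := hs.subset_closedBall 0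
  exact (continuous_sineDet.continuousOn.integrableOn_compact
    (isCompact_closedBall (0 : ι → ℝ) r)).mono_set hr

/-- The integers `0, …, m - 1` form a configuration at which `sineDet` is `1`. -/
theorem setIntegral_sineDet_ball_pos (m : ℕ) {r : ℝ} (hr : (m : ℝ) < r) :
    0 < ∫ x in Metric.ball (0 : Fin m → ℝ) r, sineDet x := by
  rw [setIntegral_pos_iff_support_of_nonneg_ae (ae_of_all _ sineDet_nonneg)
    (integrableOn_sineDet Metric.isBounded_ball)]
  refine (IsOpen.inter (isOpen_ne_fun continuous_sineDet continuous_const)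
    Metric.isOpen_ball).measure_pos _ ⟨fun i => (((i : ℕ) : ℤ) : ℝ), ?_, ?_⟩
  · rw [Set.mem_ofPred_eq, sineDet_eq_one_of_intCast (z := fun i : Fin m => ((i : ℕ) : ℤ))]
    · exact one_ne_zero
    · exact fun i j h => Fin.ext (by simpa using h)
  · rw [mem_ball_zero_iff, pi_norm_lt_iff ((Nat.cast_nonneg m).trans_lt hr)]
    intro i
    have : ((i : ℕ) : ℝ) < m := by exact_mod_cast i.2
    simpa using this.trans hr

end SineKernel

section Labels

variable {μ : Measure ℝ}

theorem IsPointMeasure.lt_top_s17 (h : IsPointMeasure μ) {B : Set ℝ} (hB : IsBounded B) :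
    μ B < ⊤ := by
  obtain ⟨r, hr⟩ := hB.subset_closedBall 0
  obtain ⟨m, hm⟩ := h _ measurableSet_closedBall (Metric.isBounded_closedBall (x := (0 : ℝ)) (r := r))
  exact (measure_mono hr).trans_lt (by rw [hm]; exact ENNReal.natCast_lt_top m)

theorem xLabel_le_iff (h : IsPointMeasure μ) (hinf : InfiniteBothDirections μ) {n : ℤ}
    (hn : 0 < n) (x : ℝ) : xLabel μ n ≤ x ↔ (n.toNat : ENNReal) ≤ μ (Set.Ioc 0 x) := by
  set S := {x : ℝ | 0 < x ∧ (n.toNat : ENNReal) ≤ μ (Set.Ioc 0 x)} with hS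
  have hx : xLabel μ n = sInf S := if_pos hn
  have hn0 : (n.toNat : ENNReal) ≠ 0 := by
    simp only [ne_eq, Nat.cast_eq_zero]
    lia
  have hbdd : BddBelow S := ⟨0, fun y hy => hy.1.le⟩
  have hmem : ∀ y, (n.toNat : ENNReal) ≤ μ (Set.Ioc 0 y) → y ∈ S := fun y hy => by
    refine ⟨?_, hy⟩
    by_contra hy0
    rw [Set.Ioc_eq_empty hy0, measure_empty] at hy
    exact hn0 (le_antisymm hy zero_le)
  have hne : S.Nonempty := by
    have ht : Tendsto (fun j : ℕ => μ (Set.Ioc 0 (j : ℝ))) atTop (𝓝 (μ (⋃ j : ℕ, Set.Ioc 0 (j : ℝ)))) :=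
      tendsto_measure_iUnion_atTop fun i j hij => Set.Ioc_subset_Ioc_right (by exact_mod_cast hij)
    have hU : (⋃ j : ℕ, Set.Ioc 0 (j : ℝ)) = Set.Ioi 0 := by
      ext y
      simp only [Set.mem_iUnion, Set.mem_Ioc, Set.mem_Ioi, exists_and_left, and_iff_left_iff_imp]
      exact fun _ => exists_nat_ge y
    rw [hU, hinf.2] at ht
    obtain ⟨j, hj⟩ := (ht.eventually (lt_mem_nhds (ENNReal.natCast_lt_top n.toNat))).exists
    exact ⟨j, hmem _ hj.le⟩
  have hinfmem : (n.toNat : ENNReal) ≤ μ (Set.Ioc 0 (sInf S)) := by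
    have ht : Tendsto (fun j : ℕ => μ (Set.Ioc 0 (sInf S + 1 / ((j : ℝ) + 1)))) atTop
        (𝓝 (μ (⋂ j : ℕ, Set.Ioc 0 (sInf S + 1 / ((j : ℝ) + 1))))) := by
      refine tendsto_measure_iInter_atTop (fun _ => measurableSet_Ioc.nullMeasurableSet) ?_
        ⟨0, (h.lt_top_s17 (Metric.isBounded_Ioc _ _)).ne⟩
      exact fun i j hij => Set.Ioc_subset_Ioc_right
        (add_le_add_right (Nat.one_div_le_one_div hij) _)
    have hI : (⋂ j : ℕ, Set.Ioc 0 (sInf S + 1 / ((j : ℝ) + 1))) = Set.Ioc 0 (sInf S) := by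
      ext y
      simp only [Set.mem_iInter, Set.mem_Ioc]
      refine ⟨fun hy => ⟨(hy 0).1, le_of_forall_pos_le_add fun ε hε => ?_⟩,
        fun hy j => ⟨hy.1, hy.2.trans (le_add_of_nonneg_right (by positivity))⟩⟩
      obtain ⟨j, hj⟩ := exists_nat_one_div_lt hε
      exact (hy j).2.trans (by gcongr)
    rw [hI] at ht
    refine ge_of_tendsto' ht fun j => ?_
    obtain ⟨y, hy, hlt⟩ := exists_lt_of_csInf_lt hne
      (lt_add_of_pos_right (sInf S) (Nat.one_div_pos_of_nat (α := ℝ) (n := j)))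
    exact hy.2.trans (measure_mono (Set.Ioc_subset_Ioc_right hlt.le))
  rw [hx]
  exact ⟨fun hle => hinfmem.trans (measure_mono (Set.Ioc_subset_Ioc_right hle)),
    fun hle => csInf_le hbdd (hmem x hle)⟩

theorem xLabel_pos_iff (h : IsPointMeasure μ) (hinf : InfiniteBothDirections μ) (n : ℤ) :
    0 < xLabel μ n ↔ 0 < n := by
  by_cases hn : 0 < n
  · simp only [hn, iff_true]
    rw [← not_le, xLabel_le_iff h hinf hn]
    simp only [lt_self_iff_false, not_false_eq_true, Set.Ioc_eq_empty, measure_empty,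
      nonpos_iff_eq_zero, Nat.cast_eq_zero]
    lia
  · simp only [hn, iff_false, not_lt, xLabel, if_false]
    exact Real.sSup_nonpos fun x hx => hx.1

theorem lt_xLabel_iff (h : IsPointMeasure μ) (hinf : InfiniteBothDirections μ) {n : ℤ}
    (hn : n ≤ 0) (x : ℝ) : x < xLabel μ n ↔ ((1 - n).toNat : ENNReal) ≤ μ (Set.Ioc x 0) := by
  set S := {x : ℝ | x ≤ 0 ∧ ((1 - n).toNat : ENNReal) ≤ μ (Set.Ioc x 0)} with hS
  have hx : xLabel μ n = sSup S := if_neg hn.not_gt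
  have hbdd : BddAbove S := ⟨0, fun y hy => hy.1⟩
  obtain ⟨m, hm⟩ : ∃ m : ℕ, (1 - n).toNat = m + 1 := ⟨(-n).toNat, by lia⟩
  have hm' : ((m : ℕ) : ENNReal) < ((1 - n).toNat : ENNReal) := by
    exact_mod_cast (by lia : m < (1 - n).toNat)
  have hmem : ∀ y, ((m : ℕ) : ENNReal) < μ (Set.Ioc y 0) → y ∈ S := fun y hy => by
    have hy0 : y < 0 := by
      by_contra hy0
      rw [Set.Ioc_eq_empty hy0, measure_empty] at hy
      exact not_lt_zero hy
    refine ⟨hy0.le, ?_⟩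
    obtain ⟨q, hq⟩ := h _ measurableSet_Ioc (Metric.isBounded_Ioc y 0)
    rw [hq] at hy ⊢
    rw [hm]
    exact_mod_cast hy
  have hne : S.Nonempty := by
    have ht : Tendsto (fun j : ℕ => μ (Set.Ioc (-(j : ℝ)) 0)) atTop
        (𝓝 (μ (⋃ j : ℕ, Set.Ioc (-(j : ℝ)) 0))) :=
      tendsto_measure_iUnion_atTop fun i j hij =>
        Set.Ioc_subset_Ioc_left (neg_le_neg (by exact_mod_cast hij))
    have hU : Set.Iio 0 ⊆ (⋃ j : ℕ, Set.Ioc (-(j : ℝ)) 0) := fun y hy => by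
      obtain ⟨j, hj⟩ := exists_nat_gt (-y)
      exact Set.mem_iUnion.2 ⟨j, by linarith, (Set.mem_Iio.1 hy).le⟩
    have htop : μ (⋃ j : ℕ, Set.Ioc (-(j : ℝ)) 0) = ⊤ :=
      top_le_iff.1 (hinf.1 ▸ measure_mono hU)
    rw [htop] at ht
    obtain ⟨j, hj⟩ := (ht.eventually (lt_mem_nhds (ENNReal.natCast_lt_top m))).exists
    exact ⟨_, hmem _ hj⟩
  rw [hx]
  refine ⟨fun hlt => ?_, fun hle => ?_⟩
  · obtain ⟨y, hy, hxy⟩ := exists_lt_of_lt_csSup hne hlt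
    exact hy.2.trans (measure_mono (Set.Ioc_subset_Ioc_left hxy.le))
  · have ht : Tendsto (fun j : ℕ => μ (Set.Ioc (x + 1 / ((j : ℝ) + 1)) 0)) atTop
        (𝓝 (μ (⋃ j : ℕ, Set.Ioc (x + 1 / ((j : ℝ) + 1)) 0))) :=
      tendsto_measure_iUnion_atTop fun i j hij => Set.Ioc_subset_Ioc_left
        (add_le_add_right (Nat.one_div_le_one_div hij) _)
    have hU : (⋃ j : ℕ, Set.Ioc (x + 1 / ((j : ℝ) + 1)) 0) = Set.Ioc x 0 := by
      ext y
      simp only [Set.mem_iUnion, Set.mem_Ioc]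
      refine ⟨fun ⟨j, hj⟩ => ⟨(lt_add_of_pos_right x Nat.one_div_pos_of_nat).trans hj.1, hj.2⟩,
        fun hy => ?_⟩
      obtain ⟨j, hj⟩ := exists_nat_one_div_lt (sub_pos.2 hy.1)
      exact ⟨j, by linarith, hy.2⟩
    rw [hU] at ht
    obtain ⟨j, hj⟩ := (ht.eventually (lt_mem_nhds (hm'.trans_le hle))).exists
    exact (lt_add_of_pos_right x Nat.one_div_pos_of_nat).trans_le (le_csSup hbdd (hmem _ hj))

theorem count_map_xLabel (h : IsPointMeasure μ) (hinf : InfiniteBothDirections μ) :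
    (Measure.count : Measure ℤ).map (xLabel μ) = μ := by
  have hmeas : Measurable (xLabel μ) := measurable_from_top
  have hpos : ∀ x, (Measure.count : Measure ℤ).map (xLabel μ) (Set.Ioc 0 x) = μ (Set.Ioc 0 x) := by
    intro x
    obtain ⟨m, hm⟩ := h _ measurableSet_Ioc (Metric.isBounded_Ioc 0 x)
    have hset : xLabel μ ⁻¹' Set.Ioc 0 x = ((Finset.Icc (1 : ℤ) m : Finset ℤ) : Set ℤ) := by
      ext n
      simp only [Set.mem_preimage, Set.mem_Ioc, xLabel_pos_iff h hinf, Finset.coe_Icc,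
        Set.mem_Icc]
      refine and_congr_right fun hn => ?_
      rw [xLabel_le_iff h hinf hn, hm, Nat.cast_le]
      lia
    rw [Measure.map_apply hmeas measurableSet_Ioc, hset, Measure.count_apply_finset, hm]
    simp
  have hneg : ∀ x, (Measure.count : Measure ℤ).map (xLabel μ) (Set.Ioc x 0) = μ (Set.Ioc x 0) := by
    intro x
    obtain ⟨m, hm⟩ := h _ measurableSet_Ioc (Metric.isBounded_Ioc x 0)
    have hset : xLabel μ ⁻¹' Set.Ioc x 0 = ((Finset.Icc (1 - m : ℤ) 0 : Finset ℤ) : Set ℤ) := by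
      ext n
      simp only [Set.mem_preimage, Set.mem_Ioc, ← not_lt, xLabel_pos_iff h hinf, Finset.coe_Icc,
        Set.mem_Icc]
      refine and_congr_left fun hn => ?_
      rw [lt_xLabel_iff h hinf (not_lt.1 hn), hm, Nat.cast_le]
      lia
    rw [Measure.map_apply hmeas measurableSet_Ioc, hset, Measure.count_apply_finset, hm]
    simp
  symm
  have : IsLocallyFiniteMeasure μ := ⟨fun x => ⟨_, Metric.closedBall_mem_nhds x one_pos,
    h.lt_top_s17 Metric.isBounded_closedBall⟩⟩
  refine Measure.ext_of_Ioc _ _ fun a b hab => ?_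
  rcases le_or_gt 0 a with ha | ha
  · have hd : Set.Ioc a b = Set.Ioc 0 b \ Set.Ioc 0 a := by
      ext y; simp only [Set.mem_Ioc, Set.mem_sdiff]; grind
    have hs : Set.Ioc 0 a ⊆ Set.Ioc 0 b := Set.Ioc_subset_Ioc_right hab.le
    have hf : μ (Set.Ioc 0 a) ≠ ⊤ := (h.lt_top_s17 (Metric.isBounded_Ioc _ _)).ne
    rw [hd, measure_sdiff hs measurableSet_Ioc.nullMeasurableSet hf,
      measure_sdiff hs measurableSet_Ioc.nullMeasurableSet (by rwa [hpos]), hpos, hpos]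
  rcases le_or_gt b 0 with hb | hb
  · have hd : Set.Ioc a b = Set.Ioc a 0 \ Set.Ioc b 0 := by
      ext y; simp only [Set.mem_Ioc, Set.mem_sdiff]; grind
    have hs : Set.Ioc b 0 ⊆ Set.Ioc a 0 := Set.Ioc_subset_Ioc_left hab.le
    have hf : μ (Set.Ioc b 0) ≠ ⊤ := (h.lt_top_s17 (Metric.isBounded_Ioc _ _)).ne
    rw [hd, measure_sdiff hs measurableSet_Ioc.nullMeasurableSet hf,
      measure_sdiff hs measurableSet_Ioc.nullMeasurableSet (by rwa [hneg]), hneg, hneg]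
  · have hd : Disjoint (Set.Ioc a 0) (Set.Ioc 0 b) := Set.Ioc_disjoint_Ioc_of_le le_rfl
    rw [← Set.Ioc_union_Ioc_eq_Ioc ha.le hb.le, measure_union hd measurableSet_Ioc,
      measure_union hd measurableSet_Ioc, hpos, hneg]

theorem encard_preimage_xLabel (h : IsPointMeasure μ) (hinf : InfiniteBothDirections μ)
    {B : Set ℝ} (hB : MeasurableSet B) : ((xLabel μ ⁻¹' B).encard : ENNReal) = μ B := by
  conv_rhs => rw [← count_map_xLabel h hinf]
  rw [Measure.map_apply measurable_from_top hB, Measure.count_apply (.of_discrete)]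

end Labels

section CorrelationSum

variable {μ : Measure ℝ}

theorem finite_preimage_xLabel (h : IsPointMeasure μ) (hinf : InfiniteBothDirections μ)
    {B : Set ℝ} (hB : IsBounded B) : (xLabel μ ⁻¹' B).Finite := by
  obtain ⟨r, hr⟩ := hB.subset_closedBall 0
  refine Set.Finite.subset ?_ (Set.preimage_mono hr)
  rw [← Set.encard_lt_top_iff, ← ENat.toENNReal_lt_top,
    encard_preimage_xLabel h hinf measurableSet_closedBall]
  exact h.lt_top_s17 Metric.isBounded_closedBall

theorem ncard_preimage_xLabel (h : IsPointMeasure μ) (hinf : InfiniteBothDirections μ)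
    {B : Set ℝ} (hB : MeasurableSet B) (hbdd : IsBounded B) :
    ((xLabel μ ⁻¹' B).ncard : ENNReal) = μ B := by
  rw [← encard_preimage_xLabel h hinf hB, ← (finite_preimage_xLabel h hinf hbdd).cast_ncard_eq]
  simp

/-- The tuples of distinct labels whose points form an element of `B`. -/
def labelTuples (μ : Measure ℝ) {m : ℕ} (B : Set (Fin m → ℝ)) : Set (Fin m → ℤ) :=
  {n | Function.Injective n ∧ (fun i => xLabel μ (n i)) ∈ B}

theorem finite_labelTuples (h : IsPointMeasure μ) (hinf : InfiniteBothDirections μ) {m : ℕ}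
    {B : Set (Fin m → ℝ)} (hB : IsBounded B) : (labelTuples μ B).Finite := by
  obtain ⟨r, hr⟩ := hB.subset_closedBall 0
  refine (Set.Finite.pi' fun _ : Fin m => finite_preimage_xLabel h hinf
    (Metric.isBounded_closedBall (x := (0 : ℝ)) (r := r))).subset fun n hn i => ?_
  have := hr hn.2
  rw [mem_closedBall_zero_iff] at this
  rw [Set.mem_preimage, mem_closedBall_zero_iff]
  exact (norm_le_pi_norm (fun i => xLabel μ (n i)) i).trans this

theorem corrSumM_indicator (h : IsPointMeasure μ) (hinf : InfiniteBothDirections μ) {m : ℕ}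
    {B : Set (Fin m → ℝ)} (hB : IsBounded B) :
    corrSumM μ m (B.indicator fun _ => (1 : ℝ)) = (labelTuples μ B).ncard := by
  classical
  have hfin := finite_labelTuples h hinf hB
  have heq : ∀ n : Fin m → ℤ, (if Function.Injective n then
      B.indicator (fun _ => (1 : ℝ)) (fun i => xLabel μ (n i)) else 0) =
      if n ∈ labelTuples μ B then 1 else 0 := fun n => by
    by_cases hn : Function.Injective n <;>
      simp [labelTuples, Set.indicator_apply, hn]
  rw [corrSumM, Set.ncard_eq_toFinset_card _ hfin,
    tsum_eq_sum (s := hfin.toFinset) fun n hn => ?_]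
  · rw [Finset.sum_congr rfl fun n hn => (heq n).trans (if_pos (hfin.mem_toFinset.1 hn))]
    simp
  · exact (heq n).trans (if_neg fun h' => hn (hfin.mem_toFinset.2 h'))

theorem corrSumM_indicator_mono (h : IsPointMeasure μ) (hinf : InfiniteBothDirections μ) {m : ℕ}
    {B B' : Set (Fin m → ℝ)} (hBB' : B ⊆ B') (hB' : IsBounded B') :
    corrSumM μ m (B.indicator fun _ => (1 : ℝ)) ≤ corrSumM μ m (B'.indicator fun _ => (1 : ℝ)) := by
  rw [corrSumM_indicator h hinf hB', corrSumM_indicator h hinf (hB'.subset hBB'), Nat.cast_le]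
  exact Set.ncard_le_ncard (fun n hn => ⟨hn.1, hBB' hn.2⟩) (finite_labelTuples h hinf hB')

/-- Injective tuples distributed among disjoint sets are families of embeddings. -/
def injectiveTuplesEquiv {k m : ℕ} {a : Fin k → ℕ} (e : ((i : Fin k) × Fin (a i)) ≃ Fin m)
    {S : Fin k → Set ℤ} (hS : ∀ i j, i ≠ j → Disjoint (S i) (S j)) :
    {n : Fin m → ℤ // Function.Injective n ∧ ∀ p, n (e p) ∈ S p.1} ≃
      ((i : Fin k) → (Fin (a i) ↪ S i)) where
  toFun n i := ⟨fun j => ⟨n.1 (e ⟨i, j⟩), n.2.2 ⟨i, j⟩⟩, fun j j' hjj' => by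
    have := e.injective (n.2.1 (congrArg Subtype.val hjj'))
    simpa using this⟩
  invFun f := ⟨fun q => f (e.symm q).1 (e.symm q).2, by
    have key : ∀ p p' : (i : Fin k) × Fin (a i),
        ((f p.1 p.2 : S p.1) : ℤ) = (f p'.1 p'.2 : S p'.1) → p = p' := by
      rintro ⟨i, j⟩ ⟨i', j'⟩ h
      obtain rfl : i = i' := by
        by_contra hne
        refine Set.disjoint_left.1 (hS i i' hne) (f i j).2 ?_
        rw [h]
        exact (f i' j').2
      obtain rfl : j = j' := (f i).injective (Subtype.ext h)
      rfl
    exact fun q q' h => e.symm.injective (key _ _ h), fun p => by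
      beta_reduce
      rw [e.symm_apply_apply]
      exact (f p.1 p.2).2⟩
  left_inv n := by
    ext q
    exact congrArg n.1 (e.apply_symm_apply q)
  right_inv f := by
    ext i j
    change ((f (e.symm (e ⟨i, j⟩)).1 (e.symm (e ⟨i, j⟩)).2 : S _) : ℤ) = f i j
    rw [e.symm_apply_apply]

/-- The set of configurations with `a i` coordinates in the interval `[aI i, bI i]`. -/
def blockBox {k m : ℕ} (aI bI : Fin k → ℝ) {a : Fin k → ℕ}
    (e : ((i : Fin k) × Fin (a i)) ≃ Fin m) : Set (Fin m → ℝ) :=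
  {y | ∀ p, y (e p) ∈ Set.Icc (aI p.1) (bI p.1)}

theorem blockBox_eq_Icc {k m : ℕ} (aI bI : Fin k → ℝ) {a : Fin k → ℕ}
    (e : ((i : Fin k) × Fin (a i)) ≃ Fin m) :
    blockBox aI bI e = Set.Icc (fun q => aI (e.symm q).1) (fun q => bI (e.symm q).1) := by
  ext y
  simp only [blockBox, Set.mem_ofPred_eq, Set.mem_Icc, Pi.le_def, ← forall_and]
  exact e.forall_congr (by simp)

theorem corrSumM_blockBox (h : IsPointMeasure μ) (hinf : InfiniteBothDirections μ)
    {k m : ℕ} {aI bI : Fin k → ℝ}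
    (hdisj : ∀ i j : Fin k, i ≠ j → Disjoint (Set.Icc (aI i) (bI i)) (Set.Icc (aI j) (bI j)))
    {a : Fin k → ℕ} (e : ((i : Fin k) × Fin (a i)) ≃ Fin m) :
    corrSumM μ m ((blockBox aI bI e).indicator fun _ => (1 : ℝ)) =
      ∏ i, (((xLabel μ ⁻¹' Set.Icc (aI i) (bI i)).ncard.descFactorial (a i) : ℕ) : ℝ) := by
  rw [corrSumM_indicator h hinf (by rw [blockBox_eq_Icc]; exact Metric.isBounded_Icc _ _),
    ← Nat.cast_prod, Nat.cast_inj]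
  have hfin : ∀ i, Finite (xLabel μ ⁻¹' Set.Icc (aI i) (bI i)) := fun i =>
    finite_preimage_xLabel h hinf (Metric.isBounded_Icc _ _)
  have := fun i => Fintype.ofFinite (xLabel μ ⁻¹' Set.Icc (aI i) (bI i))
  rw [← Nat.card_coe_set_eq]
  refine (Nat.card_congr (injectiveTuplesEquiv e
    (S := fun i => xLabel μ ⁻¹' Set.Icc (aI i) (bI i))
    fun i j hij => (hdisj i j hij).preimage _)).trans ?_
  rw [Nat.card_pi]
  refine Finset.prod_congr rfl fun i _ => ?_
  rw [Nat.card_eq_fintype_card, Fintype.card_embedding_eq, Fintype.card_fin,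
    ← Nat.card_eq_fintype_card, Nat.card_coe_set_eq]

end CorrelationSum

section OccupationSeries

/-- Binomial inversion for falling factorials. -/
theorem sum_neg_one_pow_descFactorial (N l : ℕ) :
    ∑ n ∈ Finset.range (N + 1), (-1 : ℝ) ^ n / (n.factorial : ℝ) * (N.descFactorial (l + n) : ℝ) =
      if N = l then (l.factorial : ℝ) else 0 := by
  have hterm : ∀ n : ℕ, (-1 : ℝ) ^ n / (n.factorial : ℝ) * (N.descFactorial (l + n) : ℝ) =
      N.descFactorial l * ((-1 : ℝ) ^ n * ((N - l).choose n : ℝ)) := fun n => by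
    have h1 : N.descFactorial (l + n) = n.factorial * (N - l).choose n * N.descFactorial l := by
      rw [← Nat.descFactorial_eq_factorial_mul_choose, ← Nat.descFactorial_mul_descFactorial
        (Nat.le_add_right l n), Nat.add_sub_cancel_left]
    have h2 : (n.factorial : ℝ) ≠ 0 := by positivity
    rw [h1]
    push_cast
    field_simp
  simp_rw [hterm]
  rw [← Finset.mul_sum]
  rcases lt_or_ge N l with hlt | hle
  · rw [Nat.descFactorial_of_lt hlt, if_neg hlt.ne]
    simp
  · have hsub : ∑ n ∈ Finset.range (N + 1), (-1 : ℝ) ^ n * ((N - l).choose n : ℝ) =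
        ∑ n ∈ Finset.range (N - l + 1), (-1 : ℝ) ^ n * ((N - l).choose n : ℝ) := by
      symm
      refine Finset.sum_subset (Finset.range_subset_range.2 (by lia)) fun n _ hn => ?_
      rw [Finset.mem_range, not_lt] at hn
      rw [Nat.choose_eq_zero_of_lt (by lia)]
      simp
    have halt : ∑ n ∈ Finset.range (N - l + 1), (-1 : ℝ) ^ n * ((N - l).choose n : ℝ) =
        if N - l = 0 then 1 else 0 := by
      have := Int.alternating_sum_range_choose (n := N - l)
      exact_mod_cast congrArg (Int.cast : ℤ → ℝ) this
    rw [hsub, halt]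
    by_cases h : N = l
    · subst h
      simp [Nat.descFactorial_self]
    · rw [if_neg h, if_neg (by lia), mul_zero]

theorem tsum_neg_one_pow_prod_descFactorial {k : ℕ} (N l : Fin k → ℕ) :
    ∑' n : Fin k → ℕ, ((-1 : ℝ) ^ (∑ i, n i) / ∏ i, ((n i).factorial : ℝ)) *
        ∏ i, ((N i).descFactorial (l i + n i) : ℝ) =
      if N = l then ∏ i, ((l i).factorial : ℝ) else 0 := by
  have hprod : ∀ n : Fin k → ℕ, ((-1 : ℝ) ^ (∑ i, n i) / ∏ i, ((n i).factorial : ℝ)) *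
        ∏ i, ((N i).descFactorial (l i + n i) : ℝ) =
      ∏ i, ((-1 : ℝ) ^ n i / ((n i).factorial : ℝ) * ((N i).descFactorial (l i + n i) : ℝ)) := by
    intro n
    rw [Finset.prod_mul_distrib, Finset.prod_div_distrib, Finset.prod_pow_eq_pow_sum]
  rw [tsum_congr hprod, tsum_eq_sum (s := Fintype.piFinset fun i => Finset.range (N i + 1)),
    ← Finset.prod_univ_sum (fun i => Finset.range (N i + 1)) fun i n =>
      (-1 : ℝ) ^ n / (n.factorial : ℝ) * ((N i).descFactorial (l i + n) : ℝ)]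
  · simp_rw [sum_neg_one_pow_descFactorial]
    by_cases h : N = l
    · simp [h]
    · obtain ⟨i, hi⟩ := Function.ne_iff.1 h
      rw [if_neg h, Finset.prod_eq_zero (Finset.mem_univ i) (if_neg hi)]
  · intro n hn
    simp only [Fintype.mem_piFinset, Finset.mem_range, not_forall, not_lt] at hn
    obtain ⟨i, hi⟩ := hn
    refine Finset.prod_eq_zero (Finset.mem_univ i) ?_
    rw [Nat.descFactorial_of_lt (by lia), Nat.cast_zero, mul_zero]

theorem summable_prod_pi {k : ℕ} {g : Fin k → ℕ → ℝ} (h0 : ∀ i n, 0 ≤ g i n)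
    (hg : ∀ i, Summable (g i)) : Summable fun n : Fin k → ℕ => ∏ i, g i (n i) := by
  classical
  refine summable_of_sum_le (c := ∏ i, ∑' n, g i n)
    (fun n => Finset.prod_nonneg fun i _ => h0 i _) fun u => ?_
  calc ∑ n ∈ u, ∏ i, g i (n i)
      ≤ ∑ n ∈ Fintype.piFinset fun i => u.image fun n => n i, ∏ i, g i (n i) :=
        Finset.sum_le_sum_of_subset_of_nonneg
          (fun n hn => Fintype.mem_piFinset.2 fun i => Finset.mem_image_of_mem _ hn)
          fun n _ _ => Finset.prod_nonneg fun i _ => h0 i _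
    _ = ∏ i, ∑ n ∈ u.image fun n => n i, g i n := (Finset.prod_univ_sum _ _).symm
    _ ≤ ∏ i, ∑' n, g i n := Finset.prod_le_prod
        (fun i _ => Finset.sum_nonneg fun n _ => h0 i n)
        fun i _ => (hg i).sum_le_tsum _ fun n _ => h0 i n

theorem sineCorrInt_nonneg {k : ℕ} (aI bI : Fin k → ℝ) (a : Fin k → ℕ) :
    0 ≤ sineCorrInt k aI bI a :=
  integral_nonneg fun y => sineDet_nonneg y

theorem sineCorrInt_le {k : ℕ} (aI bI : Fin k → ℝ) (a : Fin k → ℕ) :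
    sineCorrInt k aI bI a ≤ ∏ i, max (bI i - aI i) 0 ^ a i := by
  have hbox : {y : ((i : Fin k) × Fin (a i)) → ℝ | ∀ p, y p ∈ Set.Icc (aI p.1) (bI p.1)} =
      Set.Icc (fun p => aI p.1) (fun p => bI p.1) := by
    ext y
    simp [Pi.le_def, forall_and]
  have hvol : (volume (Set.Icc (fun p : (i : Fin k) × Fin (a i) => aI p.1)
      (fun p => bI p.1))).toReal = ∏ i, max (bI i - aI i) 0 ^ a i := by
    rw [Real.volume_Icc_pi, ENNReal.toReal_prod, Fintype.prod_sigma]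
    simp [ENNReal.toReal_ofReal']
  rw [sineCorrInt, hbox, ← hvol]
  have hfin : volume (Set.Icc (fun p : (i : Fin k) × Fin (a i) => aI p.1)
      (fun p => bI p.1)) < ⊤ := (Metric.isBounded_Icc _ _).measure_lt_top
  have := norm_setIntegral_le_of_norm_le_const (f := sineDet) (C := 1) hfin fun y _ => by
    rw [Real.norm_of_nonneg (sineDet_nonneg y)]
    exact sineDet_le_one y
  rw [one_mul] at this
  exact (le_abs_self _).trans this

theorem summable_sineCorrInt {k : ℕ} (aI bI : Fin k → ℝ) (l : Fin k → ℕ) :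
    Summable fun n : Fin k → ℕ => |((-1 : ℝ) ^ (∑ i, n i) / ∏ i, ((n i).factorial : ℝ)) *
      sineCorrInt k aI bI (fun i => l i + n i)| := by
  refine Summable.of_nonneg_of_le (fun _ => abs_nonneg _) (fun n => ?_)
    (summable_prod_pi (g := fun i n => max (bI i - aI i) 0 ^ l i *
      (max (bI i - aI i) 0 ^ n / (n.factorial : ℝ))) (fun i n => by positivity)
      fun i => (Real.summable_pow_div_factorial _).mul_left _)
  have hpos : (0 : ℝ) < ∏ i, ((n i).factorial : ℝ) :=
    Finset.prod_pos fun i _ => by positivity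
  rw [abs_mul, abs_div, abs_pow, abs_neg, abs_one, one_pow, abs_of_pos hpos,
    abs_of_nonneg (sineCorrInt_nonneg _ _ _)]
  calc 1 / (∏ i, ((n i).factorial : ℝ)) * sineCorrInt k aI bI (fun i => l i + n i)
      ≤ 1 / (∏ i, ((n i).factorial : ℝ)) * ∏ i, max (bI i - aI i) 0 ^ (l i + n i) := by
        gcongr
        exact sineCorrInt_le _ _ _
    _ = _ := by
        simp_rw [pow_add, ← mul_div_assoc]
        rw [Finset.prod_div_distrib]
        ring

theorem setIntegral_blockBox {k m : ℕ} (aI bI : Fin k → ℝ) {a : Fin k → ℕ}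
    (e : ((i : Fin k) × Fin (a i)) ≃ Fin m) :
    ∫ x in blockBox aI bI e, sineDet x = sineCorrInt k aI bI a := by
  have hmp := volume_measurePreserving_piCongrLeft (fun _ : (i : Fin k) × Fin (a i) => ℝ) e.symm
  have := hmp.setIntegral_preimage_emb (MeasurableEquiv.measurableEmbedding _)
    (sineDet : ((i : Fin k) × Fin (a i) → ℝ) → ℝ)
    {y | ∀ p : (i : Fin k) × Fin (a i), y p ∈ Set.Icc (aI p.1) (bI p.1)}
  rw [sineCorrInt, ← this]
  have hval : ∀ (x : Fin m → ℝ) p,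
      MeasurableEquiv.piCongrLeft (fun _ : (i : Fin k) × Fin (a i) => ℝ) e.symm x p = x (e p) := by
    intro x p
    obtain ⟨q, rfl⟩ := e.symm.surjective p
    rw [MeasurableEquiv.coe_piCongrLeft, Equiv.piCongrLeft_apply_apply, Equiv.apply_symm_apply]
  congr 1
  · congr 1
    ext x
    simp only [blockBox, Set.mem_preimage, Set.mem_ofPred_eq, hval]
  · ext x
    rw [← sineDet_comp_equiv e x]
    congr 1
    ext p
    exact (hval x p).symm

end OccupationSeries

section PointProcess

variable {Ω : Type*} [MeasurableSpace Ω] {P : Measure Ω} {ξ : Ω → Measure ℝ}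

theorem integrable_corrSumM_ball
    (hcorr : ∀ k : ℕ, 1 ≤ k → ∀ B : Set (Fin k → ℝ), MeasurableSet B → IsBounded B →
      ∫ ω, corrSumM (ξ ω) k (B.indicator fun _ => (1 : ℝ)) ∂P = ∫ x in B, sineDet x)
    {m : ℕ} (hm : 1 ≤ m) {r : ℝ} (hr : (m : ℝ) < r) :
    Integrable (fun ω => corrSumM (ξ ω) m
      ((Metric.ball (0 : Fin m → ℝ) r).indicator fun _ => (1 : ℝ))) P := by
  by_contra h
  have := hcorr m hm _ Metric.isOpen_ball.measurableSet (Metric.isBounded_ball (x := 0) (r := r))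
  rw [integral_undef h] at this
  exact (setIntegral_sineDet_ball_pos m hr).ne this

/-- The number of points of `μ` in `B`, as a natural number. -/
noncomputable def pointCount (μ : Measure ℝ) (B : Set ℝ) : ℕ := ⌊(μ B).toReal⌋₊

theorem measurable_pointCount (hξ : Measurable ξ) {B : Set ℝ} (hB : MeasurableSet B) :
    Measurable fun ω => pointCount (ξ ω) B :=
  Nat.measurable_floor.comp ((Measure.measurable_measure.1 hξ B hB).ennreal_toReal)

theorem pointCount_eq {μ : Measure ℝ} {B : Set ℝ} {n : ℕ} (h : μ B = n) : pointCount μ B = n := by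
  simp [pointCount, h]

theorem IsPointMeasure.measure_eq_iff {μ : Measure ℝ} (h : IsPointMeasure μ) {B : Set ℝ}
    (hB : MeasurableSet B) (hbdd : IsBounded B) (n : ℕ) : μ B = n ↔ pointCount μ B = n := by
  obtain ⟨m, hm⟩ := h B hB hbdd
  rw [pointCount_eq hm, hm, Nat.cast_inj]

theorem integrable_and_integral_prod_descFactorial [IsProbabilityMeasure P] (hξ : Measurable ξ)
    (hpp : ∀ᵐ ω ∂P, IsPointMeasure (ξ ω) ∧ InfiniteBothDirections (ξ ω))
    (hcorr : ∀ k : ℕ, 1 ≤ k → ∀ B : Set (Fin k → ℝ), MeasurableSet B → IsBounded B →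
      ∫ ω, corrSumM (ξ ω) k (B.indicator fun _ => (1 : ℝ)) ∂P = ∫ x in B, sineDet x)
    {k : ℕ} {aI bI : Fin k → ℝ}
    (hdisj : ∀ i j : Fin k, i ≠ j → Disjoint (Set.Icc (aI i) (bI i)) (Set.Icc (aI j) (bI j)))
    (a : Fin k → ℕ) :
    Integrable (fun ω => ∏ i,
      ((pointCount (ξ ω) (Set.Icc (aI i) (bI i))).descFactorial (a i) : ℝ)) P ∧
    ∫ ω, ∏ i, ((pointCount (ξ ω) (Set.Icc (aI i) (bI i))).descFactorial (a i) : ℝ) ∂P =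
      sineCorrInt k aI bI a := by
  rcases Nat.eq_zero_or_pos (∑ i, a i) with h0 | hpos
  · have ha : a = 0 := by
      ext i
      exact Finset.sum_eq_zero_iff.1 h0 i (Finset.mem_univ i)
    subst ha
    refine ⟨by simp, ?_⟩
    have : IsEmpty ((i : Fin k) × Fin ((0 : Fin k → ℕ) i)) := ⟨fun p => Fin.elim0 p.2⟩
    have hu : {y : ((i : Fin k) × Fin ((0 : Fin k → ℕ) i)) → ℝ |
        ∀ p, y p ∈ Set.Icc (aI p.1) (bI p.1)} = Set.univ :=
      Set.eq_univ_of_forall fun y p => isEmptyElim p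
    rw [sineCorrInt, hu]
    simp [sineDet, Matrix.det_isEmpty, volume_pi, measureReal_def]
  · set e : ((i : Fin k) × Fin (a i)) ≃ Fin (∑ i, a i) := finSigmaFinEquiv
    have hbdd : IsBounded (blockBox aI bI e) := by
      rw [blockBox_eq_Icc]
      exact Metric.isBounded_Icc _ _
    have hmeas : MeasurableSet (blockBox aI bI e) := by
      rw [blockBox_eq_Icc]
      exact measurableSet_Icc
    have hae : (fun ω => ∏ i,
        ((pointCount (ξ ω) (Set.Icc (aI i) (bI i))).descFactorial (a i) : ℝ)) =ᵐ[P]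
        fun ω => corrSumM (ξ ω) (∑ i, a i) ((blockBox aI bI e).indicator fun _ => (1 : ℝ)) := by
      filter_upwards [hpp] with ω hω
      rw [corrSumM_blockBox hω.1 hω.2 hdisj]
      refine Finset.prod_congr rfl fun i _ => ?_
      rw [pointCount_eq (ncard_preimage_xLabel hω.1 hω.2 measurableSet_Icc
        (Metric.isBounded_Icc _ _)).symm]
    refine ⟨?_, by rw [integral_congr_ae hae, hcorr _ hpos _ hmeas hbdd, setIntegral_blockBox]⟩
    obtain ⟨r, hr, hsub⟩ := hbdd.subset_ball_lt ((∑ i, a i : ℕ) : ℝ) 0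
    refine (integrable_corrSumM_ball hcorr hpos hr).mono' ?_ ?_
    · exact (Finset.measurable_fun_prod _ fun i _ => (measurable_from_top
        (f := fun n : ℕ => (n.descFactorial (a i) : ℝ))).comp
          (measurable_pointCount hξ measurableSet_Icc)).aestronglyMeasurable
    · filter_upwards [hpp, hae] with ω hω hω'
      rw [Real.norm_of_nonneg (Finset.prod_nonneg fun i _ => Nat.cast_nonneg _), hω']
      exact corrSumM_indicator_mono hω.1 hω.2 hsub Metric.isBounded_ball

end PointProcess

/-- (Prop. `occupation_prop`.) If a point process `ξ` has the correlation measures of the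
sine-kernel process, then for mutually disjoint compact intervals `I_1, ..., I_k` and
nonnegative integers `λ_1, ..., λ_k`,
`P(ξ(I_1) = λ_1, ..., ξ(I_k) = λ_k) = (1/λ!) Σ_{n ∈ ℤ_{≥0}^k} ((−1)^{|n|}/n!) C(I, λ+n)`,
the series converging absolutely. -/
theorem stmt_17 {Ω : Type*} [MeasurableSpace Ω] (P : MeasureTheory.Measure Ω)
    [IsProbabilityMeasure P]
    (ξ : Ω → MeasureTheory.Measure ℝ) (hξ : Measurable ξ)
    (hpp : ∀ᵐ ω ∂P, IsPointMeasure (ξ ω) ∧ InfiniteBothDirections (ξ ω))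
    (hcorr : ∀ k : ℕ, 1 ≤ k → ∀ B : Set (Fin k → ℝ), MeasurableSet B → IsBounded B →
      ∫ ω, corrSumM (ξ ω) k (B.indicator fun _ => (1 : ℝ)) ∂P = ∫ x in B, sineDet x)
    (k : ℕ) (hk : 1 ≤ k) (aI bI : Fin k → ℝ) (lam : Fin k → ℕ)
    (hdisj : ∀ i j : Fin k, i ≠ j →
      Disjoint (Set.Icc (aI i) (bI i)) (Set.Icc (aI j) (bI j))) :
    Summable (fun n : Fin k → ℕ =>
      |((-1 : ℝ) ^ (∑ i, n i) / ∏ i, (Nat.factorial (n i) : ℝ)) *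
        sineCorrInt k aI bI (fun i => lam i + n i)|) ∧
    (P {ω | ∀ i : Fin k, ξ ω (Set.Icc (aI i) (bI i)) = (lam i : ENNReal)}).toReal =
      (1 / ∏ i, (Nat.factorial (lam i) : ℝ)) *
        ∑' n : Fin k → ℕ, ((-1 : ℝ) ^ (∑ i, n i) / ∏ i, (Nat.factorial (n i) : ℝ)) *
          sineCorrInt k aI bI (fun i => lam i + n i) := by
  classical
  refine ⟨summable_sineCorrInt aI bI lam, ?_⟩
  have hD := integrable_and_integral_prod_descFactorial hξ hpp hcorr hdisj
  set c : (Fin k → ℕ) → ℝ := fun n => (-1 : ℝ) ^ (∑ i, n i) / ∏ i, ((n i).factorial : ℝ) with hc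
  set N : Ω → Fin k → ℕ := fun ω i => pointCount (ξ ω) (Set.Icc (aI i) (bI i)) with hN
  set F : (Fin k → ℕ) → Ω → ℝ := fun n ω =>
    c n * ∏ i, ((N ω i).descFactorial (lam i + n i) : ℝ) with hF
  have hFint : ∀ n, Integrable (F n) P := fun n => (hD fun i => lam i + n i).1.const_mul _
  have hFval : ∀ n, ∫ ω, F n ω ∂P = c n * sineCorrInt k aI bI (fun i => lam i + n i) := fun n => by
    rw [integral_const_mul, ← (hD fun i => lam i + n i).2]
  have hFnorm : ∀ n, ∫ ω, ‖F n ω‖ ∂P =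
      |c n * sineCorrInt k aI bI (fun i => lam i + n i)| := fun n => by
    simp only [hF, norm_mul]
    rw [integral_const_mul, abs_mul, abs_of_nonneg (sineCorrInt_nonneg _ _ _),
      ← (hD fun i => lam i + n i).2, Real.norm_eq_abs]
    congr 2
    ext ω
    exact Real.norm_of_nonneg (Finset.prod_nonneg fun i _ => Nat.cast_nonneg _)
  have hswap := integral_tsum_of_summable_integral_norm hFint
    ((summable_sineCorrInt aI bI lam).congr fun n => (hFnorm n).symm)
  have hset : MeasurableSet {ω | ∀ i : Fin k, ξ ω (Set.Icc (aI i) (bI i)) = (lam i : ENNReal)} := by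
    rw [Set.ofPred_forall]
    exact MeasurableSet.iInter fun i =>
      Measure.measurable_measure.1 hξ _ measurableSet_Icc (measurableSet_singleton _)
  have hae : (fun ω => ∑' n, F n ω) =ᵐ[P]
      {ω | ∀ i : Fin k, ξ ω (Set.Icc (aI i) (bI i)) = (lam i : ENNReal)}.indicator
        fun _ => ∏ i, ((lam i).factorial : ℝ) := by
    filter_upwards [hpp] with ω hω
    have hiff : (∀ i : Fin k, ξ ω (Set.Icc (aI i) (bI i)) = (lam i : ENNReal)) ↔ N ω = lam := by
      rw [funext_iff]
      exact forall_congr' fun i =>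
        hω.1.measure_eq_iff measurableSet_Icc (Metric.isBounded_Icc _ _) _
    rw [tsum_neg_one_pow_prod_descFactorial (N ω) lam, Set.indicator_apply]
    exact if_congr hiff.symm rfl rfl
  rw [← tsum_congr hFval, hswap, integral_congr_ae hae, integral_indicator_const _ hset]
  have hne : (∏ i, ((lam i).factorial : ℝ)) ≠ 0 := Finset.prod_ne_zero_iff.2 fun i _ => by positivity
  rw [measureReal_def, smul_eq_mul]
  field_simp
end
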